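/- In the setup below, if dim(r₀ ↾ (A_* ∪ c₀), M_a) is finite, then w_P(q(M_a), A_* ∪ ⋃_{i<k} c_i) is finite. -/

import Mathlib

open FirstOrder Language Cardinal

universe u

namespace Benign

variable {L : FirstOrder.Language.{u, u}} {M : Type u} [L.Structure M]

/-- Two tuples (indexed by a type `α`) realize the same complete `L`-type over the
parameter set `A`. -/
def SameTypeOver (A : Set M) {α : Type} (x y : α → M) : Prop :=
  ∀ φ : L.Formula (α ⊕ ↥A),
    φ.Realize (Sum.elim x Subtype.val) ↔ φ.Realize (Sum.elim y Subtype.val)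

/-- Two tuples realize the same strong type over `A`: they realize the same type over `A`,
and they are equivalent under every `A`-definable equivalence relation with finitely many
classes. -/
def SameStrongTypeOver (A : Set M) {α : Type} (x y : α → M) : Prop :=
  SameTypeOver (L := L) A x y ∧
    ∀ φ : L.Formula ((α ⊕ α) ⊕ ↥A),
      (Equivalence fun u v : α → M => φ.Realize (Sum.elim (Sum.elim u v) Subtype.val)) →
      (∃ k : ℕ, ∀ g : Fin (k + 1) → α → M, ∃ i j, i ≠ j ∧
          φ.Realize (Sum.elim (Sum.elim (g i) (g j)) Subtype.val)) →
      φ.Realize (Sum.elim (Sum.elim x y) Subtype.val)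

/-- The language consisting of a single unary predicate symbol `P`. -/
def unaryLang : FirstOrder.Language.{0, 0} := ⟨fun _ => Empty, fun n => PLift (n = 1)⟩

/-- The interpretation of the unary predicate `P` as membership in `A`. -/
def unaryStructure (A : Set M) : unaryLang.Structure M where
  funMap := fun f _ => f.elim
  RelMap := fun {n} r v => v (Fin.cast r.down.symm 0) ∈ A

/-- Two tuples realize the same type over `A` in the expanded language
`L* = L ∪ {P}` where the new unary predicate `P` is interpreted as `A`. -/
def SameLstarTypeOver (A : Set M) {α : Type} (x y : α → M) : Prop :=
  letI : unaryLang.Structure M := unaryStructure A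
  SameTypeOver (L := L.sum unaryLang) A x y

/-- `A` is benign in `M`: tuples with the same `L`-type over `A` have the same `L*`-type
over `A`. -/
def IsBenign (A : Set M) : Prop :=
  ∀ (n : ℕ) (x y : Fin n → M),
    SameTypeOver (L := L) A x y → SameLstarTypeOver (L := L) A x y

/-- `A` is weakly benign in `M`: tuples with the same strong type over `A` have the same
`L*`-type over `A`. -/
def IsWeaklyBenign (A : Set M) : Prop :=
  ∀ (n : ℕ) (x y : Fin n → M),
    SameStrongTypeOver (L := L) A x y → SameLstarTypeOver (L := L) A x y


/-- The cardinality of the theory: `|T| = |L| + ℵ₀`. -/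
noncomputable def cardL (L : FirstOrder.Language.{u, u}) : Cardinal.{u} :=
  L.card ⊔ ℵ₀

/-- `T` is stable in `κ`: over every parameter set of size at most `κ` in a model of `T`
there are at most `κ` complete types. -/
def StableIn (L : FirstOrder.Language.{u, u}) (T : L.Theory) (κ : Cardinal.{u}) : Prop :=
  ∀ (N : Type u) (_ : L.Structure N), N ⊨ T → ∀ A : Set N, #A ≤ κ →
    ∀ n : ℕ, #(((L[[↥A]]).completeTheory N).CompleteType (Fin n)) ≤ κ

/-- `T` is stable: stable in some cardinal. -/
def Stable (L : FirstOrder.Language.{u, u}) (T : L.Theory) : Prop :=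
  ∃ κ, StableIn L T κ

/-- `T` is superstable: stable in every cardinal `κ ≥ 2 ^ |T|`. -/
def Superstable (L : FirstOrder.Language.{u, u}) (T : L.Theory) : Prop :=
  ∀ κ : Cardinal.{u}, 2 ^ cardL L ≤ κ → StableIn L T κ

/-- `T` is `ω`-stable. -/
def OmegaStable (L : FirstOrder.Language.{u, u}) (T : L.Theory) : Prop :=
  StableIn L T ℵ₀

/-- `M` is `κ`-saturated as an `L'`-structure: every finitely satisfiable set of
`L'`-formulas in one free variable over fewer than `κ` parameters is realized. -/
def SaturatedIn (L' : FirstOrder.Language.{u, u}) [L'.Structure M] (κ : Cardinal.{u}) : Prop :=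
  ∀ S : Set M, #S < κ →
    ∀ p : Set (L'.Formula (Fin 1 ⊕ ↥S)),
      (∀ fs : Finset (L'.Formula (Fin 1 ⊕ ↥S)), ↑fs ⊆ p →
        ∃ x : M, ∀ φ ∈ fs, φ.Realize (Sum.elim ![x] Subtype.val)) →
      ∃ x : M, ∀ φ ∈ p, φ.Realize (Sum.elim ![x] Subtype.val)

/-- The pair `(M, A)` is `κ`-saturated as a structure in the language `L* = L ∪ {P}`. -/
def PairSaturated (A : Set M) (κ : Cardinal.{u}) : Prop :=
  letI : unaryLang.Structure M := unaryStructure A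
  SaturatedIn (M := M) (L.sum unaryLang) κ

/-- A subset `N ⊆ M` is (the universe of) an elementary substructure of `M`
(Tarski–Vaught test). -/
def ElemSubset (N : Set M) : Prop :=
  N.Nonempty ∧
    ∀ (n : ℕ) (φ : L.BoundedFormula (Fin n) 1) (a : Fin n → M), (∀ i, a i ∈ N) →
      (∃ x : M, φ.Realize a ![x]) → ∃ x ∈ N, φ.Realize a ![x]

/-- `B` is relatively `κ`-saturated in `A`: every type over a subset of `B` of size `< κ`
which is realized (by a finite tuple) in `A` is realized in `B`. -/
def RelKappaSaturated (κ : Cardinal.{u}) (B A : Set M) : Prop :=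
  B ⊆ A ∧
    ∀ S : Set M, S ⊆ B → #S < κ →
      ∀ (n : ℕ) (a : Fin n → M), (∀ i, a i ∈ A) →
        ∃ b : Fin n → M, (∀ i, b i ∈ B) ∧ SameTypeOver (L := L) S a b

/-- A subset `N ⊆ M` is `κ`-saturated (as a structure in its own right, computed inside
`M`): every set of formulas over `< κ` parameters from `N` which is finitely satisfiable
in `N` is realized in `N`. -/
def SubsetSaturated (κ : Cardinal.{u}) (N : Set M) : Prop :=
  ∀ S : Set M, S ⊆ N → #S < κ →
    ∀ p : Set (L.Formula (Fin 1 ⊕ ↥S)),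
      (∀ fs : Finset (L.Formula (Fin 1 ⊕ ↥S)), ↑fs ⊆ p →
        ∃ x ∈ N, ∀ φ ∈ fs, φ.Realize (Sum.elim ![x] Subtype.val)) →
      ∃ x ∈ N, ∀ φ ∈ p, φ.Realize (Sum.elim ![x] Subtype.val)

/-- `f` is a sequence of `m`-tuples which is indiscernible over `C`. -/
def IndiscOver (C : Set M) {m : ℕ} (f : ℕ → Fin m → M) : Prop :=
  ∀ (k : ℕ) (i j : Fin k → ℕ), StrictMono i → StrictMono j →
    SameTypeOver (L := L) C
      (fun s : Fin k × Fin m => f (i s.1) s.2) (fun s : Fin k × Fin m => f (j s.1) s.2)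

/-- The formula `φ(x̄, b)` divides over `C`: there is a `C`-indiscernible sequence starting
with `b` along which the instances of `φ` are `k`-inconsistent. -/
def Divides (C : Set M) {n m : ℕ} (φ : L.Formula (Fin n ⊕ Fin m)) (b : Fin m → M) : Prop :=
  ∃ f : ℕ → Fin m → M, f 0 = b ∧ IndiscOver (L := L) C f ∧
    ∃ k : ℕ, 0 < k ∧ ∀ i : Fin k → ℕ, StrictMono i →
      ¬ ∃ a : Fin n → M, ∀ j : Fin k, φ.Realize (Sum.elim a (f (i j)))

/-- `tp(a / B)` forks over `C`: the type implies a finite disjunction of formulas,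
each of which divides over `C`. -/
def TupForksOver {n : ℕ} (a : Fin n → M) (B C : Set M) : Prop :=
  ∃ (r : ℕ) (ms : Fin r → ℕ) (φ : ∀ i : Fin r, L.Formula (Fin n ⊕ Fin (ms i)))
    (b : ∀ i : Fin r, Fin (ms i) → M),
    (∀ i, Divides (L := L) C (φ i) (b i)) ∧
    ∀ a' : Fin n → M, SameTypeOver (L := L) B a a' →
      ∃ i, (φ i).Realize (Sum.elim a' (b i))

/-- The tuple `a` is independent from `X` over `C` (nonforking independence). -/
def TupIndepOver {n : ℕ} (a : Fin n → M) (X C : Set M) : Prop :=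
  ¬ TupForksOver (L := L) a (X ∪ C) C

/-- The set `Y` is independent from `X` over `C`: the type of every finite tuple from `Y`
over `X ∪ C` does not fork over `C`. -/
def IndepOver (Y X C : Set M) : Prop :=
  ∀ (n : ℕ) (a : Fin n → M), (∀ i, a i ∈ Y) → TupIndepOver (L := L) a X C

/-- `g` is an elementary map on the set `D`. -/
def ElemOn (D : Set M) (g : M → M) : Prop :=
  ∀ (n : ℕ) (a : Fin n → M), (∀ i, a i ∈ D) →
    SameTypeOver (L := L) (∅ : Set M) a (g ∘ a)

/-- The algebraic closure of `B` inside `M`. -/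
def aclSet (B : Set M) : Set M :=
  {x | ∃ φ : L.Formula (Fin 1 ⊕ ↥B), φ.Realize (Sum.elim ![x] Subtype.val) ∧
        {y : M | φ.Realize (Sum.elim ![y] Subtype.val)}.Finite}

/-- The type `tp(d / B)` is algebraic. -/
def AlgebraicTp (B : Set M) {n : ℕ} (d : Fin n → M) : Prop :=
  {d' : Fin n → M | SameTypeOver (L := L) B d d'}.Finite

/-- The types `tp(d / B)` and `tp(e / C)` are orthogonal: over any common extension `D`
of the domains, realizations of the respective nonforking extensions are independent. -/
def TypesOrthogonal {n m : ℕ} (B : Set M) (d : Fin n → M) (C : Set M) (e : Fin m → M) :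
    Prop :=
  ∀ (D : Set M) (d' : Fin n → M) (e' : Fin m → M), B ⊆ D → C ⊆ D →
    SameTypeOver (L := L) B d d' → ¬ TupForksOver (L := L) d' D B →
    SameTypeOver (L := L) C e e' → ¬ TupForksOver (L := L) e' D C →
    ¬ TupForksOver (L := L) d' (D ∪ Set.range e') D

/-- The type `tp(d / B)` is orthogonal to the set `A`: it is orthogonal to every complete
type over `acl(A)`. -/
def TypeOrthSet (B : Set M) {n : ℕ} (d : Fin n → M) (A : Set M) : Prop :=
  ∀ (m : ℕ) (e : Fin m → M), TypesOrthogonal (L := L) B d (aclSet (L := L) A) e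

/-- `tp(Na / Ma)` is orthogonal to the type `tp(e / Ma)`: the type over `Ma` of every
finite tuple from `Na` is orthogonal to it. -/
def SetTpOrth (Na Ma : Set M) {m : ℕ} (e : Fin m → M) : Prop :=
  ∀ (n : ℕ) (d : Fin n → M), (∀ i, d i ∈ Na) →
    TypesOrthogonal (L := L) Ma d Ma e

/-- The type `tp(d / B)` is regular: it is orthogonal to all of its forking extensions. -/
def TypeRegular (B : Set M) {n : ℕ} (d : Fin n → M) : Prop :=
  ∀ (D : Set M) (d' : Fin n → M), B ⊆ D →
    SameTypeOver (L := L) B d d' → TupForksOver (L := L) d' D B →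
    TypesOrthogonal (L := L) B d D d'

/-- The type `tp(d / B)` is stationary: it has a unique nonforking extension to every
superset of its domain. -/
def TypeStationary (B : Set M) {n : ℕ} (d : Fin n → M) : Prop :=
  ∀ D : Set M, B ⊆ D → ∀ d₁ d₂ : Fin n → M,
    SameTypeOver (L := L) B d d₁ → SameTypeOver (L := L) B d d₂ →
    ¬ TupForksOver (L := L) d₁ D B → ¬ TupForksOver (L := L) d₂ D B →
    SameTypeOver (L := L) D d₁ d₂

/-- `D` is `κ`-atomic over `B`: the type of every finite tuple from `D` over `B` is
implied by its restriction to a subset of `B` of size `< κ`. -/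
def KappaAtomicOver (κ : Cardinal.{u}) (D B : Set M) : Prop :=
  ∀ (n : ℕ) (d : Fin n → M), (∀ i, d i ∈ D) →
    ∃ S : Set M, S ⊆ B ∧ #S < κ ∧
      ∀ d' : Fin n → M, SameTypeOver (L := L) S d d' → SameTypeOver (L := L) B d d'

/-- `N` is `κ`-prime over `X`: `N` is a `κ`-saturated elementary substructure containing
`X` which elementarily embeds over `X` into every `κ`-saturated elementary substructure
containing `X`. -/
def KappaPrimeOver (κ : Cardinal.{u}) (N X : Set M) : Prop :=
  ElemSubset (L := L) N ∧ X ⊆ N ∧ SubsetSaturated (L := L) κ N ∧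
    ∀ N' : Set M, ElemSubset (L := L) N' → X ⊆ N' → SubsetSaturated (L := L) κ N' →
      ∃ g : M → M, ElemOn (L := L) N g ∧ (∀ x ∈ X, g x = x) ∧ g '' N ⊆ N'

/-- `Ma` is `A`-full in `M`. -/
def AFull (A Ma : Set M) (κ : Cardinal.{u}) : Prop :=
  ∀ N : Set M, KappaPrimeOver (L := L) κ N (Ma ∪ A) →
    ∀ C0 C1 C2 : Set M, C0 ⊆ Ma → C1 ⊆ A → C0 ⊆ C2 → C1 ⊆ C2 → C2 ⊆ N →
      #C0 ≤ cardL L → #C1 ≤ cardL L → #C2 ≤ cardL L →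
      ∃ f : M → M, ElemOn (L := L) (C1 ∪ C2) f ∧ (∀ x ∈ C0, f x = x) ∧
        f '' (C1 ∪ C2) ⊆ Ma ∧ f '' C1 ⊆ A ∧
        (IndepOver (L := L) C2 A C1 → IndepOver (L := L) (f '' C2) A (f '' C1))

/-- `(M₁, A₁) ∈ K_c`. -/
structure Kc (κ : Cardinal.{u}) (A : Set M) (c : M) (M₁ A₁ : Set M) : Prop where
  elem : ElemSubset (L := L) M₁
  mem : c ∈ M₁
  relSat : RelKappaSaturated (L := L) κ A₁ A
  sub : A₁ ⊆ M₁
  indep : IndepOver (L := L) M₁ A A₁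
  cardA₁ : #A₁ ≤ κ
  cardM₁ : #M₁ ≤ κ
  sat : SubsetSaturated (L := L) κ M₁

/-- `⟨A₁, Ma, Mb, Na, g⟩ ∈ K¹_{a,b}`. -/
structure K1 (κ : Cardinal.{u}) (A : Set M) (a b : M) (A₁ Ma Mb Na : Set M)
    (g : M → M) : Prop where
  ka : Kc (L := L) κ A a Ma A₁
  kb : Kc (L := L) κ A b Mb A₁
  gBij : Set.BijOn g Ma Mb
  gFix : ∀ x ∈ A₁, g x = x
  gElem : ElemOn (L := L) Ma g
  gab : g a = b
  sub : Ma ⊆ Na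
  elemNa : ElemSubset (L := L) Na
  satNa : SubsetSaturated (L := L) κ Na
  cardNa : #Na = κ
  indepNa : IndepOver (L := L) Na A A₁

/-- `⟨A₁, Ma, Mb, Na, g⟩ ∈ K²_{a,b}`: additionally `g` is an isomorphism of `Ma^eq` onto
`Mb^eq` over `A₁^eq`, i.e. `g` preserves strong types over `A₁`. -/
def K2 (κ : Cardinal.{u}) (A : Set M) (a b : M) (A₁ Ma Mb Na : Set M)
    (g : M → M) : Prop :=
  K1 (L := L) κ A a b A₁ Ma Mb Na g ∧
    ∀ (n : ℕ) (t : Fin n → M), (∀ i, t i ∈ Ma) →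
      SameStrongTypeOver (L := L) A₁ t (g ∘ t)

/-- `K^i_{a,b}` for `i ∈ {1,2}` (`two = false` gives `K¹`, `two = true` gives `K²`). -/
def Ki (two : Bool) (κ : Cardinal.{u}) (A : Set M) (a b : M) (A₁ Ma Mb Na : Set M)
    (g : M → M) : Prop :=
  if two then K2 (L := L) κ A a b A₁ Ma Mb Na g
  else K1 (L := L) κ A a b A₁ Ma Mb Na g

/-- `d'` realizes `g(tp(d / Ma))`. -/
def RealizesGType (Ma : Set M) (g : M → M) {n : ℕ} (d d' : Fin n → M) : Prop :=
  ∀ (k : ℕ) (m : Fin k → M), (∀ i, m i ∈ Ma) →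
    ∀ φ : L.Formula (Fin n ⊕ Fin k),
      φ.Realize (Sum.elim d m) ↔ φ.Realize (Sum.elim d' (g ∘ m))

/-- The data `⟨A₁, Ma, Mb, Na, g⟩ ∈ K²_{a,b}` satisfies the conclusion of the
characterization of failure of weak benignity (conditions (a)–(f) of the main lemma). -/
structure CharWitness (κ : Cardinal.{u}) (A : Set M) (a b : M) (Astar Ma Mb Na : Set M)
    (g : M → M) : Prop where
  k2 : K2 (L := L) κ A a b Astar Ma Mb Na g
  ne : Ma ≠ Na
  full : AFull (L := L) A Ma κ
  indepNa : IndepOver (L := L) Na A Astar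
  orth : ∀ (n : ℕ) (e : Fin n → M), ¬ AlgebraicTp (L := L) Ma e →
    TypeOrthSet (L := L) Ma e A → SetTpOrth (L := L) Na Ma e
  noCopy : ∀ (n : ℕ) (d : Fin n → M), (∀ i, d i ∈ Na) → ¬ (∀ i, d i ∈ Ma) →
    ¬ ∃ d' : Fin n → M, RealizesGType (L := L) Ma g d d' ∧
        TupIndepOver (L := L) d' A Mb
  gStrong : ∀ (n : ℕ) (t : Fin n → M), (∀ i, t i ∈ Ma) →
    SameStrongTypeOver (L := L) Astar t (g ∘ t)

/-- An `L*`-elementary map from `(M, A)` to `(M', A')`. -/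
def LstarElementary {M' : Type u} [L.Structure M'] (A : Set M) (A' : Set M')
    (h : M → M') : Prop :=
  ∀ (n : ℕ) (φ : (L.sum unaryLang).Formula (Fin n)) (v : Fin n → M),
    (letI : unaryLang.Structure M := unaryStructure A; φ.Realize v) ↔
    (letI : unaryLang.Structure M' := unaryStructure A'; φ.Realize (h ∘ v))

/-- The family `I` of tuples is independent over `Y`: each member is independent over `Y`
from the union of the other members. -/
def IndepFamily (Y : Set M) (I : Set (Σ m : ℕ, Fin m → M)) : Prop :=
  ∀ t ∈ I, TupIndepOver (L := L) t.2 (⋃ s ∈ I \ {t}, Set.range s.2) Y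

/-- `tp(t / Y)` belongs to the family `P` of regular stationary types nonorthogonal to
`p* = tp(dstar / Pbase)`. -/
def InP {nd : ℕ} (Pbase : Set M) (dstar : Fin nd → M) {m : ℕ} (Y : Set M)
    (t : Fin m → M) : Prop :=
  TypeRegular (L := L) Y t ∧ TypeStationary (L := L) Y t ∧
    ¬ TypesOrthogonal (L := L) Y t Pbase dstar

/-- The `P`-weight `w_P(X, Y)` of the set `X` over the set `Y`, where
`P = {p : p regular, stationary, nonorthogonal to p* = tp(dstar / Pbase)}`: the supremum
of cardinalities of `Y`-independent families of tuples realizing types in `P` over `Y`,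
each of which forks with `X` over `Y`. -/
noncomputable def wP {nd : ℕ} (Pbase : Set M) (dstar : Fin nd → M) (X Y : Set M) :
    Cardinal.{u} :=
  sSup { c : Cardinal.{u} | ∃ I : Set (Σ m : ℕ, Fin m → M), #I = c ∧
    IndepFamily (L := L) Y I ∧
    ∀ t ∈ I, InP (L := L) Pbase dstar Y t.2 ∧
      TupForksOver (L := L) t.2 (Y ∪ X) Y }

/-- The set of realizations in `X` of the (1-)type `tp(e / B)`. -/
def qSet (B : Set M) (e : M) (X : Set M) : Set M :=
  {x ∈ X | SameTypeOver (L := L) B ![x] ![e]}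

/-- `dim(tp(d / B), N)` is finite: there is no infinite sequence of realizations of the
type in `N`, chosen successively independent. -/
def DimFinite (B : Set M) {n : ℕ} (d : Fin n → M) (N : Set M) : Prop :=
  ¬ ∃ f : ℕ → Fin n → M,
    ∀ j : ℕ, (∀ i, f j i ∈ N) ∧ SameTypeOver (L := L) B d (f j) ∧
      ¬ TupForksOver (L := L) (f j) (B ∪ ⋃ l ∈ Set.Iio j, Set.range (f l)) B

/-- The definable subsets (with parameters) of `N^n`. -/
def DefSet (N : Type u) [L.Structure N] (n : ℕ) : Set (Set (Fin n → N)) :=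
  {X | ∃ (m : ℕ) (φ : L.Formula (Fin n ⊕ Fin m)) (b : Fin m → N),
    X = {v | φ.Realize (Sum.elim v b)}}

/-- The Morley rank of the (definable) set `X` is at least `α`. -/
def MRge {N : Type u} [L.Structure N] {n : ℕ} (X : Set (Fin n → N)) (α : Ordinal.{u}) :
    Prop :=
  X.Nonempty ∧ ∀ β, β < α → ∃ f : ℕ → Set (Fin n → N),
    (∀ i, f i ∈ DefSet (L := L) N n ∧ f i ⊆ X ∧ MRge (f i) β) ∧
    Pairwise (Function.onFun Disjoint f)
termination_by α
decreasing_by exact ‹β < α›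

/-- The theory `T` has Morley rank `2`: in every `ℵ₀`-saturated model, the rank of the
whole universe (in one variable) is exactly `2`. -/
def MorleyRankTwo (L : FirstOrder.Language.{u, u}) (T : L.Theory) : Prop :=
  ∀ (N : Type u) (_ : L.Structure N), N ⊨ T → SaturatedIn (M := N) L ℵ₀ →
    MRge (L := L) (Set.univ : Set (Fin 1 → N)) 2 ∧
      ¬ MRge (L := L) (Set.univ : Set (Fin 1 → N)) 3

/-- `T` has NDOP: in any sufficiently saturated model, for elementary substructures
`N₁, N₂` independent over a common elementary substructure `N₀`, and `N₃` prime over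
`N₁ ∪ N₂`, every nonalgebraic type over `N₃` is nonorthogonal to `N₁` or to `N₂`. -/
def NDOP (L : FirstOrder.Language.{u, u}) (T : L.Theory) : Prop :=
  ∀ (N : Type u) (_ : L.Structure N), N ⊨ T →
    SaturatedIn (M := N) L (Order.succ ℵ₀) →
    ∀ N₀ N₁ N₂ N₃ : Set N,
      ElemSubset (L := L) N₀ → ElemSubset (L := L) N₁ → ElemSubset (L := L) N₂ →
      N₀ ⊆ N₁ → N₀ ⊆ N₂ → IndepOver (L := L) N₁ N₂ N₀ →
      KappaPrimeOver (L := L) ℵ₀ N₃ (N₁ ∪ N₂) →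
      ∀ (n : ℕ) (d : Fin n → N), ¬ AlgebraicTp (L := L) N₃ d →
        ¬ TypeOrthSet (L := L) N₃ d N₁ ∨ ¬ TypeOrthSet (L := L) N₃ d N₂

/-- The setup of Section 2 of the paper: a witness to the failure of weak benignity for a
superstable theory, refined as in the characterization lemma, together with the tuple
`c`, the regular type `p* = tp(dstar / Ma)`, the base `C` (with `B = acl(C)`), the
`B`-indiscernible sequence `cseq` of copies of `c`, and the `P`-simple type
`q = tp(e / B)` of positive finite `P`-weight. -/
structure WSetup (L : FirstOrder.Language.{u, u}) (M : Type u) [L.Structure M] where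
  κ : Cardinal.{u}
  A : Set M
  a : M
  b : M
  Astar : Set M
  Ma : Set M
  Mb : Set M
  Na : Set M
  g : M → M
  nc : ℕ
  c : Fin nc → M
  nd : ℕ
  dstar : Fin nd → M
  C : Set M
  cseq : ℕ → Fin nc → M
  e : M
  k : ℕ
  superstable : Superstable L (L.completeTheory M)
  reg : κ.IsRegular
  pow : κ ^ cardL L = κ
  pairSat : PairSaturated (L := L) A (Order.succ κ)
  witness : CharWitness (L := L) κ A a b Astar Ma Mb Na g
  hc : ∀ i, c i ∈ Ma
  hdNa : ∀ i, dstar i ∈ Na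
  hdnotMa : ¬ ∀ i, dstar i ∈ Ma
  regularP : TypeRegular (L := L) Ma dstar
  statP : TypeStationary (L := L) (Set.range c) dstar
  nfP : ¬ TupForksOver (L := L) dstar Ma (Set.range c)
  nonorthAstar : ¬ TypeOrthSet (L := L) Ma dstar Astar
  hCsub : C ⊆ Astar
  cardC : #C ≤ cardL L
  cIndep : TupIndepOver (L := L) c Astar C
  cseq0 : cseq 0 = c
  cseqMa : ∀ j i, cseq j i ∈ Ma
  indisc : IndiscOver (L := L) (aclSet (L := L) C) cseq
  cseqTp : ∀ j, SameTypeOver (L := L) (aclSet (L := L) C) (cseq j) c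
  qSimple : wP (L := L) Ma dstar {e} (aclSet (L := L) C) < ℵ₀
  qPos : 0 < wP (L := L) Ma dstar {e} (aclSet (L := L) C)
  qAcl : ∀ x : M, SameTypeOver (L := L) (aclSet (L := L) C) ![x] ![e] →
    x ∈ aclSet (L := L) (aclSet (L := L) C ∪ (⋃ i ∈ Set.Iio k, Set.range (cseq i)) ∪
      {y | ∃ (d : Fin nd → M) (i : ℕ), i < k ∧
        SameTypeOver (L := L) (aclSet (L := L) C)
          (Sum.elim d (cseq i)) (Sum.elim dstar c) ∧ y ∈ Set.range d})
  omitted : ¬ ∃ y : Fin nd → M, RealizesGType (L := L) Ma g dstar y ∧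
    TupIndepOver (L := L) y A Mb

/-! ### Definable predicates -/

section Definability

/-- The predicate `P` on `ι`-tuples is definable with parameters from `C`. -/
def Dfb (L : FirstOrder.Language.{u, u}) {M : Type u} [L.Structure M] (C : Set M) {ι : Type}
    (P : (ι → M) → Prop) : Prop :=
  ∃ (κ : Type) (_ : Finite κ) (γ : κ → M) (φ : L.Formula (ι ⊕ κ)),
    (∀ i, γ i ∈ C) ∧ ∀ v, P v ↔ φ.Realize (Sum.elim v γ)

variable {C D : Set M} {ι κ : Type} {P Q : (ι → M) → Prop}

theorem Dfb.mono (h : Dfb L C P) (hCD : C ⊆ D) : Dfb L D P := by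
  obtain ⟨κ, hκ, γ, φ, h1, h2⟩ := h
  exact ⟨κ, hκ, γ, φ, fun i => hCD (h1 i), h2⟩

theorem Dfb.congr (h : Dfb L C P) (hPQ : ∀ v, Q v ↔ P v) : Dfb L C Q := by
  obtain ⟨κ, hκ, γ, φ, h1, h2⟩ := h
  exact ⟨κ, hκ, γ, φ, h1, fun v => (hPQ v).trans (h2 v)⟩

theorem Dfb.not (h : Dfb L C P) : Dfb L C (fun v => ¬ P v) := by
  obtain ⟨κ, hκ, γ, φ, h1, h2⟩ := h
  exact ⟨κ, hκ, γ, φ.not, h1, fun v => by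
    dsimp only; rw [h2, Formula.realize_not]⟩

theorem Dfb.and (h : Dfb L C P) (h' : Dfb L C Q) : Dfb L C (fun v => P v ∧ Q v) := by
  obtain ⟨κ, hκ, γ, φ, h1, h2⟩ := h
  obtain ⟨κ', hκ', γ', φ', h1', h2'⟩ := h'
  refine ⟨κ ⊕ κ', inferInstance, Sum.elim γ γ',
    (φ.relabel (Sum.map id Sum.inl)) ⊓ (φ'.relabel (Sum.map id Sum.inr)), ?_, ?_⟩
  · rintro (i | i)
    exacts [h1 i, h1' i]
  · intro v
    dsimp only
    rw [Formula.realize_inf, Formula.realize_relabel, Formula.realize_relabel, h2, h2',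
      Sum.elim_comp_map, Sum.elim_comp_map, Sum.elim_comp_inl, Sum.elim_comp_inr]
    rfl

theorem Dfb.or (h : Dfb L C P) (h' : Dfb L C Q) : Dfb L C (fun v => P v ∨ Q v) :=
  (h.not.and h'.not).not.congr fun v => by tauto

theorem Dfb.imp (h : Dfb L C P) (h' : Dfb L C Q) : Dfb L C (fun v => P v → Q v) :=
  (h.not.or h').congr fun v => by tauto

theorem Dfb.comp (h : Dfb L C P) (f : ι → κ) : Dfb L C (fun v : κ → M => P (v ∘ f)) := by
  obtain ⟨κ', hκ, γ, φ, h1, h2⟩ := h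
  refine ⟨κ', hκ, γ, φ.relabel (Sum.map f id), h1, fun v => ?_⟩
  dsimp only
  rw [h2, Formula.realize_relabel, Sum.elim_comp_map]
  rfl

theorem Dfb.const (p : Prop) : Dfb L C (fun _ : ι → M => p) := by
  by_cases hp : p
  · exact ⟨Empty, inferInstance, Empty.elim, ⊤, fun i => i.elim, fun v => by
      simp [hp]⟩
  · exact ⟨Empty, inferInstance, Empty.elim, ⊥, fun i => i.elim, fun v => by
      simp [hp]⟩

theorem Dfb.atom (φ : L.Formula ι) : Dfb L C (fun v : ι → M => φ.Realize v) :=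
  ⟨Empty, inferInstance, Empty.elim, φ.relabel Sum.inl, fun i => i.elim, fun v => by
    rw [Formula.realize_relabel]; simp⟩

theorem Dfb.eq (i j : ι) : Dfb L C (fun v : ι → M => v i = v j) :=
  (Dfb.atom (C := C) (M := M) ((Term.var i).equal (Term.var j) : L.Formula ι)).congr
    fun v => by simp

theorem Dfb.ex [Finite κ] {P : (ι ⊕ κ → M) → Prop} (h : Dfb L C P) :
    Dfb L C (fun v : ι → M => ∃ z : κ → M, P (Sum.elim v z)) := by
  obtain ⟨κ', hκ, γ, φ, h1, h2⟩ := h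
  refine ⟨κ', hκ, γ, (φ.relabel (Sum.elim (Sum.map Sum.inl id) (fun i => Sum.inl (Sum.inr i)) :
    (ι ⊕ κ) ⊕ κ' → (ι ⊕ κ') ⊕ κ)).iExs κ, h1, fun v => ?_⟩
  rw [Formula.realize_iExs]
  refine exists_congr fun z => ?_
  rw [h2, Formula.realize_relabel]
  apply iff_of_eq
  congr 1
  ext ((i | i) | i) <;> rfl

theorem Dfb.all [Finite κ] {P : (ι ⊕ κ → M) → Prop} (h : Dfb L C P) :
    Dfb L C (fun v : ι → M => ∀ z : κ → M, P (Sum.elim v z)) :=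
  h.not.ex.not.congr fun v => by simp

theorem Dfb.inst [Finite κ] {P : (ι ⊕ κ → M) → Prop} (h : Dfb L C P) (b : κ → M)
    (hb : ∀ i, b i ∈ C) : Dfb L C (fun v : ι → M => P (Sum.elim v b)) := by
  obtain ⟨κ', hκ, γ, φ, h1, h2⟩ := h
  refine ⟨κ ⊕ κ', inferInstance, Sum.elim b γ,
    φ.relabel (Equiv.sumAssoc ι κ κ'), ?_, fun v => ?_⟩
  · rintro (i | i)
    exacts [hb i, h1 i]
  · dsimp only
    rw [h2, Formula.realize_relabel]
    apply iff_of_eq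
    congr 1
    ext ((i | i) | i) <;> rfl

theorem Dfb.finAll {s : Type} [Finite s] {P : s → (ι → M) → Prop} (h : ∀ i, Dfb L C (P i)) :
    Dfb L C (fun v => ∀ i, P i v) := by
  choose κ hκ γ φ h1 h2 using h
  refine ⟨Σ i, κ i, inferInstance, fun x => γ x.1 x.2,
    Formula.iInf fun i => (φ i).relabel (Sum.map id (Sigma.mk i)), fun x => h1 _ _, fun v => ?_⟩
  rw [Formula.realize_iInf]
  refine forall_congr' fun i => ?_
  rw [h2, Formula.realize_relabel]
  apply iff_of_eq
  congr 1
  ext (i | i) <;> rfl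

theorem Dfb.finEx {s : Type} [Finite s] {P : s → (ι → M) → Prop} (h : ∀ i, Dfb L C (P i)) :
    Dfb L C (fun v => ∃ i, P i v) :=
  (Dfb.finAll fun i => (h i).not).not.congr fun v => by simp

/-- Separating the parameters of a definable predicate into two parts. -/
theorem Dfb.split (h : Dfb L (C ∪ D) P) :
    ∃ (κ : Type) (_ : Finite κ) (d : κ → M) (Q : (ι ⊕ κ → M) → Prop),
      (∀ i, d i ∈ D) ∧ Dfb L C Q ∧ ∀ v, P v ↔ Q (Sum.elim v d) := by
  obtain ⟨κ', hκ, γ, φ, h1, h2⟩ := h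
  classical
  refine ⟨{i // γ i ∈ D}, inferInstance, fun i => γ i,
    fun w => φ.Realize (Sum.elim (fun i => w (Sum.inl i))
      (fun i => if h : γ i ∈ D then w (Sum.inr ⟨i, h⟩) else γ i)), fun i => i.2, ?_, ?_⟩
  · refine ⟨{i // γ i ∉ D}, inferInstance, fun i => γ i, φ.relabel
      (Sum.elim (fun i => Sum.inl (Sum.inl i))
        (fun i => if h : γ i ∈ D then Sum.inl (Sum.inr ⟨i, h⟩) else Sum.inr ⟨i, h⟩)), ?_, ?_⟩
    · rintro ⟨i, hi⟩
      exact (h1 i).resolve_right hi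
    · intro v
      dsimp only
      rw [Formula.realize_relabel]
      apply iff_of_eq
      congr 1
      ext (i | i)
      · rfl
      · by_cases hi : γ i ∈ D <;> simp [hi]
  · intro v
    rw [h2]
    apply iff_of_eq
    congr 1
    ext (i | i)
    · rfl
    · by_cases hi : γ i ∈ D <;> simp [hi]

theorem exists_restrict {α β : Type*} (φ : L.Formula (α ⊕ β)) :
    ∃ (s : Finset α) (t : Finset β) (ψ : L.Formula (s ⊕ t)), ∀ (v : α → M) (w : β → M),
      φ.Realize (Sum.elim v w) ↔ ψ.Realize (Sum.elim (fun i => v i) (fun i => w i)) := by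
  classical
  have h1 : ∀ x : φ.freeVarFinset, ∀ i, x.1 = Sum.inl i →
      i ∈ φ.freeVarFinset.preimage Sum.inl Sum.inl_injective.injOn := by
    rintro ⟨x, hx⟩ i rfl
    simpa using hx
  have h2 : ∀ x : φ.freeVarFinset, ∀ i, x.1 = Sum.inr i →
      i ∈ φ.freeVarFinset.preimage Sum.inr Sum.inr_injective.injOn := by
    rintro ⟨x, hx⟩ i rfl
    simpa using hx
  refine ⟨φ.freeVarFinset.preimage Sum.inl Sum.inl_injective.injOn,
    φ.freeVarFinset.preimage Sum.inr Sum.inr_injective.injOn,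
    φ.restrictFreeVar (fun x => match h : x.1 with
      | Sum.inl i => Sum.inl ⟨i, h1 x i h⟩
      | Sum.inr i => Sum.inr ⟨i, h2 x i h⟩), fun v w => ?_⟩
  refine (BoundedFormula.realize_restrictFreeVar (φ := φ) (xs := default)
    (Sum.elim v w) ?_).symm
  rintro ⟨i | i, hi⟩ <;> rfl

/-- A definable predicate depends only on finitely many coordinates. -/
theorem Dfb.support (h : Dfb L C P) : ∃ (s : Finset ι) (Q : (s → M) → Prop),
    Dfb L C Q ∧ ∀ v, P v ↔ Q (fun i => v i) := by
  obtain ⟨κ', hκ, γ, φ, h1, h2⟩ := h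
  obtain ⟨s, t, ψ, h⟩ := exists_restrict (M := M) φ
  exact ⟨s, fun v => ψ.Realize (Sum.elim v fun i => γ i), ⟨t, inferInstance, fun i => γ i, ψ,
    fun i => h1 i, fun v => Iff.rfl⟩, fun v => (h2 v).trans (h v γ)⟩

/-- In a definable predicate, only finitely many of the variables `κ` matter. -/
theorem Dfb.support_right {P : (ι ⊕ κ → M) → Prop} (h : Dfb L C P) :
    ∃ (t : Finset κ) (Q : (ι ⊕ t → M) → Prop),
      Dfb L C Q ∧ ∀ v z, P (Sum.elim v z) ↔ Q (Sum.elim v fun i => z i) := by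
  obtain ⟨s, Q, hQ, hPQ⟩ := h.support
  classical
  let t : Finset κ := s.preimage Sum.inr Sum.inr_injective.injOn
  have ht : ∀ i : s, ∀ j, i.1 = Sum.inr j → j ∈ t := by
    rintro ⟨i, hi⟩ j rfl
    simpa [t] using hi
  let f : s → ι ⊕ t := fun i => match h : i.1 with
    | Sum.inl j => Sum.inl j
    | Sum.inr j => Sum.inr ⟨j, ht i j h⟩
  refine ⟨t, fun w => Q (w ∘ f), hQ.comp f, fun v z => ?_⟩
  rw [hPQ]
  apply iff_of_eq
  congr 1
  ext ⟨i | i, hi⟩ <;> rfl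

theorem Dfb.ex' [Nonempty M] {P : (ι ⊕ κ → M) → Prop} (h : Dfb L C P) :
    Dfb L C (fun v : ι → M => ∃ z : κ → M, P (Sum.elim v z)) := by
  obtain ⟨t, Q, hQ, hPQ⟩ := h.support_right
  refine hQ.ex.congr fun v => ?_
  classical
  constructor
  · rintro ⟨z, hz⟩
    exact ⟨_, (hPQ _ _).1 hz⟩
  · rintro ⟨z, hz⟩
    refine ⟨fun i => if h : i ∈ t then z ⟨i, h⟩ else Classical.arbitrary M, (hPQ _ _).2 ?_⟩
    simpa using hz

theorem Dfb.inst' {P : (ι ⊕ κ → M) → Prop} (h : Dfb L C P) (b : κ → M)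
    (hb : ∀ i, b i ∈ C) : Dfb L C (fun v : ι → M => P (Sum.elim v b)) := by
  obtain ⟨t, Q, hQ, hPQ⟩ := h.support_right
  exact (hQ.inst (fun i : t => b i) fun i => hb i).congr fun v => hPQ v b

end Definability

/-! ### Equality of types -/

section Types

/-- `x` and `y` have the same type over `C`. -/
def Eqv (L : FirstOrder.Language.{u, u}) {M : Type u} [L.Structure M] (C : Set M) {ι : Type}
    (x y : ι → M) : Prop :=
  ∀ P : (ι → M) → Prop, Dfb L C P → P x → P y

variable {C D : Set M} {ι κ : Type} {x y z : ι → M}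

theorem Eqv.iff (h : Eqv L C x y) {P : (ι → M) → Prop} (hP : Dfb L C P) : P x ↔ P y :=
  ⟨h P hP, fun hy => by_contra fun hx => h _ hP.not hx hy⟩

theorem Eqv.refl (x : ι → M) : Eqv L C x x := fun _ _ h => h

theorem Eqv.symm (h : Eqv L C x y) : Eqv L C y x := fun _ hP => (h.iff hP).2

theorem Eqv.trans (h : Eqv L C x y) (h' : Eqv L C y z) : Eqv L C x z :=
  fun P hP hx => h' P hP (h P hP hx)

theorem Eqv.mono (h : Eqv L D x y) (hCD : C ⊆ D) : Eqv L C x y :=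
  fun P hP => h P (hP.mono hCD)

theorem Eqv.comp (h : Eqv L C x y) (f : κ → ι) : Eqv L C (x ∘ f) (y ∘ f) :=
  fun _ hP => h _ (hP.comp f)

theorem eqv_union : Eqv L (C ∪ D) x y ↔ ∀ (κ : Type) (_ : Finite κ) (d : κ → M),
    (∀ i, d i ∈ D) → Eqv L C (Sum.elim x d) (Sum.elim y d) := by
  constructor
  · intro h κ _ d hd P hP hx
    exact h (fun v => P (Sum.elim v d))
      ((hP.mono Set.subset_union_left).inst d fun i => Or.inr (hd i)) hx
  · intro h P hP hx
    obtain ⟨κ, hκ, d, Q, hd, hQ, hPQ⟩ := hP.split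
    rw [hPQ] at hx ⊢
    exact h κ hκ d hd Q hQ hx

/-- Moving a tuple from the parameter set to the variables. -/
theorem eqv_union_range {b : κ → M} :
    Eqv L (C ∪ Set.range b) x y ↔ Eqv L C (Sum.elim x b) (Sum.elim y b) := by
  constructor
  · intro h P hP hx
    exact h (fun v => P (Sum.elim v b)) ((hP.mono Set.subset_union_left).inst' b
      fun i => Or.inr ⟨i, rfl⟩) hx
  · rw [eqv_union]
    intro h κ' _ d hd
    choose f hf using hd
    have := h.comp (Sum.map id f)
    simpa [Sum.elim_comp_map, funext hf, show b ∘ f = d from funext hf] using this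

theorem sameTypeOver_iff : SameTypeOver (L := L) C x y ↔ Eqv L C x y := by
  constructor
  · rintro h P ⟨κ, hκ, γ, φ, h1, h2⟩ hx
    rw [h2] at hx ⊢
    have := h (φ.relabel (Sum.map id fun i => ⟨γ i, h1 i⟩))
    simp only [Formula.realize_relabel, Sum.elim_comp_map, Function.comp_id] at this
    exact this.1 hx
  · intro h φ
    refine h.iff (P := fun v => φ.Realize (Sum.elim v Subtype.val)) ?_
    obtain ⟨s, t, ψ, h⟩ := exists_restrict (M := M) φ
    let e := t.equivFin
    refine ⟨Fin t.card, inferInstance, fun i => (e.symm i).1.1,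
      ψ.relabel (Sum.map Subtype.val e), fun i => (e.symm i).1.2, fun v => ?_⟩
    dsimp only
    rw [h, Formula.realize_relabel, Sum.elim_comp_map]
    apply iff_of_eq
    congr 2
    ext i
    simp

end Types

/-! ### Saturation -/

section Saturation

/-- `N` realizes all one-variable types over fewer than `κ` parameters from `N` which are
consistent (in `M`). -/
def OneSat (L : FirstOrder.Language.{u, u}) {M : Type u} [L.Structure M] (N : Set M)
    (κ : Cardinal.{u}) : Prop :=
  ∀ S : Set M, S ⊆ N → #S < κ → ∀ p : Set ((Fin 1 → M) → Prop), (∀ P ∈ p, Dfb L S P) →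
    (∀ q : Set ((Fin 1 → M) → Prop), q ⊆ p → q.Finite → ∃ x : Fin 1 → M, ∀ P ∈ q, P x) →
    ∃ x : Fin 1 → M, x 0 ∈ N ∧ ∀ P ∈ p, P x

theorem Dfb.exists_formula {C : Set M} {ι : Type} {P : (ι → M) → Prop} (h : Dfb L C P) :
    ∃ φ : L.Formula (ι ⊕ C), ∀ v, P v ↔ φ.Realize (Sum.elim v Subtype.val) := by
  obtain ⟨κ, hκ, γ, φ, h1, h2⟩ := h
  refine ⟨φ.relabel (Sum.map id fun i => ⟨γ i, h1 i⟩), fun v => ?_⟩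
  rw [h2, Formula.realize_relabel, Sum.elim_comp_map]
  rfl

theorem SaturatedIn.oneSat {κ : Cardinal.{u}} (h : SaturatedIn (M := M) L κ) :
    OneSat L (Set.univ : Set M) κ := by
  intro S _ hS p hp hfin
  have key := h S hS
    {φ | ∃ P ∈ p, ∀ v, P v ↔ φ.Realize (Sum.elim v Subtype.val)} ?_
  · obtain ⟨x, hx⟩ := key
    refine ⟨![x], trivial, fun P hP => ?_⟩
    obtain ⟨φ, hφ⟩ := (hp P hP).exists_formula
    exact (hφ _).2 (hx φ ⟨P, hP, hφ⟩)
  · intro fs hfs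
    choose! f hf1 hf2 using hfs
    obtain ⟨x, hx⟩ := hfin (f '' fs) (by rintro _ ⟨φ, hφ, rfl⟩; exact hf1 hφ)
      (fs.finite_toSet.image f)
    refine ⟨x 0, fun φ hφ => ?_⟩
    have := (hf2 hφ x).1 (hx _ ⟨φ, hφ, rfl⟩)
    rwa [show ![x 0] = x from funext fun i => by rw [Subsingleton.elim i 0]; rfl]

theorem ElemSubset.exists_mem {N : Set M} (h : ElemSubset (L := L) N) {P : (Fin 1 → M) → Prop}
    (hP : Dfb L N P) (hx : ∃ x, P x) : ∃ x ∈ N, P ![x] := by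
  obtain ⟨x, hx⟩ := hx
  obtain ⟨κ, hκ, γ, φ, h1, h2⟩ := hP
  let e := (Finite.equivFin κ)
  let ψ : L.BoundedFormula (Fin (Nat.card κ)) 1 :=
    BoundedFormula.relabel (n := 1) (k := 0) (Sum.elim (fun i => Sum.inr i) (fun i => Sum.inl (e i))) φ
  have key : ∀ y : M, ψ.Realize (fun i => γ (e.symm i)) ![y] ↔ P ![y] := by
    intro y
    rw [h2, BoundedFormula.realize_relabel]
    have : (Sum.elim (fun i => γ (e.symm i)) (![y] ∘ Fin.castAdd 0) ∘
      (Sum.elim (fun i => Sum.inr i) (fun i => Sum.inl (e i)) :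
        Fin 1 ⊕ κ → Fin (Nat.card κ) ⊕ Fin 1)) = Sum.elim ![y] γ := by
      ext (i | i)
      · rfl
      · simp
    rw [this, Formula.Realize]
    apply iff_of_eq
    congr 1
    exact Subsingleton.elim _ _
  obtain ⟨y, hy, hy'⟩ := h.2 _ ψ (fun i => γ (e.symm i)) (fun i => h1 _) ⟨x 0, (key _).2 (by
    rwa [show ![x 0] = x from funext fun i => by rw [Subsingleton.elim i 0]; rfl])⟩
  exact ⟨y, hy, (key y).1 hy'⟩

theorem Dfb.forall_mem_finite {C : Set M} {ι : Type} {q : Set ((ι → M) → Prop)}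
    (hq : q.Finite) (h : ∀ P ∈ q, Dfb L C P) : Dfb L C (fun v => ∀ P ∈ q, P v) := by
  have := hq.to_subtype
  obtain ⟨n, ⟨e⟩⟩ := Finite.exists_equiv_fin q
  exact (Dfb.finAll fun i => h _ (e.symm i).2).congr fun v =>
    ⟨fun hv i => hv _ (e.symm i).2, fun hv P hP => by simpa using hv (e ⟨P, hP⟩)⟩

theorem SubsetSaturated.oneSat {κ : Cardinal.{u}} {N : Set M}
    (h : SubsetSaturated (L := L) κ N) (hN : ElemSubset (L := L) N) : OneSat L N κ := by
  intro S hSN hS p hp hfin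
  have key := h S hSN hS
    {φ | ∃ P ∈ p, ∀ v, P v ↔ φ.Realize (Sum.elim v Subtype.val)} ?_
  · obtain ⟨x, hxN, hx⟩ := key
    refine ⟨![x], hxN, fun P hP => ?_⟩
    obtain ⟨φ, hφ⟩ := (hp P hP).exists_formula
    exact (hφ _).2 (hx φ ⟨P, hP, hφ⟩)
  · intro fs hfs
    choose! f hf1 hf2 using hfs
    have hsub : f '' fs ⊆ p := by rintro _ ⟨φ, hφ, rfl⟩; exact hf1 hφ
    obtain ⟨x, hxN, hx⟩ := hN.exists_mem
      (Dfb.forall_mem_finite (fs.finite_toSet.image f) fun P hP => (hp P (hsub hP)).mono hSN)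
      (hfin _ hsub (fs.finite_toSet.image f))
    exact ⟨x, hxN, fun φ hφ => (hf2 hφ _).1 (hx _ ⟨φ, hφ, rfl⟩)⟩

variable [Nonempty M]

theorem OneSat.nat {N : Set M} {κ : Cardinal.{u}} (h : OneSat L N κ) (hκ : ℵ₀ ≤ κ)
    {S : Set M} (hSN : S ⊆ N) (hS : #S < κ) (p : Set ((ℕ → M) → Prop))
    (hp : ∀ P ∈ p, Dfb L S P)
    (hfin : ∀ q : Set ((ℕ → M) → Prop), q ⊆ p → q.Finite → ∃ x : ℕ → M, ∀ P ∈ q, P x) :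
    ∃ x : ℕ → M, (∀ n, x n ∈ N) ∧ ∀ P ∈ p, P x := by
  classical
  let E : ((ℕ → M) → Prop) → Prop := fun P =>
    ∃ q : Set ((ℕ → M) → Prop), q ⊆ p ∧ q.Finite ∧ ∀ x, (∀ Q ∈ q, Q x) → P x
  let Dep : ℕ → ((ℕ → M) → Prop) → Prop := fun n P =>
    ∀ v w : ℕ → M, (∀ i < n, v i = w i) → P v → P w
  let I : ℕ → (ℕ → M) → Prop := fun n f =>
    (∀ i < n, f i ∈ N) ∧ ∀ P, Dfb L S P → Dep n P → E P → P f
  have hE : ∀ s : Set ((ℕ → M) → Prop), s.Finite → (∀ P ∈ s, E P) → E (fun v => ∀ P ∈ s, P v) := by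
    intro s hs hE
    choose! q hq1 hq2 hq3 using hE
    refine ⟨⋃ P ∈ s, q P, by simpa using hq1, hs.biUnion hq2, fun x hx P hP => hq3 P hP x ?_⟩
    exact fun Q hQ => hx Q (Set.mem_biUnion hP hQ)
  have base : I 0 fun _ => Classical.arbitrary M := by
    refine ⟨by simp, fun P _ hd ⟨q, hq1, hq2, hq3⟩ => ?_⟩
    obtain ⟨x, hx⟩ := hfin q hq1 hq2
    exact hd x _ (by simp) (hq3 x hx)
  have step : ∀ n f, I n f → ∃ x, I (n + 1) (Function.update f n x) := by
    intro n f ⟨hfN, hf⟩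
    let S' := S ∪ Set.range (fun i : Fin n => f i)
    have hS'N : S' ⊆ N := Set.union_subset hSN (by rintro _ ⟨i, rfl⟩; exact hfN i i.2)
    have hS' : #S' < κ := by
      refine (mk_union_le _ _).trans_lt (add_lt_of_lt hκ hS ?_)
      exact (Cardinal.lt_aleph0_iff_set_finite.2 (Set.finite_range _)).trans_le hκ
    let r : Set ((ℕ → M) → Prop) := {P | Dfb L S P ∧ Dep (n + 1) P ∧ E P}
    let T : ((ℕ → M) → Prop) → (Fin 1 → M) → Prop := fun P y => P (Function.update f n (y 0))
    have key := h S' hS'N hS' (T '' r) ?_ ?_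
    · obtain ⟨x, hxN, hx⟩ := key
      refine ⟨x 0, fun i hi => ?_, fun P h1 h2 h3 => hx _ ⟨P, ⟨h1, h2, h3⟩, rfl⟩⟩
      rcases Nat.lt_succ_iff_lt_or_eq.1 hi with hi | rfl
      · rw [Function.update_of_ne hi.ne]; exact hfN i hi
      · simpa using hxN
    · rintro _ ⟨P, ⟨h1, h2, h3⟩, rfl⟩
      let g : ℕ → Fin 1 ⊕ Fin n := fun i => if hi : i < n then Sum.inr ⟨i, hi⟩ else Sum.inl 0
      have h4 : Dfb L S' (fun v : Fin 1 ⊕ Fin n → M => P (v ∘ g)) :=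
        (h1.comp g).mono Set.subset_union_left
      refine (h4.inst (fun i : Fin n => f i) (fun i => Or.inr ⟨i, rfl⟩)).congr fun v => ?_
      have hag : ∀ i < n + 1, Function.update f n (v 0) i =
          (Sum.elim v (fun i : Fin n => f i) ∘ g) i := by
        intro i hi
        rcases Nat.lt_succ_iff_lt_or_eq.1 hi with hi | rfl
        · rw [Function.update_of_ne hi.ne]; simp [g, hi]
        · simp [g]
      constructor
      · exact h2 _ _ hag
      · exact h2 _ _ fun i hi => (hag i hi).symm
    · intro q hq hqf
      obtain ⟨s, hs, hsf, rfl⟩ : ∃ s ⊆ r, s.Finite ∧ q = T '' s :=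
        Set.exists_subset_image_finite_and.1 ⟨q, hq, hqf, rfl⟩
      let P : (ℕ → M) → Prop := fun v => ∀ Q ∈ s, Q v
      have hP : Dfb L S P := Dfb.forall_mem_finite hsf fun Q hQ => (hs hQ).1
      let g : ℕ → ℕ ⊕ Fin 1 := fun i => if i = n then Sum.inr 0 else Sum.inl i
      have hg : ∀ (v : ℕ → M) (z : Fin 1 → M), Sum.elim v z ∘ g = Function.update v n (z 0) := by
        intro v z
        ext i
        by_cases hi : i = n
        · subst hi; simp [g]
        · simp [g, hi]
      have hex := hf (fun v => ∃ z : Fin 1 → M, P (Sum.elim v z ∘ g)) (hP.comp g).ex ?_ ?_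
      · obtain ⟨z, hz⟩ := hex
        refine ⟨z, ?_⟩
        rintro _ ⟨Q, hQ, rfl⟩
        rw [hg] at hz
        exact hz Q hQ
      · rintro v w hvw ⟨z, hz⟩
        refine ⟨z, fun Q hQ => (hs hQ).2.1 _ _ ?_ (hz Q hQ)⟩
        intro i hi
        rw [hg, hg]
        by_cases hin : i = n
        · subst hin; simp
        · rw [Function.update_of_ne hin, Function.update_of_ne hin]
          exact hvw i (by omega)
      · obtain ⟨q, hq1, hq2, hq3⟩ := hE s hsf fun Q hQ => (hs hQ).2.2
        refine ⟨q, hq1, hq2, fun x hx => ⟨fun _ => x n, ?_⟩⟩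
        rw [hg, Function.update_eq_self]
        exact hq3 x hx
  choose! nx hnx using step
  let F : ℕ → ℕ → M := fun n => Nat.rec (fun _ => Classical.arbitrary M)
    (fun n f => Function.update f n (nx n f)) n
  have hF : ∀ n, I n (F n) := fun n => by
    induction n with
    | zero => exact base
    | succ n ih => exact hnx n _ ih
  have hFs : ∀ n m i, i < n → n ≤ m → F m i = F n i := by
    intro n m i hi hm
    induction m, hm using Nat.le_induction with
    | base => rfl
    | succ m hm ih =>
      rw [← ih]
      exact Function.update_of_ne (by omega) _ _
  refine ⟨fun n => F (n + 1) n, fun n => (hF (n + 1)).1 n (Nat.lt_succ_self n), fun P hP => ?_⟩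
  obtain ⟨s, Q, hQ, hPQ⟩ := (hp P hP).support
  obtain ⟨n, hn⟩ : ∃ n, ∀ i ∈ s, i < n := ⟨s.sup id + 1, fun i hi =>
    Nat.lt_succ_of_le (Finset.le_sup (f := id) hi)⟩
  have := (hF n).2 P (hp P hP) ?_ ⟨{P}, by simpa using hP, Set.finite_singleton P, by simp⟩
  · rw [hPQ] at this ⊢
    convert this using 2 with i
    exact (hFs (i + 1) n i (Nat.lt_succ_self _) (hn i i.2)).symm
  · intro v w hvw hv
    rw [hPQ] at hv ⊢
    convert hv using 2 with i
    exact (hvw i (hn i i.2)).symm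

theorem OneSat.countable {N : Set M} {κ : Cardinal.{u}} (h : OneSat L N κ) (hκ : ℵ₀ ≤ κ)
    {S : Set M} (hSN : S ⊆ N) (hS : #S < κ) {ι : Type} [Countable ι] (p : Set ((ι → M) → Prop))
    (hp : ∀ P ∈ p, Dfb L S P)
    (hfin : ∀ q : Set ((ι → M) → Prop), q ⊆ p → q.Finite → ∃ x : ι → M, ∀ P ∈ q, P x) :
    ∃ x : ι → M, (∀ n, x n ∈ N) ∧ ∀ P ∈ p, P x := by
  obtain ⟨e, he⟩ := exists_injective_nat ι
  let T : ((ι → M) → Prop) → (ℕ → M) → Prop := fun P v => P (v ∘ e)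
  have key := h.nat hκ hSN hS (T '' p) ?_ ?_
  · obtain ⟨x, hxN, hx⟩ := key
    exact ⟨x ∘ e, fun i => hxN _, fun P hP => hx _ ⟨P, hP, rfl⟩⟩
  · rintro _ ⟨P, hP, rfl⟩
    exact (hp P hP).comp e
  · intro q hq hqf
    obtain ⟨s, hs, hsf, rfl⟩ : ∃ s ⊆ p, s.Finite ∧ q = T '' s :=
      Set.exists_subset_image_finite_and.1 ⟨q, hq, hqf, rfl⟩
    obtain ⟨x, hx⟩ := hfin s hs hsf
    refine ⟨Function.extend e x fun _ => Classical.arbitrary M, ?_⟩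
    rintro _ ⟨P, hP, rfl⟩
    simpa [T, Function.comp_def, he.extend_apply] using hx P hP

end Saturation

/-! ### Trees of instances of formulas in superstable theories -/

section Tree

/-- The instances of `R` along the sequence `B` of parameters are `k`-inconsistent. -/
def Incons {M : Type u} {α β : Type} {ι : Type*} (R : (α ⊕ β → M) → Prop) (k : ℕ)
    (B : ι → β → M) : Prop :=
  ∀ s : Fin k → ι, Function.Injective s → ¬ ∃ a : α → M, ∀ j, R (Sum.elim a (B (s j)))

/-- There is a tree of instances of the given patterns below `X`, in which the siblings are
inconsistent. -/
def HasTree {M : Type u} {α : Type} :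
    List (((α ⊕ ℕ → M) → Prop) × ℕ) → ((α → M) → Prop) → Prop
  | [], X => ∃ x, X x
  | P :: s, X => ∃ e : ℕ → ℕ → M, Incons P.1 P.2 e ∧
      ∀ i, HasTree s (fun x => X x ∧ P.1 (Sum.elim x (e i)))

theorem exists_model_realizing {V : Type u} (p : Set (L.Formula V)) [Nonempty M]
    (h : ∀ q : Finset (L.Formula V), ↑q ⊆ p → ∃ v : V → M, ∀ φ ∈ q, φ.Realize v) :
    ∃ (N : Type u) (_ : L.Structure N), N ⊨ L.completeTheory M ∧
      ∃ v : V → N, ∀ φ ∈ p, φ.Realize v := by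
  classical
  let J := Finset p
  let U : Ultrafilter J := Ultrafilter.of Filter.atTop
  have hU : (U : Filter J) ≤ Filter.atTop := Ultrafilter.of_le _
  have h' : ∀ t : J, ∃ v : V → M, ∀ φ ∈ t, φ.1.Realize v := by
    intro t
    obtain ⟨v, hv⟩ := h (t.image Subtype.val) (by
      intro φ hφ
      obtain ⟨ψ, -, rfl⟩ := Finset.mem_image.1 (Finset.mem_coe.1 hφ)
      exact ψ.2)
    exact ⟨v, fun φ hφ => hv _ (Finset.mem_image_of_mem _ hφ)⟩
  choose w hw using h'
  refine ⟨(U : Filter J).Product (fun _ => M), inferInstance, ?_,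
    fun i => ((fun t => w t i : ∀ _ : J, M) : (U : Filter J).Product (fun _ => M)), ?_⟩
  · refine ⟨fun φ hφ => ?_⟩
    rw [Ultraproduct.sentence_realize]
    exact Filter.Eventually.of_forall fun _ => hφ
  · intro φ hφ
    refine (Ultraproduct.realize_formula_cast (M := fun _ => M) (u := U) φ
      (fun i t => w t i)).2 ?_
    exact hU ((Filter.eventually_ge_atTop ({⟨φ, hφ⟩} : J)).mono fun t ht =>
      hw t ⟨φ, hφ⟩ (ht (Finset.mem_singleton_self _)))

theorem realize_iff_of_typeOf_eq {N : Type u} [L.Structure N] [Nonempty N] (A : Set N) {α : Type}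
    {x y : α → N}
    (h : ((L[[A]]).completeTheory N).typeOf x = ((L[[A]]).completeTheory N).typeOf y)
    {β : Type} (φ : L.Formula (α ⊕ β)) (b : β → N) (hb : ∀ i, b i ∈ A) :
    φ.Realize (Sum.elim x b) ↔ φ.Realize (Sum.elim y b) := by
  let φ' : L.Formula (A ⊕ α) :=
    φ.relabel (Sum.elim Sum.inr (fun i => Sum.inl ⟨b i, hb i⟩))
  let ψ : (L[[A]]).Formula α := BoundedFormula.constantsVarsEquiv.symm φ'
  have key : ∀ x : α → N, ψ.Realize x ↔ φ.Realize (Sum.elim x b) := by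
    intro x
    have := BoundedFormula.realize_constantsVarsEquiv (φ := ψ) (v := x) (xs := default)
    simp only [ψ, Equiv.apply_symm_apply] at this
    rw [Formula.Realize, ← this]
    have h2 := Formula.realize_relabel (φ := φ)
      (g := (Sum.elim Sum.inr (fun i => Sum.inl ⟨b i, hb i⟩) : α ⊕ β → A ⊕ α))
      (v := Sum.elim (fun a => ((L.con a : (L[[A]]).Constants) : N)) x)
    refine Iff.trans h2 ?_
    apply iff_of_eq
    congr 1
    ext (i | i) <;> simp
  rw [← key, ← key, ← Theory.CompleteType.formula_mem_typeOf (T := (L[[A]]).completeTheory N),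
    ← Theory.CompleteType.formula_mem_typeOf (T := (L[[A]]).completeTheory N), h]

/-- An infinite cardinal `≥ c` of countable cofinality. -/
theorem exists_lt_power_aleph0 (c : Cardinal.{u}) : ∃ μ, c ≤ μ ∧ ℵ₀ ≤ μ ∧ μ < μ ^ ℵ₀ := by
  have h1 := Cardinal.aleph0_le_aleph (c.ord + Ordinal.omega0)
  refine ⟨ℵ_ (c.ord + Ordinal.omega0), ?_, h1, ?_⟩
  · calc c = c.ord.card := (Cardinal.card_ord c).symm
      _ ≤ (c.ord + Ordinal.omega0).card := Ordinal.card_le_card le_self_add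
      _ ≤ _ := by
        have := Ordinal.card_le_card ((Ordinal.isNormal_omega.strictMono.le_apply
          (x := c.ord + Ordinal.omega0)))
        simpa using this
  · have := Cardinal.lt_power_cof_ord h1
    rwa [Cardinal.ord_aleph, Ordinal.cof_omega (Ordinal.isSuccLimit_add _
      Ordinal.isSuccLimit_omega0), Ordinal.cof_add _ Ordinal.omega0_ne_zero,
      Ordinal.cof_omega0] at this

/-- Counting branches of a tree whose branching is finite. -/
theorem mk_branches_le {Λ : Type u} (F : List Λ → Set Λ) (hF : ∀ l, (F l).Finite) :
    #{ξ : ℕ → Λ // ∀ n, ξ n ∈ F ((List.range n).map ξ)} ≤ 𝔠 := by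
  have : ∀ l, ∃ f : Λ → ℕ, Set.InjOn f (F l) := fun l =>
    Set.countable_iff_exists_injOn.1 (hF l).countable
  choose f hf using this
  have inj : Function.Injective (fun (ξ : {ξ : ℕ → Λ // ∀ n, ξ n ∈ F ((List.range n).map ξ)})
      (n : ℕ) => f ((List.range n).map ξ.1) (ξ.1 n)) := by
    rintro ⟨ξ, hξ⟩ ⟨η, hη⟩ h
    rw [Subtype.mk_eq_mk]
    ext n
    induction n using Nat.strong_induction_on with
    | _ n ih =>
      have e : (List.range n).map ξ = (List.range n).map η :=
        List.map_congr_left fun i hi => ih i (List.mem_range.1 hi)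
      have h1 := congrFun h n
      simp only [e] at h1
      exact hf _ (by simpa [e] using hξ n) (hη n) h1
  have := Cardinal.mk_le_of_injective (Function.Injective.comp
    (Equiv.ulift.{u, 0}.symm.injective) inj)
  simpa using this

theorem HasTree.exists_labelling [Nonempty M] {α : Type} (σ : ℕ → ((α ⊕ ℕ → M) → Prop) × ℕ) (r m : ℕ)
    (X : (α → M) → Prop) (h : HasTree ((List.range' m r).map σ) X) :
    ∃ E : List ℕ → ℕ → M,
      (∀ l : List ℕ, l.length < r → Incons (σ (m + l.length)).1 (σ (m + l.length)).2
        fun i : ℕ => E (l ++ [i])) ∧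
      ∀ l : List ℕ, l.length = r → ∃ x, X x ∧ ∀ j < r,
        (σ (m + j)).1 (Sum.elim x (E (l.take (j + 1)))) := by
  induction r generalizing m X with
  | zero =>
    obtain ⟨x, hx⟩ : ∃ x, X x := by simpa [HasTree] using h
    exact ⟨fun _ _ => Classical.arbitrary M, by simp, fun l _ => ⟨x, hx, by simp⟩⟩
  | succ r ih =>
    rw [List.range'_succ, List.map_cons] at h
    obtain ⟨e, he, hT⟩ := h
    choose E hE1 hE2 using fun i => ih (m + 1) _ (hT i)
    refine ⟨fun l => match l with
      | [] => e 0
      | [i] => e i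
      | i :: j :: l => E i (j :: l), ?_, ?_⟩
    · rintro (_ | ⟨i, l⟩) hl
      · simpa using he
      · have := hE1 i l (by simpa using hl)
        have e1 : m + 1 + l.length = m + (i :: l).length := by simp; omega
        rw [e1] at this
        convert this using 2 with j
        cases l <;> rfl
    · rintro (_ | ⟨i, l⟩) hl
      · simp at hl
      · obtain ⟨x, ⟨hx, hx'⟩, hx2⟩ := hE2 i l (by simpa using hl)
        refine ⟨x, hx, fun j hj => ?_⟩
        rcases j with _ | j
        · simpa using hx'
        · have := hx2 j (by omega)
          rw [show m + 1 + j = m + (j + 1) by omega] at this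
          convert this using 3
          cases l with
          | nil => simp at hl; omega
          | cons a l => simp

theorem Dfb.exists_formula_empty {ι : Type} {P : (ι → M) → Prop} (h : Dfb L (∅ : Set M) P) :
    ∃ φ : L.Formula ι, ∀ v, P v ↔ φ.Realize v := by
  obtain ⟨κ, hκ, γ, φ, h1, h2⟩ := h
  have : IsEmpty κ := ⟨fun i => h1 i⟩
  refine ⟨φ.relabel (Sum.elim id fun i => this.elim i), fun v => ?_⟩
  rw [h2, Formula.realize_relabel]
  apply iff_of_eq
  congr 1
  ext (i | i)
  · rfl
  · exact this.elim i

/-- The formula saying that the instances of `φ` at the given tuples of variables are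
inconsistent. -/
noncomputable def inconsFormula {α : Type} [Finite α] {V : Type u} (φ : L.Formula (α ⊕ ℕ)) {k : ℕ}
    (b : Fin k → ℕ → V) : L.Formula V :=
  (Formula.iExs (L := L) (α := V) α (Formula.iInf fun j : Fin k =>
    φ.relabel (Sum.elim Sum.inr fun m => Sum.inl (b j m)))).not

theorem realize_inconsFormula {α : Type} [Finite α] {V : Type u} {φ : L.Formula (α ⊕ ℕ)} {k : ℕ}
    {b : Fin k → ℕ → V} {v : V → M} :
    (inconsFormula φ b).Realize v ↔
      ¬ ∃ a : α → M, ∀ j, φ.Realize (Sum.elim a (v ∘ b j)) := by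
  rw [inconsFormula, Formula.realize_not, Formula.realize_iExs]
  refine not_congr (exists_congr fun a => ?_)
  rw [Formula.realize_iInf]
  refine forall_congr' fun j => ?_
  rw [Formula.realize_relabel]
  apply iff_of_eq
  congr 1
  ext (i | i) <;> rfl

theorem Superstable.not_hasTree [Nonempty M] (hT : Superstable L (L.completeTheory M))
    {α : Type} [Finite α] (σ : ℕ → ((α ⊕ ℕ → M) → Prop) × ℕ)
    (hσ : ∀ n, Dfb L ∅ (σ n).1) : ∃ r, ¬ HasTree ((List.range r).map σ) (fun _ => True) := by
  classical
  by_contra! hcon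
  choose φ hφ using fun n => (hσ n).exists_formula_empty
  let k : ℕ → ℕ := fun n => (σ n).2
  obtain ⟨μ, hμ1, hμ2, hμ3⟩ := exists_lt_power_aleph0.{u} (2 ^ cardL L)
  let Λ : Type u := μ.out
  have hΛ : #Λ = μ := Cardinal.mk_out μ
  have : Infinite Λ := Cardinal.infinite_iff.2 (by rwa [hΛ])
  let V : Type u := (List Λ × ℕ) ⊕ ((ℕ → Λ) × α)
  let W : Type u := (Σ l : List Λ, (Fin (k l.length) ↪ Λ)) ⊕ ((ℕ → Λ) × ℕ)
  let Ψ : W → L.Formula V := Sum.elim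
    (fun w => inconsFormula (φ w.1.length) fun j m => Sum.inl (w.1 ++ [w.2 j], m))
    (fun w => (φ w.2).relabel (Sum.elim (fun i => Sum.inr (w.1, i))
      fun m => Sum.inl ((List.range (w.2 + 1)).map w.1, m)))
  have hfin : ∀ q : Finset (L.Formula V), ↑q ⊆ Set.range Ψ →
      ∃ v : V → M, ∀ φ ∈ q, φ.Realize v := by
    intro q hq
    obtain ⟨T, hT, rfl⟩ : ∃ T : Finset W, True ∧ T.image Ψ = q := by
      obtain ⟨T, -, hT⟩ := Finset.subset_set_image_iff.1 (by simpa using hq :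
        (q : Set (L.Formula V)) ⊆ Ψ '' Set.univ)
      exact ⟨T, trivial, hT⟩
    let len : W → ℕ := Sum.elim (fun w => w.1.length) fun w => w.2
    let r := T.sup len + 1
    have hr : ∀ w ∈ T, len w < r := fun w hw => Nat.lt_succ_of_le (Finset.le_sup hw)
    let Λ₀ : W → Set Λ := Sum.elim (fun w => Set.range w.2) fun _ => ∅
    obtain ⟨h, hh⟩ : ∃ h : Λ → ℕ, Set.InjOn h (⋃ w ∈ T, Λ₀ w) := by
      refine Set.countable_iff_exists_injOn.1 (Set.Finite.countable ?_)
      refine T.finite_toSet.biUnion fun w _ => ?_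
      rcases w with w | w
      · exact Set.finite_range _
      · exact Set.finite_empty
    have hc := hcon r
    rw [List.range_eq_range'] at hc
    obtain ⟨E, hE1, hE2⟩ := HasTree.exists_labelling σ r 0 _ hc
    choose x hx0 hx using hE2
    refine ⟨Sum.elim (fun w => E (w.1.map h) w.2)
      (fun w => x ((List.range r).map (h ∘ w.1)) (by simp) w.2), ?_⟩
    intro ψ hψ
    obtain ⟨w, hw, rfl⟩ := Finset.mem_image.1 hψ
    rcases w with ⟨l, s⟩ | ⟨ξ, j⟩
    · refine realize_inconsFormula.2 ?_
      rintro ⟨a, ha⟩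
      have hl : (l.map h).length = l.length := List.length_map h
      have := hE1 (l.map h) (by rw [hl]; exact hr _ hw)
      rw [zero_add, hl] at this
      refine this (fun j => h (s j)) (fun i j hij => ?_) ⟨a, fun j => ?_⟩
      · exact s.injective (hh (Set.mem_biUnion hw ⟨i, rfl⟩) (Set.mem_biUnion hw ⟨j, rfl⟩) hij)
      · refine (hφ _ _).2 ?_
        convert ha j using 2
        ext m
        simp
    · have hj : j < r := hr _ hw
      have := hx ((List.range r).map (h ∘ ξ)) (by simp) j hj
      rw [zero_add, hφ] at this
      simp only [Ψ, Sum.elim_inr, Formula.realize_relabel]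
      convert this using 1
      ext (i | i)
      · rfl
      · simp only [Function.comp_apply, Sum.elim_inr, Sum.elim_inl, ← List.map_take,
          List.take_range, List.map_map]
        rw [min_eq_left (by omega)]
  obtain ⟨N, _, hN, v, hv⟩ := exists_model_realizing (Set.range Ψ) hfin
  have : Nonempty N := ⟨v (Sum.inl ([], 0))⟩
  let E : List Λ → ℕ → N := fun l m => v (Sum.inl (l, m))
  let x : (ℕ → Λ) → α → N := fun ξ i => v (Sum.inr (ξ, i))
  have hinc : ∀ (l : List Λ) (s : Fin (k l.length) ↪ Λ),
      ¬ ∃ a : α → N, ∀ j, (φ l.length).Realize (Sum.elim a (E (l ++ [s j]))) := by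
    intro l s
    have := hv _ ⟨Sum.inl ⟨l, s⟩, rfl⟩
    exact realize_inconsFormula.1 this
  have hbr : ∀ (ξ : ℕ → Λ) (j : ℕ),
      (φ j).Realize (Sum.elim (x ξ) (E ((List.range (j + 1)).map ξ))) := by
    intro ξ j
    have := hv _ ⟨Sum.inr ⟨ξ, j⟩, rfl⟩
    simp only [Ψ, Sum.elim_inr, Formula.realize_relabel] at this
    convert this using 1
    ext (i | i) <;> rfl
  let A : Set N := Set.range fun w : List Λ × ℕ => v (Sum.inl w)
  have hA : #A ≤ μ := by
    refine Cardinal.mk_range_le.trans ?_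
    rw [Cardinal.mk_prod, Cardinal.lift_id', Cardinal.mk_list_eq_mk, hΛ]
    simp [Cardinal.mul_aleph0_eq hμ2]
  have hEA : ∀ l m, E l m ∈ A := fun l m => ⟨(l, m), rfl⟩
  obtain ⟨n, ⟨e⟩⟩ := Finite.exists_equiv_fin α
  have hst := hT μ hμ1 N inferInstance hN A hA n
  let tp : (ℕ → Λ) → ((L[[A]]).completeTheory N).CompleteType (Fin n) :=
    fun ξ => ((L[[A]]).completeTheory N).typeOf (x ξ ∘ e.symm)
  have htp : ∀ ξ η, tp ξ = tp η → ∀ j l, (φ j).Realize (Sum.elim (x ξ) (E l)) →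
      (φ j).Realize (Sum.elim (x η) (E l)) := by
    intro ξ η h j l hh
    have := realize_iff_of_typeOf_eq A h ((φ j).relabel (Sum.map e id)) (E l) (hEA l)
    simp only [Formula.realize_relabel, Sum.elim_comp_map, Function.comp_assoc,
      Equiv.symm_comp_self, Function.comp_id] at this
    exact this.1 hh
  have hfib : ∀ t, #(tp ⁻¹' {t}) ≤ 𝔠 := by
    intro t
    by_cases ht : ∃ ξ, tp ξ = t
    · obtain ⟨ξ, rfl⟩ := ht
      let F : List Λ → Set Λ := fun l =>
        {i | (φ l.length).Realize (Sum.elim (x ξ) (E (l ++ [i])))}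
      have hF : ∀ l, (F l).Finite := by
        intro l
        by_contra hinf
        let f := (Set.Infinite.natEmbedding _ hinf)
        exact hinc l ⟨fun j => (f j).1, fun i j h => Fin.ext (f.injective (Subtype.ext h))⟩
          ⟨x ξ, fun j => (f j).2⟩
      refine le_trans ?_ (mk_branches_le F hF)
      refine Cardinal.mk_le_of_injective (f := fun η : tp ⁻¹' {tp ξ} => ⟨η.1, fun n => ?_⟩) ?_
      · have := htp η.1 ξ η.2 n _ (hbr η.1 n)
        simpa [F, List.range_succ] using this
      · rintro ⟨η, hη⟩ ⟨η', hη'⟩ h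
        simpa using h
    · rw [show tp ⁻¹' {t} = ∅ from Set.eq_empty_iff_forall_notMem.2 fun ξ hξ => ht ⟨ξ, hξ⟩]
      simp
  have h1 := Cardinal.mk_le_mk_mul_of_mk_preimage_le tp hfib
  have h2 : #(ℕ → Λ) = μ ^ ℵ₀ := by simp [hΛ]
  rw [h2] at h1
  have h3 : 𝔠 ≤ μ := by
    refine le_trans ?_ hμ1
    rw [← Cardinal.two_power_aleph0]
    exact Cardinal.power_le_power_left two_ne_zero le_sup_right
  have h4 := h1.trans (mul_le_mul' hst h3)
  rw [Cardinal.mul_eq_self hμ2] at h4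
  exact absurd h4 (not_le.2 hμ3)

end Tree

/-! ### The ambient model -/

section Ambient

/-- `M` is saturated above the cardinal `card`, and carries no long trees of instances. -/
class Amb (L : FirstOrder.Language.{u, u}) (M : Type u) [L.Structure M] where
  card : Cardinal.{u}
  aleph0_le : ℵ₀ ≤ card
  nonempty : Nonempty M
  oneSat : OneSat L (Set.univ : Set M) (Order.succ card)
  exists_not_hasTree : ∀ {α : Type} [Finite α] (σ : ℕ → ((α ⊕ ℕ → M) → Prop) × ℕ),
    (∀ n, Dfb L ∅ (σ n).1) → ∃ r, ¬ HasTree ((List.range r).map σ) (fun _ => True)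

/-- The set `C` is small compared to the saturation of `M`. -/
def Small (L : FirstOrder.Language.{u, u}) {M : Type u} [L.Structure M] [Amb L M]
    (C : Set M) : Prop :=
  #C ≤ Amb.card L M

theorem Small.mono [Amb L M] {C D : Set M} (h : Small L D) (hCD : C ⊆ D) : Small L C :=
  (Cardinal.mk_le_mk_of_subset hCD).trans h

theorem Small.union [Amb L M] {C D : Set M} (hC : Small L C) (hD : Small L D) :
    Small L (C ∪ D) :=
  (Cardinal.mk_union_le _ _).trans (Cardinal.add_le_of_le Amb.aleph0_le hC hD)

theorem Small.of_countable [Amb L M] {C : Set M} (h : C.Countable) : Small L C :=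
  (Cardinal.mk_le_aleph0_iff.2 h.to_subtype).trans Amb.aleph0_le

theorem Small.range [Amb L M] {ι : Type} [Countable ι] (x : ι → M) : Small L (Set.range x) :=
  Small.of_countable (Set.countable_range x)

theorem Small.lt [Amb L M] {C : Set M} (h : Small L C) : #C < Order.succ (Amb.card L M) :=
  Order.lt_succ_iff.2 h

theorem Small.finite [Amb L M] {C : Set M} (h : C.Finite) : Small L C :=
  Small.of_countable h.countable

theorem exists_of_directed {X : Type*} {p : Set (X → Prop)} (hne : p.Nonempty)
    (hdir : ∀ P ∈ p, ∀ Q ∈ p, ∃ R ∈ p, ∀ v, R v → P v ∧ Q v) (hsat : ∀ P ∈ p, ∃ v, P v)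
    (q : Set (X → Prop)) (hq : q ⊆ p) (hqf : q.Finite) : ∃ v, ∀ P ∈ q, P v := by
  have : ∃ R ∈ p, ∀ v, R v → ∀ P ∈ q, P v := by
    induction q, hqf using Set.Finite.induction_on with
    | empty => exact ⟨_, hne.some_mem, by simp⟩
    | insert _ _ ih =>
      obtain ⟨R, hR, h⟩ := ih ((Set.subset_insert _ _).trans hq)
      obtain ⟨R', hR', h'⟩ := hdir R hR _ (hq (Set.mem_insert _ _))
      refine ⟨R', hR', fun v hv P hP => ?_⟩
      rcases hP with rfl | hP
      · exact (h' v hv).2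
      · exact h v (h' v hv).1 P hP
  obtain ⟨R, hR, h⟩ := this
  obtain ⟨v, hv⟩ := hsat R hR
  exact ⟨v, h v hv⟩

/-- Realizing a directed family of predicates. -/
theorem Small.realize [Amb L M] {C : Set M} (hC : Small L C) {ι : Type} [Countable ι]
    (p : Set ((ι → M) → Prop)) (hp : ∀ P ∈ p, Dfb L C P)
    (hfin : ∀ q : Set ((ι → M) → Prop), q ⊆ p → q.Finite → ∃ x : ι → M, ∀ P ∈ q, P x) :
    ∃ x : ι → M, ∀ P ∈ p, P x := by
  have : Nonempty M := Amb.nonempty L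
  obtain ⟨x, -, hx⟩ := Amb.oneSat.countable (Amb.aleph0_le.trans (Order.le_succ _))
    (Set.subset_univ C) hC.lt p hp hfin
  exact ⟨x, hx⟩

theorem OneSat.extend [Nonempty M] {N : Set M} {μ : Cardinal.{u}} (h : OneSat L N μ)
    (hμ : ℵ₀ < μ) {C : Set M} (hCN : C ⊆ N) (hC : #C < μ) {ι κ : Type} [Countable ι]
    [Countable κ] {x y : ι → M} (hy : ∀ i, y i ∈ N) (hxy : Eqv L C x y) (z : κ → M) :
    ∃ w : κ → M, (∀ i, w i ∈ N) ∧ Eqv L C (Sum.elim x z) (Sum.elim y w) := by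
  have hS : #↥(C ∪ Set.range y) < μ := by
    refine (Cardinal.mk_union_le _ _).trans_lt (Cardinal.add_lt_of_lt hμ.le hC ?_)
    exact (Cardinal.mk_le_aleph0_iff.2 (Set.countable_range y).to_subtype).trans_lt hμ
  have key := h.countable hμ.le (S := C ∪ Set.range y)
    (Set.union_subset hCN (by rintro _ ⟨i, rfl⟩; exact hy i)) hS
    {P : (κ → M) → Prop | ∃ Q : (ι ⊕ κ → M) → Prop, Dfb L C Q ∧ Q (Sum.elim x z) ∧
      P = fun w => Q (Sum.elim y w)} ?_ ?_
  · obtain ⟨w, hwN, hw⟩ := key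
    exact ⟨w, hwN, fun Q hQ hx => hw _ ⟨Q, hQ, hx, rfl⟩⟩
  · rintro _ ⟨Q, hQ, -, rfl⟩
    have := ((hQ.comp Sum.swap).mono (Set.subset_union_left (t := Set.range y))).inst' y
      fun i => Or.inr ⟨i, rfl⟩
    refine this.congr fun v => ?_
    apply iff_of_eq
    congr 1
    ext (i | i) <;> rfl
  · refine exists_of_directed ⟨_, fun _ => True, Dfb.const _, trivial, rfl⟩ ?_ ?_
    · rintro _ ⟨Q, hQ, hx, rfl⟩ _ ⟨Q', hQ', hx', rfl⟩
      exact ⟨_, ⟨_, hQ.and hQ', ⟨hx, hx'⟩, rfl⟩, fun v hv => hv⟩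
    · rintro _ ⟨Q, hQ, hx, rfl⟩
      exact hxy _ hQ.ex' ⟨z, hx⟩

theorem Eqv.extend [Amb L M] {C : Set M} (hC : Small L C) {ι κ : Type} [Countable ι]
    [Countable κ] {x y : ι → M} (hxy : Eqv L C x y) (z : κ → M) :
    ∃ w : κ → M, Eqv L C (Sum.elim x z) (Sum.elim y w) := by
  have : Nonempty M := Amb.nonempty L
  obtain ⟨w, -, hw⟩ := Amb.oneSat.extend (Order.lt_succ_of_le Amb.aleph0_le)
    (Set.subset_univ C) hC.lt (fun _ => trivial) hxy z
  exact ⟨w, hw⟩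

/-- Building a sequence by recursion from the set of the previous values. -/
theorem exists_seq {X : Type*} (Q : Set X → X → Prop) (h : ∀ S : Set X, S.Finite → ∃ y, Q S y) :
    ∃ g : ℕ → X, ∀ n, Q (g '' Set.Iio n) (g n) := by
  classical
  have : Nonempty X := ⟨(h ∅ Set.finite_empty).choose⟩
  choose! y hy using h
  let F : ℕ → Set X := fun n => Nat.rec ∅ (fun _ S => insert (y S) S) n
  have hF : ∀ n, F n = (fun n => y (F n)) '' Set.Iio n := by
    intro n
    induction n with
    | zero => simp [F]
    | succ n ih =>
      rw [show F (n + 1) = insert (y (F n)) (F n) from rfl]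
      rw [show Set.Iio (n + 1) = insert n (Set.Iio n) by ext; simp, Set.image_insert_eq,
        ← ih]
  refine ⟨fun n => y (F n), fun n => ?_⟩
  rw [← hF]
  refine hy _ ?_
  rw [hF]
  exact (Set.finite_Iio n).image _

end Ambient

section TreeLemmas

variable {α : Type} {X Z : (α → M) → Prop} {s t : List (((α ⊕ ℕ → M) → Prop) × ℕ)}

theorem Incons.comp {α β : Type} {R : (α ⊕ β → M) → Prop} {k : ℕ} {ι κ : Type*}
    {B : ι → β → M} (h : Incons R k B) {f : κ → ι} (hf : Function.Injective f) :
    Incons R k fun i => B (f i) :=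
  fun s hs => h (f ∘ s) (hf.comp hs)

theorem HasTree.mono (h : HasTree s X) (hXZ : ∀ x, X x → Z x) : HasTree s Z := by
  induction s generalizing X Z with
  | nil =>
    obtain ⟨x, hx⟩ := h
    exact ⟨x, hXZ x hx⟩
  | cons P s ih =>
    obtain ⟨e, he, hT⟩ := h
    exact ⟨e, he, fun i => ih (hT i) fun x hx => ⟨hXZ x hx.1, hx.2⟩⟩

theorem HasTree.sublist (h : HasTree s X) (hst : t.Sublist s) : HasTree t X := by
  induction hst generalizing X with
  | slnil => exact h
  | cons P _ ih =>
    obtain ⟨e, he, hT⟩ := h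
    exact ih ((hT 0).mono fun x hx => hx.1)
  | cons_cons P _ ih =>
    obtain ⟨e, he, hT⟩ := h
    exact ⟨e, he, fun i => ih (hT i)⟩

theorem HasTree.or (h : HasTree s fun x => X x ∨ Z x) : HasTree s X ∨ HasTree s Z := by
  induction s generalizing X Z with
  | nil =>
    obtain ⟨x, hx | hx⟩ := h
    exacts [Or.inl ⟨x, hx⟩, Or.inr ⟨x, hx⟩]
  | cons P s ih =>
    obtain ⟨e, he, hT⟩ := h
    have h' : ∀ i, HasTree s (fun x => X x ∧ P.1 (Sum.elim x (e i))) ∨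
        HasTree s (fun x => Z x ∧ P.1 (Sum.elim x (e i))) := fun i =>
      ih ((hT i).mono fun x hx => by tauto)
    by_cases hinf : {i | HasTree s (fun x => X x ∧ P.1 (Sum.elim x (e i)))}.Infinite
    · left
      let f := Set.Infinite.natEmbedding _ hinf
      exact ⟨fun i => e (f i), he.comp (f := fun i => (f i).1)
        (Subtype.val_injective.comp f.injective), fun i => (f i).2⟩
    · right
      have hinf' := (Set.not_infinite.1 hinf).infinite_compl
      let f := Set.Infinite.natEmbedding _ hinf'
      exact ⟨fun i => e (f i), he.comp (f := fun i => (f i).1)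
        (Subtype.val_injective.comp f.injective), fun i => (h' _).resolve_left (f i).2⟩

theorem HasTree.finEx {ι : Type} [Finite ι] {X : ι → (α → M) → Prop}
    (hs : ∀ x, Z x → ∃ i, X i x) (h : HasTree s Z) : ∃ i, HasTree s fun x => Z x ∧ X i x := by
  by_contra! hcon
  have : ∀ t : Set ι, t.Finite → ¬ HasTree s (fun x => Z x ∧ ∃ i ∈ t, X i x) := by
    intro t ht
    induction t, ht using Set.Finite.induction_on with
    | empty =>
      intro h
      obtain ⟨x, -, i, hi, -⟩ := h.sublist (List.nil_sublist _)
      exact hi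
    | @insert i t _ _ ih =>
      intro h
      have h1 : HasTree s (fun x => (Z x ∧ X i x) ∨ (Z x ∧ ∃ i ∈ t, X i x)) := by
        refine h.mono ?_
        rintro x ⟨hx, j, rfl | hj, hXj⟩
        exacts [Or.inl ⟨hx, hXj⟩, Or.inr ⟨hx, j, hj, hXj⟩]
      exact h1.or.elim (hcon i) ih
  exact this Set.univ Set.finite_univ (h.mono fun x hx => ⟨hx, by simpa using hs x hx⟩)

theorem Dfb.not_exists_forall {C : Set M} {ι β : Type} [Finite α] {R : (α ⊕ β → M) → Prop}
    (hR : Dfb L C R) {k : ℕ} (g : Fin k → β → ι) :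
    Dfb L C (fun v : ι → M => ¬ ∃ a : α → M, ∀ j, R (Sum.elim a fun i => v (g j i))) := by
  refine (Dfb.ex (κ := α) (P := fun w : ι ⊕ α → M =>
    ∀ j, R (Sum.elim (fun i => w (Sum.inr i)) fun i => w (Sum.inl (g j i)))) ?_).not
  refine Dfb.finAll fun j => ?_
  refine (hR.comp (Sum.elim Sum.inr fun i => Sum.inl (g j i))).congr fun v => ?_
  apply iff_of_eq
  congr 1
  ext (i | i) <;> rfl

theorem Dfb.incons {C : Set M} {ι β κ : Type} [Finite α] [Finite κ] {R : (α ⊕ β → M) → Prop}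
    (hR : Dfb L C R) (k : ℕ) (g : κ → β → ι) :
    Dfb L C (fun v : ι → M => Incons R k fun i j => v (g i j)) :=
  (Dfb.finAll fun s : {s : Fin k → κ // Function.Injective s} =>
    hR.not_exists_forall fun j => g (s.1 j)).congr fun _ =>
      ⟨fun h s => h s.1 s.2, fun h s hs => h ⟨s, hs⟩⟩

theorem HasTree.of_eqv [Amb L M] {C : Set M} (hC : Small L C) [Finite α]
    (hs : ∀ P ∈ s, Dfb L C P.1) {β : Type} [Countable β] {θ : (α ⊕ β → M) → Prop}
    (hθ : Dfb L C θ) {b b' : β → M} (hb : Eqv L C b b')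
    (h : HasTree s fun x => θ (Sum.elim x b)) : HasTree s fun x => θ (Sum.elim x b') := by
  induction s generalizing β with
  | nil =>
    refine hb (fun b => ∃ x, θ (Sum.elim x b)) ?_ h
    exact ((hθ.comp Sum.swap).ex).congr fun v => exists_congr fun z => by
      apply iff_of_eq
      congr 1
      ext (i | i) <;> rfl
  | cons P s ih =>
    obtain ⟨e, he, hT⟩ := h
    obtain ⟨e', he'⟩ := hb.extend hC (fun p : ℕ × ℕ => e p.1 p.2)
    refine ⟨fun i j => e' (i, j), fun t ht => ?_, fun i => ?_⟩
    · exact (he'.comp Sum.inr).iff ((hs P (by simp)).not_exists_forall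
        fun j i => (t j, i)) |>.1 (he t ht)
    · have hP := hs P (by simp)
      have := ih (β := β ⊕ ℕ) (fun P hP => hs P (List.mem_cons_of_mem _ hP))
        ((hθ.comp (Sum.map id Sum.inl)).and (hP.comp (Sum.map id Sum.inr)))
        (he'.comp (Sum.map id fun j => (i, j))) (by
          simp only [Sum.elim_comp_map, Function.comp_id, Sum.elim_comp_inl, Sum.elim_comp_inr]
          exact hT i)
      simp only [Sum.elim_comp_map, Function.comp_id, Sum.elim_comp_inl, Sum.elim_comp_inr] at this
      exact this

theorem exists_replicate_sublist {X : Type*} {Δ : Finset X} (ρ : X → ℕ)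
    (s : List X) (hs : ∀ P ∈ s, P ∈ Δ) (hlen : (∑ P ∈ Δ, ρ P) + 1 ≤ s.length) :
    ∃ P ∈ Δ, (List.replicate (ρ P) P).Sublist s := by
  classical
  have h2 : ∑ P ∈ Δ, s.count P = s.length := by
    rw [← List.sum_toFinset_count_eq_length]
    symm
    refine Finset.sum_subset (fun P hP => hs P (List.mem_toFinset.1 hP)) ?_
    intro P _ hP
    exact List.count_eq_zero.2 fun h => hP (List.mem_toFinset.2 h)
  obtain ⟨P, hP, hlt⟩ : ∃ P ∈ Δ, ρ P < s.count P :=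
    Finset.exists_lt_of_sum_lt (f := ρ) (g := fun P => s.count P) (by omega)
  exact ⟨P, hP, List.replicate_sublist_iff.2 hlt.le⟩

/-- Lists of patterns from a finite set with a tree have bounded length. -/
theorem exists_bound_hasTree [Amb L M] [Finite α] {Δ : Set (((α ⊕ ℕ → M) → Prop) × ℕ)}
    (hΔ : Δ.Finite) (hdfb : ∀ P ∈ Δ, Dfb L ∅ P.1) :
    ∃ r, ∀ s : List (((α ⊕ ℕ → M) → Prop) × ℕ), (∀ P ∈ s, P ∈ Δ) → r ≤ s.length →
      ¬ HasTree s fun _ => True := by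
  classical
  lift Δ to Finset (((α ⊕ ℕ → M) → Prop) × ℕ) using hΔ
  have h1 : ∀ P ∈ Δ, ∃ r, ¬ HasTree (List.replicate r P) fun _ => True := by
    intro P hP
    obtain ⟨r, hr⟩ := Amb.exists_not_hasTree (L := L) (fun _ => P) fun _ => hdfb P hP
    exact ⟨r, by simpa using hr⟩
  choose! ρ hρ using h1
  refine ⟨(∑ P ∈ Δ, ρ P) + 1, fun s hs hlen hT => ?_⟩
  obtain ⟨P, hP, h⟩ := exists_replicate_sublist ρ s hs hlen
  exact hρ P hP (hT.sublist h)

end TreeLemmas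

/-! ### Dividing and independence -/

section Dividing

/-- The instance `R(x, b)` divides over `C` with inconsistency number `k`. -/
def KDiv (L : FirstOrder.Language.{u, u}) {M : Type u} [L.Structure M] (C : Set M)
    {α β : Type} (R : (α ⊕ β → M) → Prop) (k : ℕ) (b : β → M) : Prop :=
  ∀ X : (β → M) → Prop, Dfb L C X → X b → ∀ r : ℕ, ∃ B : Fin r → β → M,
    (∀ i, X (B i)) ∧ Incons R k B

/-- A parameter-free formula together with an inconsistency number. -/
structure Pat (L : FirstOrder.Language.{u, u}) (M : Type u) [L.Structure M] (α : Type) where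
  β : Type
  fin : Finite β
  R : (α ⊕ β → M) → Prop
  dfb : Dfb L ∅ R
  k : ℕ

attribute [instance] Pat.fin

/-- The sets `A` and `B` are independent over `C`. -/
def Ind (L : FirstOrder.Language.{u, u}) {M : Type u} [L.Structure M] (C A B : Set M) : Prop :=
  ∀ (α : Type) [Finite α] (P : Pat L M α) (a : α → M) (b : P.β → M), (∀ i, a i ∈ A) →
    (∀ i, b i ∈ B ∪ C) → P.R (Sum.elim a b) → ¬ KDiv L C P.R P.k b

variable {α β γ κ : Type} {A A' B B' C D E : Set M} {k : ℕ}

theorem KDiv.mono {R : (α ⊕ β → M) → Prop} {b : β → M} (h : KDiv L D R k b) (hCD : C ⊆ D) :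
    KDiv L C R k b :=
  fun X hX => h X (hX.mono hCD)

theorem KDiv.of_eqv {R : (α ⊕ β → M) → Prop} {b b' : β → M} (h : KDiv L C R k b)
    (hb : Eqv L C b b') : KDiv L C R k b' :=
  fun X hX hx => h X hX ((hb.iff hX).2 hx)

theorem Ind.mono (h : Ind L C A B) (hA : A' ⊆ A) (hB : B' ⊆ B ∪ C) : Ind L C A' B' :=
  fun α _ P a b ha hb => h α P a b (fun i => hA (ha i)) fun i =>
    (hb i).elim (fun h => hB h) Or.inr

theorem Ind.base (h : Ind L C A B) (hCD : C ⊆ D) (hD : D ⊆ B ∪ C) : Ind L D A B :=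
  fun α _ P a b ha hb hR hK => h α P a b ha
    (fun i => (hb i).elim Or.inl fun h => hD h) hR (hK.mono hCD)

theorem ind_range [Finite α] {a : α → M} (h : ∀ (P : Pat L M α) (b : P.β → M),
    (∀ i, b i ∈ B ∪ C) → P.R (Sum.elim a b) → ¬ KDiv L C P.R P.k b) :
    Ind L C (Set.range a) B := by
  intro α' _ P a' b ha' hb hR hK
  choose f hf using ha'
  obtain rfl : a ∘ f = a' := funext hf
  refine h ⟨P.β, P.fin, fun v => P.R (v ∘ Sum.map f id), P.dfb.comp _, P.k⟩ b hb
    (by simpa only [Sum.elim_comp_map, Function.comp_id] using hR) ?_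
  intro X hX hXb r
  obtain ⟨B, hB, hI⟩ := hK X hX hXb r
  refine ⟨B, hB, fun s hs ⟨x, hx⟩ => hI s hs ⟨x ∘ f, fun j => ?_⟩⟩
  simpa only [Sum.elim_comp_map, Function.comp_id] using hx j

theorem Ind.not_kDiv (h : Ind L C A B) [Finite α] [Finite β] {W : (α ⊕ β → M) → Prop}
    (hW : Dfb L C W) {a : α → M} {b : β → M} (ha : ∀ i, a i ∈ A) (hb : ∀ i, b i ∈ B ∪ C)
    (hab : W (Sum.elim a b)) : ¬ KDiv L C W k b := by
  intro hK
  rw [← Set.empty_union C] at hW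
  obtain ⟨κ, hκ, c, Q, hc, hQ, hWQ⟩ := hW.split
  have key : ∀ (x : α → M) (y : β → M), Sum.elim x (Sum.elim y c) ∘ (Equiv.sumAssoc α β κ) =
      Sum.elim (Sum.elim x y) c := by
    intro x y
    ext ((i | i) | i) <;> rfl
  refine h α ⟨β ⊕ κ, inferInstance, fun v => Q (v ∘ Equiv.sumAssoc α β κ), hQ.comp _, k⟩ a
    (Sum.elim b c) ha ?_ ?_ ?_
  swap
  · change Q (Sum.elim a (Sum.elim b c) ∘ Equiv.sumAssoc α β κ)
    rw [key, ← hWQ]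
    exact hab
  · rintro (i | i)
    exacts [hb i, Or.inr (hc i)]
  · intro X hX hXb r
    obtain ⟨B, hB, hI⟩ := hK (fun y => X (Sum.elim y c)) (hX.inst c hc) hXb r
    refine ⟨fun i => Sum.elim (B i) c, hB, fun s hs ⟨x, hx⟩ => hI s hs ⟨x, fun j => ?_⟩⟩
    have h1 : Q (Sum.elim x (Sum.elim (B (s j)) c) ∘ Equiv.sumAssoc α β κ) := hx j
    rwa [key, ← hWQ] at h1


/-- Dividing persists when the base is extended by an independent set. -/
theorem KDiv.base_ext [Finite α] [Finite β] {R : (α ⊕ β → M) → Prop} (hR : Dfb L C R)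
    {b : β → M} (hK : KDiv L C R k b) (h : Ind L C A (Set.range b)) : KDiv L (C ∪ A) R k b := by
  intro X hX hXb r
  obtain ⟨κ, hκ, a, Q, ha, hQ, hXQ⟩ := hX.split
  by_contra hcon
  rcases Nat.eq_zero_or_pos r with rfl | hr
  · obtain ⟨B, -, hI⟩ := hK (fun _ => True) (Dfb.const _) trivial 0
    exact hcon ⟨B, fun i => i.elim0, hI⟩
  let χ : (κ → M) → Prop := fun z => ∃ B : Fin r × β → M,
    (∀ i, Q (Sum.elim (fun j => B (i, j)) z)) ∧ Incons R k fun i j => B (i, j)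
  have hχ : Dfb L C χ := by
    refine Dfb.ex (P := fun w : κ ⊕ (Fin r × β) → M =>
      (∀ i, Q (Sum.elim (fun j => w (Sum.inr (i, j))) fun j => w (Sum.inl j))) ∧
        Incons R k fun i j => w (Sum.inr (i, j))) (Dfb.and (Dfb.finAll fun i => ?_)
        (hR.incons k fun i j => Sum.inr (i, j)))
    refine (hQ.comp (Sum.elim (fun j => Sum.inr (i, j)) Sum.inl)).congr fun v => ?_
    apply iff_of_eq
    congr 1
    ext (i | i) <;> rfl
  have hW : Dfb L C (fun v : κ ⊕ β → M => Q (v ∘ Sum.swap) ∧ ¬ χ (v ∘ Sum.inl)) :=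
    (hQ.comp _).and (hχ.comp _).not
  have hsw : ∀ (z : κ → M) (y : β → M), Sum.elim z y ∘ Sum.swap = Sum.elim y z := by
    intro z y
    ext (i | i) <;> rfl
  refine h.not_kDiv (k := r) hW (a := a) (b := b) ha (fun i => Or.inl ⟨i, rfl⟩) ⟨?_, ?_⟩ ?_
  · rw [hsw, ← hXQ]
    exact hXb
  · rintro ⟨B, hB, hI⟩
    exact hcon ⟨fun i j => B (i, j), fun i => (hXQ _).2 (hB i), hI⟩
  · intro Y hY hYb r'
    obtain ⟨B, hB, hI⟩ := hK Y hY hYb r'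
    refine ⟨B, hB, fun s hs ⟨z, hz⟩ => (hz ⟨0, hr⟩).2 ⟨fun p => B (s p.1) p.2, fun i => ?_, ?_⟩⟩
    · have := (hz i).1
      rwa [hsw] at this
    · exact hI.comp hs

theorem Ind.base_left : Ind L C C B := by
  intro α _ P a b ha hb hR hK
  obtain ⟨B, hB, hI⟩ := hK (fun y => P.R (Sum.elim a y)) (by
    have := ((P.dfb.mono (Set.empty_subset C)).comp Sum.swap).inst a ha
    refine this.congr fun v => ?_
    apply iff_of_eq
    congr 1
    ext (i | i) <;> rfl) hR P.k
  exact hI id Function.injective_id ⟨a, hB⟩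

/-- Left transitivity. -/
theorem Ind.left_trans (h : Ind L C A B) (h' : Ind L (C ∪ A) A' B) : Ind L C (A ∪ A') B := by
  classical
  intro α _ P a b ha hb hR hK
  have hK' : KDiv L (C ∪ A) P.R P.k b := hK.base_ext (P.dfb.mono (Set.empty_subset _))
    (h.mono subset_rfl (by rintro _ ⟨i, rfl⟩; exact hb i))
  let W : ({i // a i ∉ A} ⊕ P.β → M) → Prop := fun v =>
    P.R (Sum.elim (fun i => if hi : a i ∈ A then a i else v (Sum.inl ⟨i, hi⟩)) (v ∘ Sum.inr))
  have hW : Dfb L (C ∪ A) W := by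
    have h1 := ((P.dfb.mono (Set.empty_subset (C ∪ A))).comp (κ := ({i // a i ∉ A} ⊕ P.β) ⊕
      {i // a i ∈ A}) (Sum.elim (fun i => if hi : a i ∈ A then Sum.inr ⟨i, hi⟩ else
      Sum.inl (Sum.inl ⟨i, hi⟩)) fun j => Sum.inl (Sum.inr j))).inst (fun i => a i.1)
      fun i => Or.inr i.2
    refine h1.congr fun v => ?_
    apply iff_of_eq
    dsimp only [W]
    congr 1
    ext (i | i)
    · by_cases hi : a i ∈ A <;> simp [hi]
    · rfl
  refine h'.not_kDiv (k := P.k) hW (a := fun i => a i.1) (b := b)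
    (fun i => (ha i.1).resolve_left i.2) (fun i => ?_) ?_ ?_
  · exact (hb i).elim Or.inl fun h => Or.inr (Or.inl h)
  · dsimp only [W]
    convert hR using 1
    ext (i | i)
    · by_cases hi : a i ∈ A <;> simp
    · rfl
  · intro X hX hXb r
    obtain ⟨B, hB, hI⟩ := hK' X hX hXb r
    exact ⟨B, hB, fun s hs ⟨x, hx⟩ => hI s hs
      ⟨fun i => if hi : a i ∈ A then a i else x ⟨i, hi⟩, fun j => hx j⟩⟩

theorem Ind.union_base (h : Ind L C A B) : Ind L C (C ∪ A) B :=
  Ind.base_left.left_trans (by rwa [Set.union_self])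

/-- The algebraic closure of `C` is independent from everything over `C`. -/
theorem ind_acl : Ind L C (aclSet (L := L) C) B := by
  intro α _ P a b ha hb hR hK
  have hφ : ∀ i, ∃ Z : (Fin 1 → M) → Prop, Dfb L C Z ∧ Z ![a i] ∧ {y | Z ![y]}.Finite := by
    intro i
    obtain ⟨φ, h1, h2⟩ := ha i
    refine ⟨fun v => φ.Realize (Sum.elim v Subtype.val), ?_, h1, h2⟩
    obtain ⟨s, t, ψ, h⟩ := exists_restrict (M := M) φ
    let e := t.equivFin
    refine ⟨Fin t.card, inferInstance, fun i => (e.symm i).1.1,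
      ψ.relabel (Sum.map Subtype.val e), fun i => (e.symm i).1.2, fun v => ?_⟩
    dsimp only
    rw [h, Formula.realize_relabel, Sum.elim_comp_map]
    apply iff_of_eq
    congr 2
    ext i
    simp
  choose Z hZ1 hZ2 hZ3 using hφ
  let Y : (α → M) → Prop := fun v => ∀ i, Z i ![v i]
  have hY : Dfb L C Y := Dfb.finAll fun i => ((hZ1 i).comp (fun _ => i)).congr fun v => by
    apply iff_of_eq
    congr 1
    ext j
    rw [Subsingleton.elim j 0]
    rfl
  have hYf : {v | Y v}.Finite := by
    refine (Set.Finite.pi' (t := fun i => {y | Z i ![y]}) hZ3).subset fun v hv i => hv i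
  obtain ⟨N, hN⟩ : ∃ N, N = hYf.toFinset.card := ⟨_, rfl⟩
  have hX : Dfb L C (fun y : P.β → M => ∃ v : α → M, Y v ∧ P.R (Sum.elim v y)) := by
    refine (Dfb.ex (P := fun w : P.β ⊕ α → M => Y (w ∘ Sum.inr) ∧ P.R (w ∘ Sum.swap))
      ((hY.comp _).and ((P.dfb.mono (Set.empty_subset _)).comp _))).congr fun v =>
      exists_congr fun z => ?_
    refine and_congr Iff.rfl ?_
    apply iff_of_eq
    congr 1
    ext (i | i) <;> rfl
  obtain ⟨B, hB, hI⟩ := hK _ hX ⟨a, hZ2, hR⟩ (N * P.k + 1)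
  choose x hx1 hx2 using hB
  classical
  obtain ⟨v, hv, hlt⟩ := Finset.exists_lt_card_fiber_of_mul_lt_card_of_maps_to
    (s := Finset.univ) (t := hYf.toFinset) (f := x) (n := P.k) (by simpa using hx1)
    (by rw [← hN]; simp)
  obtain ⟨s⟩ : Nonempty (Fin P.k ↪ {i // x i = v}) := by
    refine Function.Embedding.nonempty_of_card_le ?_
    rw [Fintype.card_fin, Fintype.card_subtype]
    exact hlt.le
  refine hI (fun j => (s j).1) (Subtype.val_injective.comp s.injective) ⟨v, fun j => ?_⟩
  have := hx2 (s j).1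
  rwa [(s j).2] at this

end Dividing

/-! ### Trees of dividing instances -/

section Fork

variable {α β γ κ ι : Type} {A A' B B' C D E : Set M} {k : ℕ}

/-- A pattern, with its parameter variables renamed to natural numbers. -/
noncomputable def Pat.raw (P : Pat L M α) : ((α ⊕ ℕ → M) → Prop) × ℕ :=
  (fun v => P.R (v ∘ Sum.map id (exists_injective_nat P.β).choose), P.k)

theorem Pat.raw_dfb (P : Pat L M α) : Dfb L ∅ P.raw.1 :=
  P.dfb.comp _

theorem Pat.exists_raw [Nonempty M] (P : Pat L M α) (b : P.β → M) :
    ∃ e : ℕ → M, e ∘ (exists_injective_nat P.β).choose = b :=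
  ⟨Function.extend (exists_injective_nat P.β).choose b fun _ => Classical.arbitrary M,
    funext fun i => (exists_injective_nat P.β).choose_spec.extend_apply _ _ i⟩

theorem Pat.raw_elim (P : Pat L M α) (x : α → M) (e : ℕ → M) :
    P.raw.1 (Sum.elim x e) ↔ P.R (Sum.elim x (e ∘ (exists_injective_nat P.β).choose)) := by
  simp only [Pat.raw, Sum.elim_comp_map, Function.comp_id]

theorem KDiv.exists_seq [Amb L M] (hC : Small L C) [Finite α] [Finite β] {R : (α ⊕ β → M) → Prop}
    (hR : Dfb L C R) {b : β → M} (h : KDiv L C R k b) :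
    ∃ e : ℕ → β → M, (∀ i, Eqv L C b (e i)) ∧ Incons R k e := by
  have key := hC.realize (ι := ℕ × β) {Y | ∃ (r : ℕ) (X : (β → M) → Prop), Dfb L C X ∧ X b ∧
    Y = fun v => (∀ i : Fin r, X fun j => v (i, j)) ∧ Incons R k fun (i : Fin r) j => v (i, j)}
    ?_ ?_
  · obtain ⟨v, hv⟩ := key
    refine ⟨fun i j => v (i, j), fun i X hX hXb => ?_, fun s hs hx => ?_⟩
    · exact (hv _ ⟨i + 1, X, hX, hXb, rfl⟩).1 ⟨i, Nat.lt_succ_self i⟩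
    · obtain ⟨N, hN⟩ : ∃ N, ∀ j, s j < N := by
        obtain ⟨N, hN⟩ := (Set.finite_range s).bddAbove
        exact ⟨N + 1, fun j => Nat.lt_succ_of_le (hN ⟨j, rfl⟩)⟩
      refine (hv _ ⟨N, fun _ => True, Dfb.const _, trivial, rfl⟩).2 (fun j => ⟨s j, hN j⟩) ?_ hx
      intro i j hij
      exact hs (congrArg Fin.val hij)
  · rintro _ ⟨r, X, hX, -, rfl⟩
    exact (Dfb.finAll fun i : Fin r => hX.comp fun j => ((i : ℕ), j)).and
      (hR.incons k fun (i : Fin r) j => ((i : ℕ), j))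
  · refine exists_of_directed ⟨_, 0, fun _ => True, Dfb.const _, trivial, rfl⟩ ?_ ?_
    · rintro _ ⟨r, X, hX, hXb, rfl⟩ _ ⟨r', X', hX', hXb', rfl⟩
      refine ⟨_, ⟨max r r', _, hX.and hX', ⟨hXb, hXb'⟩, rfl⟩, ?_⟩
      rintro v ⟨h1, h2⟩
      refine ⟨⟨fun i => (h1 (Fin.castLE (le_max_left _ _) i)).1,
        h2.comp (f := Fin.castLE (le_max_left _ _)) (Fin.castLE_injective _)⟩,
        ⟨fun i => (h1 (Fin.castLE (le_max_right _ _) i)).2,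
        h2.comp (f := Fin.castLE (le_max_right _ _)) (Fin.castLE_injective _)⟩⟩
    · rintro _ ⟨r, X, hX, hXb, rfl⟩
      obtain ⟨B, hB, hI⟩ := h X hX hXb r
      have : Nonempty M := Amb.nonempty L
      refine ⟨fun p => if hp : p.1 < r then B ⟨p.1, hp⟩ p.2 else Classical.arbitrary M, ?_, ?_⟩
      · intro i
        simpa using hB i
      · simpa using hI

theorem hasTree_cons [Amb L M] (hC : Small L C) [Finite α]
    {s : List (((α ⊕ ℕ → M) → Prop) × ℕ)} (hs : ∀ P ∈ s, Dfb L ∅ P.1) {X : (α → M) → Prop}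
    (hX : Dfb L C X) (P : Pat L M α) {b : P.β → M} (hK : KDiv L C P.R P.k b)
    (h : HasTree s fun x => X x ∧ P.R (Sum.elim x b)) : HasTree (P.raw :: s) X := by
  have : Nonempty M := Amb.nonempty L
  obtain ⟨e, he, hI⟩ := hK.exists_seq hC (P.dfb.mono (Set.empty_subset _))
  choose e' he' using fun i => P.exists_raw (e i)
  refine ⟨e', fun t ht => ?_, fun i => ?_⟩
  · simp only [Pat.raw_elim, he']
    exact hI t ht
  · simp only [Pat.raw_elim, he']
    have key := HasTree.of_eqv hC (fun Q hQ => (hs Q hQ).mono (Set.empty_subset _))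
      (θ := fun v : α ⊕ P.β → M => X (v ∘ Sum.inl) ∧ P.R v)
      ((hX.comp _).and (P.dfb.mono (Set.empty_subset _))) (he i)
      (by simpa only [Sum.elim_comp_inl] using h)
    simpa only [Sum.elim_comp_inl] using key

theorem hasTree_chain [Amb L M] [Finite α] (P : ℕ → Pat L M α) (b : ∀ i, (P i).β → M)
    (E : ℕ → Set M) (hE : ∀ i, Small L (E i)) (hK : ∀ i, KDiv L (E i) (P i).R (P i).k (b i))
    (hb : ∀ i, ∀ j < i, ∀ l, b j l ∈ E i) (x : α → M) (hx : ∀ i, (P i).R (Sum.elim x (b i)))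
    (m n : ℕ) : HasTree ((List.range' n m).map fun i => (P i).raw)
      (fun x => ∀ j : Fin n, (P j).R (Sum.elim x (b j))) := by
  induction m generalizing n with
  | zero => exact ⟨x, fun j => hx j⟩
  | succ m ih =>
    rw [List.range'_succ, List.map_cons]
    refine hasTree_cons (hE n) ?_ ?_ (P n) (hK n) ((ih (n + 1)).mono ?_)
    · intro Q hQ
      obtain ⟨i, -, rfl⟩ := List.mem_map.1 hQ
      exact (P i).raw_dfb
    · exact Dfb.finAll fun j => ((P j).dfb.mono (Set.empty_subset _)).inst _ (hb n j j.2)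
    · intro y hy
      exact ⟨fun j => hy j.castSucc, hy (Fin.last n)⟩

theorem no_infinite_chain [Amb L M] [Finite α] (P : ℕ → Pat L M α) (b : ∀ i, (P i).β → M)
    (E : ℕ → Set M) (hE : ∀ i, Small L (E i)) (hK : ∀ i, KDiv L (E i) (P i).R (P i).k (b i))
    (hb : ∀ i, ∀ j < i, ∀ l, b j l ∈ E i) (x : α → M) (hx : ∀ i, (P i).R (Sum.elim x (b i))) :
    False := by
  obtain ⟨r, hr⟩ := Amb.exists_not_hasTree (L := L) (fun i => (P i).raw) fun i => (P i).raw_dfb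
  refine hr ?_
  rw [List.range_eq_range']
  exact (hasTree_chain P b E hE hK hb x hx r 0).mono fun _ _ => trivial

/-- The predicate `X` implies a finite disjunction of instances that divide over `C`. -/
def Fork (L : FirstOrder.Language.{u, u}) {M : Type u} [L.Structure M] (C : Set M)
    (X : (α → M) → Prop) : Prop :=
  ∃ (s : Type) (_ : Finite s) (P : s → Pat L M α) (b : ∀ i, (P i).β → M),
    (∀ i, KDiv L C (P i).R (P i).k (b i)) ∧ ∀ x, X x → ∃ i, (P i).R (Sum.elim x (b i))

theorem not_fork [Amb L M] (hC : Small L C) [Finite α] {X : (α → M) → Prop} (hX : Dfb L C X)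
    {a : α → M} (ha : X a) : ¬ Fork L C X := by
  rintro ⟨s, hs, P, b, hK, h⟩
  obtain ⟨r, hr⟩ := exists_bound_hasTree (L := L) (Set.finite_range fun i => (P i).raw)
    (by rintro _ ⟨i, rfl⟩; exact (P i).raw_dfb)
  have key : ∀ n, ∃ l : List (((α ⊕ ℕ → M) → Prop) × ℕ),
      (∀ Q ∈ l, Q ∈ Set.range fun i => (P i).raw) ∧ l.length = n ∧ HasTree l X := by
    intro n
    induction n with
    | zero => exact ⟨[], by simp, rfl, a, ha⟩
    | succ n ih =>
      obtain ⟨l, h1, h2, h3⟩ := ih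
      obtain ⟨i, hi⟩ := h3.finEx (X := fun i x => (P i).R (Sum.elim x (b i))) h
      refine ⟨(P i).raw :: l, ?_, by simp [h2], hasTree_cons hC ?_ hX (P i) (hK i) hi⟩
      · intro Q hQ
        rcases List.mem_cons.1 hQ with rfl | hQ
        exacts [⟨i, rfl⟩, h1 Q hQ]
      · intro Q hQ
        obtain ⟨j, rfl⟩ := h1 Q hQ
        exact (P j).raw_dfb
  obtain ⟨l, h1, h2, h3⟩ := key r
  exact hr l h1 h2.ge (h3.mono fun _ _ => trivial)

/-- The type of `a` over `C ∪ B` does not fork over `C`. -/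
def NFork (L : FirstOrder.Language.{u, u}) {M : Type u} [L.Structure M] (C : Set M)
    (a : α → M) (B : Set M) : Prop :=
  ∀ X : (α → M) → Prop, Dfb L (C ∪ B) X → X a → ¬ Fork L C X

theorem nFork_empty [Amb L M] (hC : Small L C) [Finite α] (a : α → M) : NFork L C a ∅ := by
  intro X hX hXa
  rw [Set.union_empty] at hX
  exact not_fork hC hX hXa

theorem NFork.exists_ind [Amb L M] (hC : Small L C) (hB : Small L B) (hB' : Small L B') [Finite α]
    {a : α → M} (h : NFork L C a B) :
    ∃ a' : α → M, Eqv L (C ∪ B) a a' ∧ Ind L C (Set.range a') (B ∪ B') := by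
  have key := ((hC.union hB).union hB').realize (ι := α) {Y | ∃ (X : (α → M) → Prop) (s : Type)
    (_ : Finite s) (P : s → Pat L M α) (b : ∀ i, (P i).β → M), Dfb L (C ∪ B) X ∧ X a ∧
    (∀ i j, b i j ∈ C ∪ B ∪ B') ∧ (∀ i, KDiv L C (P i).R (P i).k (b i)) ∧
    Y = fun x => X x ∧ ∀ i, ¬ (P i).R (Sum.elim x (b i))} ?_ ?_
  · obtain ⟨a', ha'⟩ := key
    refine ⟨a', fun X hX hXa => ?_, ind_range fun P b hb hR hK => ?_⟩
    · exact (ha' _ ⟨X, Empty, inferInstance, fun i => i.elim, fun i => i.elim, hX, hXa,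
        fun i => i.elim, fun i => i.elim, rfl⟩).1
    · refine (ha' _ ⟨fun _ => True, Unit, inferInstance, fun _ => P, fun _ => b, Dfb.const _,
        trivial, fun _ j => ?_, fun _ => hK, rfl⟩).2 () hR
      rcases hb j with (h | h) | h
      exacts [Or.inl (Or.inr h), Or.inr h, Or.inl (Or.inl h)]
  · rintro _ ⟨X, s, hs, P, b, hX, -, hb, -, rfl⟩
    exact (hX.mono Set.subset_union_left).and
      (Dfb.finAll fun i => (((P i).dfb.mono (Set.empty_subset _)).inst _ (hb i)).not)
  · refine exists_of_directed ⟨_, fun _ => True, Empty, inferInstance, fun i => i.elim,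
      fun i => i.elim, Dfb.const _, trivial, fun i => i.elim, fun i => i.elim, rfl⟩ ?_ ?_
    · rintro _ ⟨X, s, hs, P, b, hX, hXa, hb, hK, rfl⟩ _ ⟨X', s', hs', P', b', hX', hXa', hb', hK', rfl⟩
      refine ⟨_, ⟨_, s ⊕ s', inferInstance, Sum.elim P P', fun i => Sum.casesOn i b b', hX.and hX',
        ⟨hXa, hXa'⟩, ?_, ?_, rfl⟩, ?_⟩
      · rintro (i | i)
        exacts [hb i, hb' i]
      · rintro (i | i)
        exacts [hK i, hK' i]
      · rintro v ⟨h1, h2⟩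
        exact ⟨⟨h1.1, fun i => h2 (Sum.inl i)⟩, ⟨h1.2, fun i => h2 (Sum.inr i)⟩⟩
    · rintro _ ⟨X, s, hs, P, b, hX, hXa, hb, hK, rfl⟩
      by_contra! hcon
      exact h X hX hXa ⟨s, hs, P, b, hK, hcon⟩

theorem small_biUnion [Amb L M] [Countable ι] {S : Set (ι → M)} (hS : S.Finite) :
    Small L (⋃ z ∈ S, Set.range z) :=
  Small.of_countable (hS.countable.biUnion fun z _ => Set.countable_range z)

theorem NFork.exists_seq [Amb L M] (hC : Small L C) (hB : Small L B) [Finite α]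
    {a : α → M} (h : NFork L C a B) : ∃ g : ℕ → α → M, ∀ n, Eqv L (C ∪ B) a (g n) ∧
      Ind L C (Set.range (g n)) (B ∪ ⋃ m ∈ Set.Iio n, Set.range (g m)) := by
  obtain ⟨g, hg⟩ := Benign.exists_seq (fun (S : Set (α → M)) y => Eqv L (C ∪ B) a y ∧
    Ind L C (Set.range y) (B ∪ ⋃ z ∈ S, Set.range z)) fun S hS =>
      h.exists_ind hC hB (small_biUnion hS)
  refine ⟨g, fun n => ?_⟩
  have := hg n
  rwa [Set.biUnion_image] at this

theorem ind_biUnion {g : ℕ → ι → M}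
    (hg : ∀ n, Ind L C (Set.range (g n)) (⋃ m ∈ Set.Iio n, Set.range (g m))) (n : ℕ)
    (T : Finset ℕ) (hT : ∀ m ∈ T, n < m) :
    Ind L C (⋃ m ∈ T, Set.range (g m)) (Set.range (g n)) := by
  induction T using Finset.induction_on_max with
  | empty => exact Ind.base_left.mono (by simp) Set.subset_union_left
  | insert t T hlt ih =>
    have h1 := ih fun m hm => hT m (Finset.mem_insert_of_mem hm)
    have h2 : Ind L (C ∪ ⋃ m ∈ T, Set.range (g m)) (Set.range (g t)) (Set.range (g n)) := by
      refine ((hg t).base Set.subset_union_left ?_).mono subset_rfl ?_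
      · refine Set.union_subset Set.subset_union_right
          (Set.subset_union_of_subset_left ?_ _)
        exact Set.biUnion_subset_biUnion_left fun m hm => hlt m hm
      · refine Set.subset_union_of_subset_left ?_ _
        exact Set.subset_biUnion_of_mem (u := fun m => Set.range (g m))
          (hT t (Finset.mem_insert_self _ _))
    refine (h1.left_trans h2).mono ?_ Set.subset_union_left
    rw [Finset.set_biUnion_insert, Set.union_comm]

theorem hasTree_of_ind [Amb L M] (hC : Small L C) [Countable ι] [Finite α] {g : ℕ → ι → M}
    (hg : ∀ n, Ind L C (Set.range (g n)) (⋃ m ∈ Set.Iio n, Set.range (g m)))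
    (P : ℕ → Pat L M α) (j : ∀ n, (P n).β → ι) (x : α → M) (S : Finset ℕ)
    (hK : ∀ n ∈ S, KDiv L C (P n).R (P n).k (g n ∘ j n))
    (hx : ∀ n ∈ S, (P n).R (Sum.elim x (g n ∘ j n))) :
    ∃ l : List (((α ⊕ ℕ → M) → Prop) × ℕ), (∀ Q ∈ l, ∃ n ∈ S, Q = (P n).raw) ∧
      l.length = S.card ∧ HasTree l fun _ => True := by
  have key : ∀ T : Finset ℕ, (∀ n ∈ S, ∀ m ∈ T, n < m) → ∀ X : (α → M) → Prop,
      Dfb L (C ∪ ⋃ m ∈ T, Set.range (g m)) X → X x →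
      ∃ l : List (((α ⊕ ℕ → M) → Prop) × ℕ), (∀ Q ∈ l, ∃ n ∈ S, Q = (P n).raw) ∧
        l.length = S.card ∧ HasTree l X := by
    induction S using Finset.induction_on_max with
    | empty => exact fun T _ X _ hX => ⟨[], by simp, rfl, x, hX⟩
    | insert n S hlt ih =>
      intro T hT X hX hXx
      have hn : n ∉ S := fun h => (hlt n h).false
      have hnS := Finset.mem_insert_self n S
      have hX' : Dfb L (C ∪ ⋃ m ∈ insert n T, Set.range (g m)) fun x =>
          X x ∧ (P n).R (Sum.elim x (g n ∘ j n)) := by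
        rw [Finset.set_biUnion_insert]
        refine (hX.mono ?_).and (((P n).dfb.mono (Set.empty_subset _)).inst _ fun i => ?_)
        · exact Set.union_subset_union_right _ Set.subset_union_right
        · exact Or.inr (Or.inl ⟨_, rfl⟩)
      obtain ⟨l, h1, h2, h3⟩ := ih (fun m hm => hK m (Finset.mem_insert_of_mem hm))
        (fun m hm => hx m (Finset.mem_insert_of_mem hm)) (insert n T) (fun m hm t ht => by
          rcases Finset.mem_insert.1 ht with rfl | ht
          exacts [hlt m hm, hT m (Finset.mem_insert_of_mem hm) t ht]) _ hX' ⟨hXx, hx n hnS⟩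
      have hI : Ind L C (⋃ m ∈ T, Set.range (g m)) (Set.range (g n ∘ j n)) :=
        (ind_biUnion hg n T fun m hm => hT n hnS m hm).mono subset_rfl
          ((Set.range_comp_subset_range _ _).trans Set.subset_union_left)
      refine ⟨(P n).raw :: l, ?_, ?_, hasTree_cons (C := C ∪ ⋃ m ∈ T, Set.range (g m)) ?_ ?_ hX
        (P n) ((hK n hnS).base_ext ((P n).dfb.mono (Set.empty_subset _)) hI) h3⟩
      · intro Q hQ
        rcases List.mem_cons.1 hQ with rfl | hQ
        · exact ⟨n, hnS, rfl⟩
        · obtain ⟨m, hm, rfl⟩ := h1 Q hQ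
          exact ⟨m, Finset.mem_insert_of_mem hm, rfl⟩
      · rw [Finset.card_insert_of_notMem hn, List.length_cons, h2]
      · exact hC.union (Small.of_countable
          (T.countable_toSet.biUnion fun m _ => Set.countable_range _))
      · intro Q hQ
        obtain ⟨m, hm, rfl⟩ := h1 Q hQ
        exact (P m).raw_dfb
  exact key ∅ (by simp) _ (Dfb.const True) trivial

/-- Nondividing implies nonforking. -/
theorem Ind.nFork [Amb L M] (hC : Small L C) [Finite α] {a : α → M}
    (h : Ind L C (Set.range a) B) : NFork L C a B := by
  intro X hX hXa hF
  obtain ⟨κ, hκ, d, W, hd, hW, hXW⟩ := hX.split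
  obtain ⟨s, hs, P, b, hK, hP⟩ := hF
  let η : κ ⊕ (Σ i, (P i).β) → M := Sum.elim d fun p => b p.1 p.2
  obtain ⟨g, hg⟩ := (nFork_empty hC η).exists_seq hC (B := ∅) (Small.finite Set.finite_empty)
  simp only [Set.union_empty, Set.empty_union] at hg
  obtain ⟨r, hr⟩ := exists_bound_hasTree (L := L) (Set.finite_range fun i => (P i).raw)
    (by rintro _ ⟨i, rfl⟩; exact (P i).raw_dfb)
  have h1 : ¬ KDiv L C W r d :=
    h.not_kDiv hW (fun i => ⟨i, rfl⟩) (fun i => Or.inl (hd i)) ((hXW _).1 hXa)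
  rw [KDiv] at h1
  push Not at h1
  obtain ⟨Z, hZ, hZd, N, hN⟩ := h1
  have h2 := hN (fun i j => g i (Sum.inl j)) fun i => ((hg i).1.comp Sum.inl) Z hZ hZd
  rw [Incons] at h2
  push Not at h2
  obtain ⟨t, ht, x, hx⟩ := h2
  have h3 : ∀ n, (∃ j, (t j : ℕ) = n) → ∃ i, (P i).R (Sum.elim x fun j => g n (Sum.inr ⟨i, j⟩)) := by
    rintro _ ⟨j, rfl⟩
    have : Dfb L C fun v : κ ⊕ (Σ i, (P i).β) → M => ∀ x : α → M, W (Sum.elim x (v ∘ Sum.inl)) →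
        ∃ i, (P i).R (Sum.elim x fun j => v (Sum.inr ⟨i, j⟩)) := by
      refine (Dfb.all (P := fun w : (κ ⊕ (Σ i, (P i).β)) ⊕ α → M =>
        W (w ∘ Sum.elim Sum.inr (Sum.inl ∘ Sum.inl)) →
        ∃ i, (P i).R (w ∘ Sum.elim Sum.inr fun j => Sum.inl (Sum.inr ⟨i, j⟩))) ?_).congr fun v => ?_
      · exact (hW.comp _).imp (Dfb.finEx fun i =>
          ((P i).dfb.mono (Set.empty_subset _)).comp _)
      · refine forall_congr' fun x => imp_congr ?_ (exists_congr fun i => ?_)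
        · apply iff_of_eq
          congr 1
          ext (i | i) <;> rfl
        · apply iff_of_eq
          congr 1
          ext (i | i) <;> rfl
    refine ((hg (t j)).1.iff this).1 (fun x hx => ?_) x (hx j)
    exact hP x ((hXW x).2 hx)
  have : Nonempty s := (hP a hXa).nonempty
  choose! i hi using h3
  obtain ⟨l, hl1, hl2, hl3⟩ := hasTree_of_ind hC (fun n => (hg n).2) (fun n => P (i n))
    (fun n j => Sum.inr ⟨i n, j⟩) x (Finset.univ.map ⟨fun j => (t j : ℕ),
      Fin.val_injective.comp ht⟩)
    (fun n _ => (hK (i n)).of_eqv ((hg n).1.comp fun j => Sum.inr ⟨i n, j⟩)) (fun n hn => by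
      obtain ⟨j, -, rfl⟩ := Finset.mem_map.1 hn
      exact hi _ ⟨j, rfl⟩)
  refine hr l (fun Q hQ => ?_) (by simp [hl2]) hl3
  obtain ⟨n, -, rfl⟩ := hl1 Q hQ
  exact ⟨i n, rfl⟩

end Fork

/-! ### Properties of independence -/

section Independence

variable {α β γ κ ι : Type} {A A' B B' C D D₀ D₁ E : Set M} {k : ℕ}

theorem Ind.symm [Amb L M] (hC : Small L C) (h : Ind L C A B) : Ind L C B A := by
  intro β _ P b a hb ha hR hK
  have h1 : Ind L C (Set.range a) (Set.range b) := by
    refine h.union_base.mono ?_ ?_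
    · rintro _ ⟨i, rfl⟩
      exact (ha i).symm
    · rintro _ ⟨i, rfl⟩
      exact Or.inl (hb i)
  obtain ⟨g, hg⟩ := (h1.nFork hC).exists_seq hC (Small.range b)
  obtain ⟨r, hr⟩ := exists_bound_hasTree (L := L) (Set.finite_singleton P.raw)
    (by rintro _ rfl; exact P.raw_dfb)
  obtain ⟨l, hl1, hl2, hl3⟩ := hasTree_of_ind hC
    (fun n => (hg n).2.mono subset_rfl (Set.subset_union_right.trans Set.subset_union_left))
    (fun _ => P) (fun _ => id) b (Finset.range r)
    (fun n _ => hK.of_eqv ((hg n).1.mono Set.subset_union_left)) (fun n _ => by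
      have h2 := eqv_union_range.1 (hg n).1 (fun v => P.R (v ∘ Sum.swap))
        ((P.dfb.mono (Set.empty_subset _)).comp _)
      have h3 : ∀ y : P.β → M, Sum.elim y b ∘ Sum.swap = Sum.elim b y := by
        intro y
        ext (i | i) <;> rfl
      simp only [h3] at h2
      exact h2 hR)
  refine hr l (fun Q hQ => ?_) (by simp [hl2]) hl3
  obtain ⟨n, -, rfl⟩ := hl1 Q hQ
  rfl

theorem Ind.exists_extend [Amb L M] (hC : Small L C) (hB : Small L B) (hB' : Small L B')
    [Finite α] {a : α → M} (h : Ind L C (Set.range a) B) :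
    ∃ a' : α → M, Eqv L (C ∪ B) a a' ∧ Ind L C (Set.range a') (B ∪ B') :=
  (h.nFork hC).exists_ind hC hB hB'

theorem exists_ind [Amb L M] (hC : Small L C) (hB : Small L B) [Finite α] (a : α → M) :
    ∃ a' : α → M, Eqv L C a a' ∧ Ind L C (Set.range a') B := by
  obtain ⟨a', h1, h2⟩ := (nFork_empty hC a).exists_ind hC (Small.finite Set.finite_empty) hB
  rw [Set.union_empty] at h1
  rw [Set.empty_union] at h2
  exact ⟨a', h1, h2⟩

/-- Right transitivity. -/
theorem Ind.right_trans [Amb L M] (hC : Small L C) (hB : Small L B) (h : Ind L C A B)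
    (h' : Ind L (C ∪ B) A B') : Ind L C A (B ∪ B') :=
  ((h.symm hC).left_trans (h'.symm (hC.union hB))).symm hC

/-- A finite tuple is independent from `B` over some finite subset of `B`. -/
theorem exists_finite_base [Amb L M] [Finite α] (a : α → M) (B : Set M) :
    ∃ B₀ ⊆ B, B₀.Finite ∧ Ind L B₀ (Set.range a) B := by
  by_contra! hcon
  let X := {y : Σ P : Pat L M α, P.β → M // (∀ i, y.2 i ∈ B) ∧ y.1.R (Sum.elim a y.2)}
  have key := exists_seq (fun (S : Set X) y =>
    KDiv L (⋃ z ∈ S, Set.range z.1.2) y.1.1.R y.1.1.k y.1.2) ?_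
  · obtain ⟨g, hg⟩ := key
    simp only [Set.biUnion_image] at hg
    refine no_infinite_chain (fun i => (g i).1.1) (fun i => (g i).1.2) _ (fun i => ?_) hg ?_ a
      fun i => (g i).2.2
    · exact Small.of_countable ((Set.to_countable (Set.Iio i)).biUnion fun z _ => Set.countable_range _)
    · intro i j hj l
      exact Set.mem_biUnion (Set.mem_Iio.2 hj) ⟨l, rfl⟩
  · intro S hS
    have h1 : (⋃ z ∈ S, Set.range z.1.2) ⊆ B := by
      refine Set.iUnion₂_subset fun z _ => ?_
      rintro _ ⟨i, rfl⟩
      exact z.2.1 i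
    by_contra! hcon'
    refine hcon _ h1 (hS.biUnion fun z _ => Set.finite_range _) (ind_range fun P b hb hR hK => ?_)
    exact hcon' ⟨⟨P, b⟩, fun i => (hb i).elim id fun h => h1 h, hR⟩ hK

theorem exists_finite_base' [Amb L M] [Finite α] (a : α → M) (B : Set M) {F : Set M}
    (hF : F.Finite) (hFB : F ⊆ B) :
    ∃ B₀ ⊆ B, B₀.Finite ∧ F ⊆ B₀ ∧ Ind L B₀ (Set.range a) B := by
  obtain ⟨B₀, h1, h2, h3⟩ := exists_finite_base (L := L) a B
  refine ⟨B₀ ∪ F, Set.union_subset h1 hFB, h2.union hF, Set.subset_union_right,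
    h3.base Set.subset_union_left ?_⟩
  exact (Set.union_subset h1 hFB).trans Set.subset_union_left

theorem Small.biUnion_Iio [Amb L M] {b : ℕ → Set M} (hb : ∀ n, Small L (b n)) (n : ℕ) :
    Small L (⋃ m ∈ Set.Iio n, b m) := by
  induction n with
  | zero => exact Small.finite (by simp)
  | succ n ih =>
    refine (ih.union (hb n)).mono ?_
    refine Set.iUnion₂_subset fun m hm => ?_
    rcases (Nat.lt_succ_iff.1 hm).lt_or_eq with h | rfl
    · exact (Set.subset_biUnion_of_mem (u := b) (Set.mem_Iio.2 h)).trans Set.subset_union_left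
    · exact Set.subset_union_right

/-- A finite tuple depends on only finitely many members of an independent sequence. -/
theorem no_infinite_weight [Amb L M] (hE : Small L E) [Finite α] (a : α → M) (b : ℕ → Set M)
    (hb : ∀ n, Small L (b n)) (hI : ∀ n, Ind L E (b n) (⋃ m ∈ Set.Iio n, b m))
    (ha : ∀ n, ¬ Ind L E (b n) (Set.range a)) : False := by
  have h1 : ∀ n, ∃ (P : Pat L M α) (b' : P.β → M), (∀ i, b' i ∈ b n ∪ E) ∧
      P.R (Sum.elim a b') ∧ KDiv L E P.R P.k b' := by
    intro n
    by_contra! hcon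
    exact ha n ((ind_range hcon).symm hE)
  choose P b' hb' hR hK using h1
  refine no_infinite_chain P b' (fun n => E ∪ ⋃ m ∈ Set.Iio n, b m)
    (fun n => hE.union (Small.biUnion_Iio hb n)) (fun n => ?_) ?_ a hR
  · refine (hK n).base_ext ((P n).dfb.mono (Set.empty_subset _)) (((hI n).symm hE).mono
      subset_rfl ?_)
    rintro _ ⟨i, rfl⟩
    exact hb' n i
  · intro i j hj l
    rcases hb' j l with h | h
    · exact Or.inr (Set.mem_biUnion (Set.mem_Iio.2 hj) h)
    · exact Or.inl h

theorem KDiv.conj {u v : ι → M} (h : Eqv L D u v) (i : κ → ι) (j : β → ι)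
    {R : (α ⊕ β → M) → Prop} [Finite α] [Finite β] (hR : Dfb L ∅ R) (hD : D₀ ⊆ D)
    (hK : KDiv L (D₀ ∪ Set.range (u ∘ i)) R k (u ∘ j)) :
    KDiv L (D₀ ∪ Set.range (v ∘ i)) R k (v ∘ j) := by
  intro X hX hXv r
  obtain ⟨s, hs, d, Q, hd, hQ, hXQ⟩ := hX.split
  choose f hf using hd
  obtain rfl : v ∘ i ∘ f = d := funext hf
  have h1 : ∀ w : ι → M, Sum.elim (w ∘ j) (w ∘ i ∘ f) = w ∘ Sum.elim j (i ∘ f) := by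
    intro w
    ext (l | l) <;> rfl
  have key := hK (fun y => Q (Sum.elim y (u ∘ i ∘ f))) ((hQ.mono Set.subset_union_left).inst _
    fun l => Or.inr ⟨f l, rfl⟩) (by
      rw [h1]
      refine (h.iff ((hQ.mono hD).comp _)).2 ?_
      rw [← h1, ← hXQ]
      exact hXv) r
  have hχ : Dfb L D (fun w : ι → M => ∃ B : Fin r × β → M,
      (∀ l, Q (Sum.elim (fun m => B (l, m)) (w ∘ i ∘ f))) ∧ Incons R k fun l m => B (l, m)) := by
    refine Dfb.ex (P := fun w : ι ⊕ Fin r × β → M =>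
      (∀ l, Q (Sum.elim (fun m => w (Sum.inr (l, m))) (w ∘ Sum.inl ∘ i ∘ f))) ∧
        Incons R k fun l m => w (Sum.inr (l, m))) (Dfb.and (Dfb.finAll fun l => ?_)
        ((hR.mono (Set.empty_subset _)).incons k fun l m => Sum.inr (l, m)))
    refine ((hQ.mono hD).comp (Sum.elim (fun m => Sum.inr (l, m)) (Sum.inl ∘ i ∘ f))).congr
      fun w => ?_
    apply iff_of_eq
    congr 1
    ext (m | m) <;> rfl
  obtain ⟨B, hB, hI⟩ := key
  obtain ⟨B', hB', hI'⟩ := (h.iff hχ).1 ⟨fun p => B p.1 p.2, hB, hI⟩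
  exact ⟨fun l m => B' (l, m), fun l => (hXQ _).2 (hB' l), hI'⟩

theorem Eqv.append_const {u v : ι → M} (h : Eqv L D u v) (d : κ → M) (hd : ∀ i, d i ∈ D) :
    Eqv L D (Sum.elim u d) (Sum.elim v d) := by
  intro P hP hx
  have := h (fun w => P (Sum.elim w d)) (hP.inst' d hd)
  exact this hx

/-- Independence is invariant under conjugation. -/
theorem Ind.conj {u v : ι → M} (h : Eqv L D u v) (i : κ → ι) (j : α → ι) (l : β → ι)
    (hD₀ : D₀ ⊆ D) (hD₁ : D₁ ⊆ D)
    (hI : Ind L (D₀ ∪ Set.range (u ∘ i)) (Set.range (u ∘ j)) (D₁ ∪ Set.range (u ∘ l))) :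
    Ind L (D₀ ∪ Set.range (v ∘ i)) (Set.range (v ∘ j)) (D₁ ∪ Set.range (v ∘ l)) := by
  intro γ _ P a b ha hb hR hK
  choose f hf using ha
  obtain rfl : v ∘ j ∘ f = a := funext hf
  have h1 : ∀ m, ∃ t : ι ⊕ {x // x ∈ D₀ ∪ D₁}, Sum.elim v Subtype.val t = b m ∧
      Sum.elim u Subtype.val t ∈ (D₁ ∪ Set.range (u ∘ l)) ∪ (D₀ ∪ Set.range (u ∘ i)) := by
    intro m
    rcases hb m with (h | ⟨m', h⟩) | (h | ⟨m', h⟩)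
    · exact ⟨Sum.inr ⟨b m, Or.inr h⟩, rfl, Or.inl (Or.inl h)⟩
    · exact ⟨Sum.inl (l m'), h, Or.inl (Or.inr ⟨m', rfl⟩)⟩
    · exact ⟨Sum.inr ⟨b m, Or.inl h⟩, rfl, Or.inr (Or.inl h)⟩
    · exact ⟨Sum.inl (i m'), h, Or.inr (Or.inr ⟨m', rfl⟩)⟩
  choose t ht1 ht2 using h1
  obtain ⟨q, hqv, hqu⟩ : ∃ q : P.β → ι ⊕ {m : P.β // (t m).isRight},
      (∀ m, Sum.elim v (fun m => Sum.elim v Subtype.val (t m.1)) (q m) = b m) ∧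
      (∀ m, Sum.elim u (fun m => Sum.elim v Subtype.val (t m.1)) (q m) ∈
        (D₁ ∪ Set.range (u ∘ l)) ∪ (D₀ ∪ Set.range (u ∘ i))) := by
    have : ∀ m, ∃ q : ι ⊕ {m : P.β // (t m).isRight},
        Sum.elim v (fun m => Sum.elim v Subtype.val (t m.1)) q = b m ∧
        Sum.elim u (fun m => Sum.elim v Subtype.val (t m.1)) q ∈
        (D₁ ∪ Set.range (u ∘ l)) ∪ (D₀ ∪ Set.range (u ∘ i)) := by
      intro m
      have h1 := ht1 m
      have h2 := ht2 m
      rcases h : t m with x | x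
      · rw [h] at h1 h2
        exact ⟨Sum.inl x, h1, h2⟩
      · refine ⟨Sum.inr ⟨m, by simp [h]⟩, ht1 m, ?_⟩
        rw [h] at h2
        simpa [h] using h2
    choose q hq using this
    exact ⟨q, fun m => (hq m).1, fun m => (hq m).2⟩
  have hE := h.append_const (fun m : {m : P.β // (t m).isRight} => Sum.elim v Subtype.val (t m.1))
    (by
      rintro ⟨m, hm⟩
      obtain ⟨x, hx⟩ := Sum.isRight_iff.1 hm
      rw [hx]
      exact x.2.elim (fun h => hD₀ h) fun h => hD₁ h)
  have hbq : Sum.elim v (fun m : {m : P.β // (t m).isRight} => Sum.elim v Subtype.val (t m.1)) ∘ q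
    = b := funext hqv
  refine hI γ P (u ∘ j ∘ f) (Sum.elim u (fun m : {m : P.β // (t m).isRight} =>
    Sum.elim v Subtype.val (t m.1)) ∘ q)
    (fun x => ⟨f x, rfl⟩) hqu ?_ ?_
  · have := (hE.iff ((P.dfb.mono (Set.empty_subset D)).comp (Sum.elim (Sum.inl ∘ j ∘ f) q))).2
    have h2 : ∀ w : ι ⊕ {m : P.β // (t m).isRight} → M, w ∘ Sum.elim (Sum.inl ∘ j ∘ f) q =
        Sum.elim (w ∘ Sum.inl ∘ j ∘ f) (w ∘ q) := by
      intro w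
      ext (m | m) <;> rfl
    simp only [h2, hbq] at this
    exact this hR
  · exact KDiv.conj (i := Sum.inl ∘ i) hE.symm q P.dfb hD₀ (by rw [hbq]; exact hK)

end Independence

/-! ### Comparison with forking through indiscernible sequences -/

section Averages

variable {β : Type} {C D : Set M}

/-- Iterated average of a predicate on tuples of natural numbers. -/
def IterAvg (U : Filter ℕ) : (k : ℕ) → ((Fin k → ℕ) → Prop) → Prop
  | 0, Q => Q Fin.elim0
  | k + 1, Q => ∀ᶠ n in U, IterAvg U k fun s => Q (Fin.snoc s n)

theorem IterAvg.exists_injective {k : ℕ} {Q : (Fin k → ℕ) → Prop}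
    (h : IterAvg (Filter.hyperfilter ℕ) k Q) (F : Set ℕ) (hF : F.Finite) :
    ∃ s : Fin k → ℕ, Function.Injective s ∧ (∀ i, s i ∉ F) ∧ Q s := by
  induction k generalizing F with
  | zero => exact ⟨Fin.elim0, fun i => i.elim0, fun i => i.elim0, h⟩
  | succ k ih =>
    have h1 : ∀ᶠ n in (Filter.hyperfilter ℕ : Filter ℕ), n ∉ F :=
      hF.compl_mem_hyperfilter
    obtain ⟨n, hn, hnF⟩ := (Filter.Eventually.and h h1).exists
    obtain ⟨s, hs, hsF, hQ⟩ := ih hn (insert n F) (hF.insert n)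
    refine ⟨Fin.snoc s n, ?_, ?_, hQ⟩
    · rw [Fin.snoc_injective_iff]
      refine ⟨hs, ?_⟩
      rintro ⟨i, hi⟩
      exact hsF i (hi ▸ Set.mem_insert _ _)
    · intro i
      refine Fin.lastCases ?_ (fun i => ?_) i
      · simpa using hnF
      · simpa using fun h => hsF i (Set.mem_insert_of_mem _ h)

theorem exists_average [Amb L M] (hD : Small L D) [Countable β] (U : Ultrafilter ℕ)
    (e : ℕ → β → M) : ∃ y : β → M, ∀ X, Dfb L D X → (X y ↔ ∀ᶠ n in U, X (e n)) := by
  have key := hD.realize {X : (β → M) → Prop | Dfb L D X ∧ ∀ᶠ n in U, X (e n)}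
    (fun X hX => hX.1) (exists_of_directed ⟨fun _ => True, Dfb.const _, by simp⟩
      (fun X hX Y hY => ⟨_, ⟨hX.1.and hY.1, hX.2.and hY.2⟩, fun v hv => hv⟩)
      fun X hX => hX.2.exists.imp' e fun n hn => hn)
  obtain ⟨y, hy⟩ := key
  refine ⟨y, fun X hX => ⟨fun h => ?_, fun h => hy X ⟨hX, h⟩⟩⟩
  by_contra hcon
  exact hy _ ⟨hX.not, Ultrafilter.eventually_not.2 hcon⟩ h

theorem iterAvg_iff {U : Ultrafilter ℕ} {e g : ℕ → β → M}
    (hg : ∀ n X, Dfb L (D ∪ ⋃ m ∈ Set.Iio n, Set.range (g m)) X →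
      (X (g n) ↔ ∀ᶠ n in U, X (e n))) (he : ∀ n j, e n j ∈ D) [Finite β] (k : ℕ)
    {Q : (Fin k × β → M) → Prop} (hQ : Dfb L D Q) (i : Fin k → ℕ) (hi : StrictMono i) :
    (Q fun p => g (i p.1) p.2) ↔ IterAvg U k fun s => Q fun p => e (s p.1) p.2 := by
  induction k with
  | zero =>
    refine iff_of_eq ?_
    show _ = Q _
    congr 1
    ext ⟨p, -⟩
    exact p.elim0
  | succ k ih =>
    let c : Fin (k + 1) × β → (Fin k × β) ⊕ β := fun p =>
      Fin.lastCases (motive := fun _ => (Fin k × β) ⊕ β) (Sum.inr p.2)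
        (fun j => Sum.inl (j, p.2)) p.1
    have hc : ∀ (x : Fin k → ℕ) (y : ℕ) (f : ℕ → β → M) (w : β → M), w = f y →
        Sum.elim (fun p : Fin k × β => f (x p.1) p.2) w ∘ c = fun p => f (Fin.snoc (α := fun _ => ℕ) x y p.1) p.2 := by
      rintro x y f w rfl
      ext ⟨p, q⟩
      refine Fin.lastCases ?_ (fun p => ?_) p <;> simp [c]
    have h1 : (fun p : Fin (k + 1) × β => g (i p.1) p.2) =
        Sum.elim (fun p : Fin k × β => g (i p.1.castSucc) p.2) (g (i (Fin.last k))) ∘ c := by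
      rw [hc (fun j => i j.castSucc) (i (Fin.last k)) g _ rfl]
      ext ⟨p, q⟩
      refine Fin.lastCases ?_ (fun p => ?_) p <;> simp
    rw [h1]
    have h2 : Dfb L (D ∪ ⋃ m ∈ Set.Iio (i (Fin.last k)), Set.range (g m)) (fun w : β → M =>
        Q (Sum.elim (fun p : Fin k × β => g (i p.1.castSucc) p.2) w ∘ c)) := by
      have h3 := ((hQ.mono (Set.subset_union_left (t := ⋃ m ∈ Set.Iio (i (Fin.last k)),
        Set.range (g m)))).comp (Sum.swap ∘ c)).inst
        (fun p : Fin k × β => g (i p.1.castSucc) p.2) (fun p => Or.inr (Set.mem_biUnion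
          (Set.mem_Iio.2 (hi (Fin.castSucc_lt_last p.1))) ⟨p.2, rfl⟩))
      refine h3.congr fun v => ?_
      apply iff_of_eq
      congr 1
      ext p
      simp only [Function.comp_apply]
      cases c p <;> rfl
    rw [hg _ _ h2]
    refine Filter.eventually_congr (Filter.Eventually.of_forall fun n => ?_)
    have h4 : Dfb L D (fun w : Fin k × β → M => Q (Sum.elim w (e n) ∘ c)) :=
      (hQ.comp c).inst _ (he n)
    rw [ih h4 (fun j => i j.castSucc) (hi.comp (Fin.strictMono_castSucc))]
    refine iff_of_eq ?_
    congr 1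
    ext s
    rw [hc s n e _ rfl]

end Averages

section Links

variable {C D B : Set M}

theorem Divides.kDiv {n m : ℕ} {φ : L.Formula (Fin n ⊕ Fin m)} {b : Fin m → M}
    (h : Divides (L := L) C φ b) : ∃ k, KDiv L C (fun v => φ.Realize v) k b := by
  obtain ⟨f, rfl, hf, k, -, hk⟩ := h
  refine ⟨k, fun X hX hXb r => ⟨fun i => f i, fun i => ?_, fun s hs => ?_⟩⟩
  · have h1 := sameTypeOver_iff.1 (hf 1 (fun _ => 0) (fun _ => i) (Subsingleton.strictMono _)
      (Subsingleton.strictMono _))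
    exact (h1.comp fun j => (0, j)) X hX hXb
  · rintro ⟨a, ha⟩
    have hcard : (Finset.univ.map ⟨fun j => (s j : ℕ), Fin.val_injective.comp hs⟩).card = k := by
      simp
    refine hk _ (Finset.orderEmbOfFin _ hcard).strictMono ⟨a, fun j => ?_⟩
    obtain ⟨j', -, hj'⟩ := Finset.mem_map.1 (Finset.orderEmbOfFin_mem _ hcard j)
    rw [← hj']
    exact ha j'

theorem KDiv.divides [Amb L M] (hC : Small L C) {n m k : ℕ} {φ : L.Formula (Fin n ⊕ Fin m)}
    {b : Fin m → M} (h : KDiv L C (fun v => φ.Realize v) k b) : Divides (L := L) C φ b := by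
  have : Nonempty M := Amb.nonempty L
  have hφ : Dfb L (∅ : Set M) (fun v => φ.Realize v) := Dfb.atom φ
  have hφC : Dfb L C (fun v => φ.Realize v) := Dfb.atom φ
  obtain ⟨e, he, hI⟩ := h.exists_seq hC hφC
  let E : Set M := C ∪ Set.range fun p : ℕ × Fin m => e p.1 p.2
  obtain ⟨g, hg⟩ := Benign.exists_seq (fun (S : Set (Fin m → M)) y =>
    ∀ X, Dfb L (E ∪ ⋃ z ∈ S, Set.range z) X →
      (X y ↔ ∀ᶠ n in (Filter.hyperfilter ℕ : Filter ℕ), X (e n))) fun S hS =>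
    exists_average ((hC.union (Small.range _)).union (small_biUnion hS)) _ e
  simp only [Set.biUnion_image] at hg
  have key := fun (k : ℕ) (Q : (Fin k × Fin m → M) → Prop) (hQ : Dfb L C Q) (i : Fin k → ℕ)
    (hi : StrictMono i) => iterAvg_iff (D := E) hg (fun n j => Or.inr ⟨(n, j), rfl⟩) k
      (hQ.mono Set.subset_union_left) i hi
  have hg0 : Eqv L C (g 0) b := by
    intro X hX hXg
    obtain ⟨n, hn⟩ := ((hg 0 X (hX.mono (Set.subset_union_left.trans
      Set.subset_union_left))).1 hXg).exists
    exact ((he n).iff hX).2 hn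
  obtain ⟨f, hf⟩ := hg0.extend hC fun p : ℕ × Fin m => g p.1 p.2
  have hf' : Eqv L C (fun p : ℕ × Fin m => g p.1 p.2) f := by
    simpa only [Sum.elim_comp_inr] using hf.comp Sum.inr
  refine ⟨fun i j => f (i, j), ?_, ?_, k, ?_, ?_⟩
  · ext j
    have := hf (fun v => v (Sum.inl j) = v (Sum.inr (0, j))) (Dfb.eq _ _) rfl
    exact this.symm
  · intro l i j hi hj
    rw [sameTypeOver_iff]
    have h1 : Eqv L C (fun s : Fin l × Fin m => g (i s.1) s.2) fun s => g (j s.1) s.2 :=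
      fun Q hQ h => (key l Q hQ j hj).2 ((key l Q hQ i hi).1 h)
    exact ((hf'.comp fun s : Fin l × Fin m => (i s.1, s.2)).symm.trans h1).trans
      (hf'.comp fun s : Fin l × Fin m => (j s.1, s.2))
  · rcases Nat.eq_zero_or_pos k with rfl | hk
    · exact absurd ⟨fun _ => Classical.arbitrary M, fun j => j.elim0⟩
        (hI Fin.elim0 fun i => i.elim0)
    · exact hk
  · rintro i hi hcon
    have h1 : Dfb L C (fun w : Fin k × Fin m → M => ∃ a : Fin n → M, ∀ j,
        φ.Realize (Sum.elim a fun l => w (j, l))) :=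
      (hφC.not_exists_forall fun j l => (j, l)).not.congr fun v => not_not.symm
    have h2 := ((hf'.comp fun s : Fin k × Fin m => (i s.1, s.2)).iff h1).2 hcon
    obtain ⟨s, hs, -, hx⟩ := ((key k _ h1 i hi).1 h2).exists_injective ∅ Set.finite_empty
    exact hI s hs hx

theorem TupForksOver.not_ind [Amb L M] (hC : Small L C) (hB : Small L B) {n : ℕ} {a : Fin n → M}
    (h : TupForksOver (L := L) a B C) : ¬ Ind L C (Set.range a) B := by
  intro hI
  obtain ⟨r, ms, φ, b, hD, h⟩ := h
  obtain ⟨a', h1, h2⟩ := hI.exists_extend hC hB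
    (B' := ⋃ i, Set.range (b i)) (Small.of_countable (Set.countable_iUnion fun i =>
      Set.countable_range _))
  obtain ⟨i, hi⟩ := h a' (sameTypeOver_iff.2 (h1.mono Set.subset_union_right))
  obtain ⟨k, hk⟩ := (hD i).kDiv
  exact h2 (Fin n) ⟨Fin (ms i), inferInstance, fun v => (φ i).Realize v, Dfb.atom _, k⟩ a' (b i)
    (fun j => ⟨j, rfl⟩) (fun j => Or.inl (Or.inr (Set.mem_iUnion.2 ⟨i, j, rfl⟩))) hi hk

theorem tupForksOver_of_not_ind [Amb L M] (hC : Small L C) {n : ℕ} {a : Fin n → M}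
    (hB : B ⊆ D) (hCD : C ⊆ D) (h : ¬ Ind L C (Set.range a) B) : TupForksOver (L := L) a D C := by
  have h1 : ∃ (P : Pat L M (Fin n)) (b : P.β → M), (∀ i, b i ∈ B ∪ C) ∧ P.R (Sum.elim a b) ∧
      KDiv L C P.R P.k b := by
    by_contra! hcon
    exact h (ind_range hcon)
  obtain ⟨P, b, hb, hR, hK⟩ := h1
  obtain ⟨φ, hφ⟩ := P.dfb.exists_formula_empty
  obtain ⟨m, ⟨t⟩⟩ := Finite.exists_equiv_fin P.β
  have hbt : (b ∘ t.symm) ∘ t = b := by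
    ext
    simp
  have h2 : ∀ (x : Fin n → M) (y : Fin m → M), (φ.relabel (Sum.map id t)).Realize (Sum.elim x y) ↔
      P.R (Sum.elim x (y ∘ t)) := by
    intro x y
    rw [hφ, Formula.realize_relabel, Sum.elim_comp_map, Function.comp_id]
  refine ⟨1, fun _ => m, fun _ => φ.relabel (Sum.map id t), fun _ => b ∘ t.symm,
    fun _ => KDiv.divides (k := P.k) hC ?_, fun a' ha' => ⟨0, ?_⟩⟩
  · intro X hX hXb r
    obtain ⟨F, hF, hI⟩ := hK (fun y => X (y ∘ t.symm)) (hX.comp _) hXb r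
    refine ⟨fun i => F i ∘ t.symm, hF, fun s hs ⟨x, hx⟩ => hI s hs ⟨x, fun j => ?_⟩⟩
    have := (h2 _ _).1 (hx j)
    have h3 : (F (s j) ∘ t.symm) ∘ t = F (s j) := by
      ext
      simp
    rwa [h3] at this
  · rw [h2, hbt]
    refine (sameTypeOver_iff.1 ha') (fun v => P.R (Sum.elim v b))
      ((P.dfb.mono (Set.empty_subset _)).inst _ fun i => ?_) hR
    exact (hb i).elim (fun h => hB h) fun h => hCD h

theorem tupForksOver_iff [Amb L M] (hB : Small L B) (hCB : C ⊆ B) {n : ℕ} {a : Fin n → M} :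
    TupForksOver (L := L) a B C ↔ ¬ Ind L C (Set.range a) B :=
  ⟨TupForksOver.not_ind (hB.mono hCB) hB, tupForksOver_of_not_ind (hB.mono hCB) subset_rfl hCB⟩

theorem not_tupForksOver_iff [Amb L M] (hB : Small L B) (hCB : C ⊆ B) {n : ℕ} {a : Fin n → M} :
    ¬ TupForksOver (L := L) a B C ↔ Ind L C (Set.range a) B := by
  rw [tupForksOver_iff hB hCB, not_not]

theorem tupIndepOver_iff [Amb L M] (hC : Small L C) (hB : Small L B) {n : ℕ} {a : Fin n → M} :
    TupIndepOver (L := L) a B C ↔ Ind L C (Set.range a) B := by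
  rw [TupIndepOver, not_tupForksOver_iff (hB.union hC) Set.subset_union_right]
  refine ⟨fun h => h.mono subset_rfl ?_, fun h => h.mono subset_rfl subset_rfl⟩
  exact Set.subset_union_left.trans Set.subset_union_left

end Links

/-! ### Regular types -/

section Calculus

variable {α β γ κ ι : Type} {A A' B B' C D E F Z : Set M}

theorem Small.empty [Amb L M] : Small L (∅ : Set M) :=
  Small.finite Set.finite_empty

theorem biUnion_Iio_succ {X : Type*} (s : ℕ → Set X) (n : ℕ) :
    ⋃ m ∈ Set.Iio (n + 1), s m = (⋃ m ∈ Set.Iio n, s m) ∪ s n :=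
  Set.biUnion_lt_succ s n

theorem Ind.up (h : Ind L C A B) (hCD : C ⊆ D) (hD : D ⊆ B) (hB : B' ⊆ B) : Ind L D A B' :=
  (h.base hCD (hD.trans Set.subset_union_left)).mono subset_rfl
    (hB.trans Set.subset_union_left)

theorem Ind.down (h : Ind L C A B) (hB : B' ⊆ B) : Ind L C A B' :=
  h.mono subset_rfl (hB.trans Set.subset_union_left)

theorem Ind.sub (h : Ind L C A B) (hA : A' ⊆ A) : Ind L C A' B :=
  h.mono hA Set.subset_union_left

theorem Ind.trans [Amb L M] (hD : Small L D) (hCD : C ⊆ D) (h : Ind L C A D)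
    (h' : Ind L D A B) : Ind L C A (D ∪ B) := by
  refine h.right_trans (hD.mono hCD) hD ?_
  rwa [Set.union_eq_self_of_subset_left hCD]

theorem ind_self (hBC : B ⊆ C) [Amb L M] (hC : Small L C) : Ind L C A B :=
  (Ind.base_left (L := L) (C := C) (B := A)).symm hC |>.down hBC

theorem Ind.conj_left {a a' : α → M} (h : Eqv L D a a') (hZ : Z ⊆ D) (hB : B ⊆ D)
    (hI : Ind L Z (Set.range a) B) : Ind L Z (Set.range a') B := by
  have := Ind.conj (κ := Empty) (β := Empty) h Empty.elim id Empty.elim hZ hB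
    (by simpa [Set.range_eq_empty] using hI)
  simpa [Set.range_eq_empty] using this

theorem Ind.conj_pair {a a' : α → M} {b b' : β → M}
    (h : Eqv L D (Sum.elim a b) (Sum.elim a' b')) (hZ : Z ⊆ D)
    (hI : Ind L Z (Set.range a) (Set.range b)) : Ind L Z (Set.range a') (Set.range b') := by
  have := Ind.conj (κ := Empty) h Empty.elim Sum.inl Sum.inr hZ (Set.empty_subset _)
    (by simpa [Set.range_eq_empty] using hI)
  simpa [Set.range_eq_empty] using this

theorem Ind.conj_base {u v : ι → M} (h : Eqv L D u v) (i : κ → ι) (j : α → ι) (l : β → ι)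
    (hI : Ind L (Set.range (u ∘ i)) (Set.range (u ∘ j)) (Set.range (u ∘ l))) :
    Ind L (Set.range (v ∘ i)) (Set.range (v ∘ j)) (Set.range (v ∘ l)) := by
  have := Ind.conj h i j l (Set.empty_subset _) (Set.empty_subset _)
    (by simpa using hI)
  simpa using this

theorem ind_of_step [Amb L M] (hE : Small L E) {X : Type*} {t : α → M} (S : Set X)
    (r : X → Set M) (hr : ∀ x ∈ S, Small L (r x))
    (h : ∀ D, Small L D → E ⊆ D → Ind L E (Set.range t) D → ∀ x ∈ S, Ind L D (Set.range t) (r x)) :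
    Ind L E (Set.range t) (⋃ x ∈ S, r x) := by
  have key : ∀ T : Set X, T.Finite → T ⊆ S → Small L (⋃ x ∈ T, r x) ∧
      Ind L E (Set.range t) (⋃ x ∈ T, r x) := by
    intro T hT
    induction T, hT using Set.Finite.induction_on with
    | empty =>
      intro _
      simp only [Set.mem_empty_iff_false, Set.iUnion_of_empty, Set.iUnion_empty]
      exact ⟨Small.empty, ind_self (Set.empty_subset _) hE⟩
    | @insert x T _ _ ih =>
      intro hTS
      obtain ⟨h1, h2⟩ := ih ((Set.subset_insert _ _).trans hTS)
      have hx : x ∈ S := hTS (Set.mem_insert _ _)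
      rw [Set.biUnion_insert]
      refine ⟨(hr x hx).union h1, ?_⟩
      rw [Set.union_comm]
      have h3 : Ind L E (Set.range t) (E ∪ ⋃ x ∈ T, r x) := h2.mono subset_rfl (by
        rw [Set.union_comm])
      refine (Ind.trans (hE.union h1) Set.subset_union_left h3
        (h _ (hE.union h1) Set.subset_union_left h3 x hx)).down ?_
      exact Set.union_subset_union_left _ Set.subset_union_right
  intro β _ P a b ha hb
  have := P.fin
  have hb' : ∀ i, ∃ T : Set X, T.Finite ∧ T ⊆ S ∧ b i ∈ (⋃ x ∈ T, r x) ∪ E := by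
    intro i
    rcases hb i with h | h
    · obtain ⟨x, hx, hi⟩ := Set.mem_iUnion₂.1 h
      exact ⟨{x}, Set.finite_singleton _, by simpa using hx, Or.inl (by simpa using hi)⟩
    · exact ⟨∅, Set.finite_empty, Set.empty_subset _, Or.inr h⟩
  choose T hTf hTS hT using hb'
  refine (key (⋃ i, T i) (Set.finite_iUnion hTf) (Set.iUnion_subset hTS)).2 β P a b ha fun i => ?_
  exact (hT i).imp (fun h => Set.biUnion_subset_biUnion_left (Set.subset_iUnion T i) h) id

theorem exists_finite_not_ind [Amb L M] [Finite α] [Finite β] {a : α → M} {b : β → M}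
    (hE : Small L E) (h : ¬ Ind L E (Set.range a) (Set.range b)) (hF : F.Finite) (hFE : F ⊆ E) :
    ∃ E₀ ⊆ E, E₀.Finite ∧ F ⊆ E₀ ∧ Ind L E₀ (Set.range (Sum.elim a b)) E ∧
      ¬ Ind L E₀ (Set.range a) (Set.range b) := by
  obtain ⟨E₀, h1, h2, h3, h4⟩ := exists_finite_base' (L := L) (Sum.elim a b) E hF hFE
  refine ⟨E₀, h1, h2, h3, h4, fun h5 => h ?_⟩
  have hs : Small L E₀ := hE.mono h1
  rw [Set.Sum.elim_range] at h4
  have h6 : Ind L (E₀ ∪ Set.range b) (Set.range a) E := by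
    have h7 := (h4.symm hs).base (D := E₀ ∪ Set.range b) Set.subset_union_left
      (Set.union_subset Set.subset_union_right
        (Set.subset_union_right.trans Set.subset_union_left))
    exact (h7.symm (hs.union (Small.range _))).sub Set.subset_union_left
  have h8 := h5.right_trans hs (Small.range _) h6
  exact h8.up h1 Set.subset_union_right Set.subset_union_left

end Calculus

section Regular

variable {α β γ κ ι : Type} {A A' B B' C D E F Z Z' : Set M}

/-- `a` realizes the nonforking extension of `tp(u / Z)` to `E`. -/
def NF (L : FirstOrder.Language.{u, u}) {M : Type u} [L.Structure M] (Z : Set M) {α : Type}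
    (u : α → M) (E : Set M) (a : α → M) : Prop :=
  Eqv L Z u a ∧ Ind L Z (Set.range a) E

/-- Over small sets, nonforking realizations of `tp(u / Z)` are independent from forking
realizations. -/
def Reg (L : FirstOrder.Language.{u, u}) {M : Type u} [L.Structure M] [Amb L M] (Z : Set M)
    {α : Type} (u : α → M) : Prop :=
  ∀ E, Small L E → Z ⊆ E → ∀ a b, NF L Z u E a → Eqv L Z u b → ¬ Ind L Z (Set.range b) E →
    Ind L E (Set.range a) (Set.range b)

/-- Over small sets, `tp(u / Z)` has a unique nonforking extension. -/
def Stat (L : FirstOrder.Language.{u, u}) {M : Type u} [L.Structure M] [Amb L M] (Z : Set M)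
    {α : Type} (u : α → M) : Prop :=
  ∀ E, Small L E → Z ⊆ E → ∀ a b, NF L Z u E a → NF L Z u E b → Eqv L E a b

theorem NF.enlarge [Amb L M] {u a a' : α → M} (hE : Small L E) (hZE : Z ⊆ E)
    (h : NF L Z u E a) (ha : Eqv L E a a') (hI : Ind L E (Set.range a') D) :
    NF L Z u (E ∪ D) a' :=
  ⟨h.1.trans (ha.mono hZE), Ind.trans hE hZE (h.2.conj_left ha hZE subset_rfl) hI⟩

theorem NF.extend [Amb L M] {u a : α → M} (hE : Small L E) (hZE : Z ⊆ E)
    (h : NF L Z u E a) (hI : Ind L E (Set.range a) D) : NF L Z u D a :=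
  ⟨h.1, (h.enlarge hE hZE (Eqv.refl a) hI).2.down (by simp)⟩

theorem NF.restrict {u a : α → M} (h : NF L Z u E a) (hDE : D ⊆ E) : NF L Z u D a :=
  ⟨h.1, h.2.down hDE⟩

theorem Reg.ind_or [Amb L M] [Finite α] [Finite β] [Finite γ] {u a : α → M} {b : β → M}
    {c : γ → M} (hR : Reg L Z u) (hE : Small L E) (hZE : Z ⊆ E) (ha : NF L Z u E a)
    (h : Ind L E (Set.range b) (Set.range c)) :
    Ind L E (Set.range a) (Set.range b) ∨ Ind L E (Set.range a) (Set.range c) := by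
  by_contra! hcon
  obtain ⟨h1, h2⟩ := hcon
  have hEb : Small L (E ∪ Set.range b) := hE.union (Small.range b)
  obtain ⟨g, hg⟩ := (nFork_empty hEb (Sum.elim a c)).exists_seq hEb Small.empty
  simp only [Set.union_empty, Set.empty_union] at hg
  let a' : ℕ → α → M := fun n => g n ∘ Sum.inl
  let c' : ℕ → γ → M := fun n => g n ∘ Sum.inr
  have ha' : ∀ n, Eqv L (E ∪ Set.range b) a (a' n) := fun n => (hg n).1.comp Sum.inl
  have hc' : ∀ n, Eqv L (E ∪ Set.range b) c (c' n) := fun n => (hg n).1.comp Sum.inr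
  have hag : ∀ n, Set.range (a' n) ⊆ Set.range (g n) := fun n => Set.range_comp_subset_range _ _
  have hcg : ∀ n, Set.range (c' n) ⊆ Set.range (g n) := fun n => Set.range_comp_subset_range _ _
  have hsP : ∀ n, Small L (⋃ m ∈ Set.Iio n, Set.range (c' m)) :=
    fun n => Small.biUnion_Iio (fun m => Small.range _) n
  have hPg : ∀ n, (⋃ m ∈ Set.Iio n, Set.range (c' m)) ⊆ ⋃ m ∈ Set.Iio n, Set.range (g m) :=
    fun n => Set.iUnion₂_mono fun m _ => hcg m
  have hP : ∀ n, Ind L E (⋃ m ∈ Set.Iio n, Set.range (c' m)) (Set.range b) := by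
    intro n
    induction n with
    | zero => simpa using (ind_self (L := L) (A := Set.range b) (Set.empty_subset E) hE).symm hE
    | succ n ih =>
      rw [biUnion_Iio_succ]
      refine ih.left_trans ?_
      have h3 : Ind L E (Set.range (c' n)) (Set.range b) :=
        (h.symm hE).conj_left (hc' n) Set.subset_union_left Set.subset_union_right
      have h4 := h3.right_trans hE (Small.range b) (((hg n).2.sub (hcg n)).down (hPg n))
      exact (h4.base Set.subset_union_left (Set.union_subset Set.subset_union_right
        (Set.subset_union_right.trans Set.subset_union_left))).mono subset_rfl
        (Set.subset_union_left.trans Set.subset_union_left)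
  refine no_infinite_weight hE b (fun n => Set.range (a' n)) (fun n => Small.range _)
    (fun n => ?_) fun n hI => h1 (hI.conj_left (ha' n).symm Set.subset_union_left
      Set.subset_union_right)
  have hPn := hP n
  generalize hPdef : (⋃ m ∈ Set.Iio n, Set.range (c' m)) = P at hPn
  have hPs : Small L P := hPdef ▸ hsP n
  have h5 : Ind L E (Set.range (a' n)) P := by
    have h6 : Ind L (E ∪ Set.range b) P (Set.range (a' n)) :=
      (((hg n).2.sub (hag n)).down (hPdef ▸ hPg n)).symm hEb
    exact ((hPn.right_trans hE (Small.range b) h6).down Set.subset_union_right).symm hE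
  have hnf : ∀ m, NF L Z u E (a' m) := fun m =>
    ⟨ha.1.trans ((ha' m).mono (hZE.trans Set.subset_union_left)),
      ha.2.conj_left (ha' m) (hZE.trans Set.subset_union_left) Set.subset_union_left⟩
  have hEP : Small L (E ∪ P) := hE.union hPs
  have hnf' : NF L Z u (E ∪ P) (a' n) := (hnf n).enlarge hE hZE (Eqv.refl _) h5
  have h7 : Ind L (E ∪ P) (Set.range (a' n)) (⋃ m ∈ Set.Iio n, Set.range (a' m)) := by
    refine ind_of_step hEP _ _ (fun m _ => Small.range _) fun D hD hED hI m hm => ?_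
    have hZP : Z ⊆ E ∪ P := hZE.trans Set.subset_union_left
    refine hR D hD (hZP.trans hED) _ _ (hnf'.extend hEP hZP hI) (hnf m).1 fun hcon => h2 ?_
    have h8 : Ind L E (Set.range (a' m)) (Set.range (c' m)) := by
      refine hcon.up hZE (Set.subset_union_left.trans hED) (subset_trans ?_ hED)
      rw [← hPdef]
      exact (Set.subset_biUnion_of_mem (u := fun m => Set.range (c' m)) hm).trans
        Set.subset_union_right
    refine Ind.conj_pair (D := E) ?_ subset_rfl h8
    have h9 := ((hg m).1.mono (Set.subset_union_left (s := E) (t := Set.range b))).symm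
    rwa [← Sum.elim_comp_inl_inr (g m)] at h9
  have h10 : Ind L E (Set.range (a' n)) (E ∪ P) := h5.mono subset_rfl (by rw [Set.union_comm])
  exact (Ind.trans hEP Set.subset_union_left h10 h7).down Set.subset_union_right

/-- Nonorthogonality of `tp(u / Z)` and `tp(u' / Z')`, witnessed over `D`. -/
def NOAt (L : FirstOrder.Language.{u, u}) {M : Type u} [L.Structure M] (D Z : Set M)
    {α β : Type} (u : α → M) (Z' : Set M) (u' : β → M) : Prop :=
  ∃ v v', NF L Z u D v ∧ NF L Z' u' D v' ∧ ¬ Ind L D (Set.range v) (Set.range v')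

/-- Nonorthogonality of `tp(u / Z)` and `tp(u' / Z')`, witnessed over a small set. -/
def NO (L : FirstOrder.Language.{u, u}) {M : Type u} [L.Structure M] [Amb L M] (Z : Set M)
    {α β : Type} (u : α → M) (Z' : Set M) (u' : β → M) : Prop :=
  ∃ D, Small L D ∧ Z ⊆ D ∧ Z' ⊆ D ∧ NOAt L D Z u Z' u'

theorem exists_ind_pair [Amb L M] [Finite α] [Finite β] (hD : Small L D) (hE : Small L E)
    (v : α → M) (v' : β → M) : ∃ w w', Eqv L D (Sum.elim v v') (Sum.elim w w') ∧
      Ind L D (Set.range (Sum.elim w w')) E := by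
  obtain ⟨w, h1, h2⟩ := exists_ind hD hE (Sum.elim v v')
  refine ⟨w ∘ Sum.inl, w ∘ Sum.inr, ?_, ?_⟩ <;> rwa [Sum.elim_comp_inl_inr]

theorem not_ind_enlarge [Amb L M] {v : α → M} {v' : β → M} (hE : Small L E)
    (hDE : D ⊆ E) (h : ¬ Ind L D (Set.range v) (Set.range v'))
    (hI : Ind L D (Set.range (Sum.elim v v')) E) : ¬ Ind L E (Set.range v) (Set.range v') := by
  intro h'
  rw [Set.Sum.elim_range] at hI
  exact h ((Ind.trans hE hDE (hI.sub Set.subset_union_left) h').down Set.subset_union_right)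

theorem NOAt.enlarge [Amb L M] [Finite α] [Finite β] {u : α → M} {u' : β → M}
    (h : NOAt L D Z u Z' u') (hD : Small L D) (hZ : Z ⊆ D) (hZ' : Z' ⊆ D) (hE : Small L E)
    (hDE : D ⊆ E) : NOAt L E Z u Z' u' := by
  obtain ⟨v, v', h1, h2, h3⟩ := h
  obtain ⟨w, w', h4, h5⟩ := exists_ind_pair hD hE v v'
  have h6 := h5
  rw [Set.Sum.elim_range] at h6
  have e1 : Eqv L D v w := by simpa only [Sum.elim_comp_inl] using h4.comp Sum.inl
  have e2 : Eqv L D v' w' := by simpa only [Sum.elim_comp_inr] using h4.comp Sum.inr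
  refine ⟨w, w', (h1.enlarge hD hZ e1 (h6.sub Set.subset_union_left)).restrict
    Set.subset_union_right, (h2.enlarge hD hZ' e2 (h6.sub Set.subset_union_right)).restrict
    Set.subset_union_right, ?_⟩
  exact not_ind_enlarge hE hDE
    (fun h => h3 (h.conj_pair h4.symm subset_rfl)) h5

theorem NOAt.symm [Amb L M] {u : α → M} {u' : β → M} (hD : Small L D)
    (h : NOAt L D Z u Z' u') : NOAt L D Z' u' Z u := by
  obtain ⟨v, v', h1, h2, h3⟩ := h
  exact ⟨v', v, h2, h1, fun h => h3 (h.symm hD)⟩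

theorem NO.symm [Amb L M] {u : α → M} {u' : β → M} (h : NO L Z u Z' u') : NO L Z' u' Z u := by
  obtain ⟨D, h1, h2, h3, h4⟩ := h
  exact ⟨D, h1, h3, h2, h4.symm h1⟩

theorem NO.at [Amb L M] [Finite α] [Finite β] {u : α → M} {u' : β → M} (h : NO L Z u Z' u')
    (hE : Small L E) : ∃ D, Small L D ∧ E ⊆ D ∧ Z ⊆ D ∧ Z' ⊆ D ∧ NOAt L D Z u Z' u' := by
  obtain ⟨D, h1, h2, h3, h4⟩ := h
  exact ⟨D ∪ E, h1.union hE, Set.subset_union_right, h2.trans Set.subset_union_left,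
    h3.trans Set.subset_union_left, h4.enlarge h1 h2 h3 (h1.union hE) Set.subset_union_left⟩

theorem NO.trans [Amb L M] [Finite α] [Finite β] [Finite γ] {X : Set M} {h : γ → M} {u : α → M}
    {u' : β → M} (hR : Reg L X h) (hS : Stat L X h) (h1 : NO L Z u X h) (h2 : NO L X h Z' u') :
    NO L Z u Z' u' := by
  obtain ⟨D₁, s1, z1, x1, w1⟩ := h1
  obtain ⟨D, s, hDD, x2, z2, v₂, w, n2, n3, n4⟩ := h2.at s1
  obtain ⟨v, v₁, m1, m2, m3⟩ := w1.enlarge s1 z1 x1 s hDD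
  have e1 : Eqv L D v₂ v₁ := hS D s x2 _ _ n2 m2
  obtain ⟨w', hw'⟩ := e1.extend s w
  have e2 : Eqv L D w w' := by simpa only [Sum.elim_comp_inr] using hw'.comp Sum.inr
  refine ⟨D, s, z1.trans hDD, z2, v, w', m1, ⟨n3.1.trans (e2.mono z2),
    n3.2.conj_left e2 z2 subset_rfl⟩, fun hI => ?_⟩
  rcases hR.ind_or s x2 m2 hI with hI | hI
  · exact m3 (hI.symm s)
  · exact n4 (hI.conj_pair hw'.symm subset_rfl)

theorem NO.ind [Amb L M] [Finite α] [Finite β] {u t : α → M} {u' s : β → M} (hno : NO L Z u Z' u')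
    (hR : Reg L Z u) (hS : Stat L Z u) (hR' : Reg L Z' u') (hE : Small L E) (hZ : Z ⊆ E)
    (hZ' : Z' ⊆ E) (ht : NF L Z u E t) (hs : Eqv L Z' u' s) (hs' : ¬ Ind L Z' (Set.range s) E) :
    Ind L E (Set.range t) (Set.range s) := by
  by_contra hcon
  obtain ⟨D, sD, hED, zD, zD', v, v', n1, n2, n3⟩ := hno.at hE
  obtain ⟨t₁, s₁, e, hI⟩ := exists_ind_pair hE sD t s
  have hI' := hI
  rw [Set.Sum.elim_range] at hI'
  have e1 : Eqv L E t t₁ := by simpa only [Sum.elim_comp_inl] using e.comp Sum.inl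
  have e2 : Eqv L E s s₁ := by simpa only [Sum.elim_comp_inr] using e.comp Sum.inr
  have ht₁ : NF L Z u D t₁ := (ht.enlarge hE hZ e1 (hI'.sub Set.subset_union_left)).restrict
    Set.subset_union_right
  have hcon' : ¬ Ind L D (Set.range t₁) (Set.range s₁) :=
    not_ind_enlarge sD hED (fun h => hcon (h.conj_pair e.symm subset_rfl)) hI
  obtain ⟨w, hw⟩ := (hS D sD zD _ _ n1 ht₁).extend sD v'
  have e3 : Eqv L D v' w := by simpa only [Sum.elim_comp_inr] using hw.comp Sum.inr
  have hw' : NF L Z' u' D w := ⟨n2.1.trans (e3.mono zD'), n2.2.conj_left e3 zD' subset_rfl⟩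
  have h1 : Ind L D (Set.range w) (Set.range s₁) :=
    hR' D sD zD' _ _ hw' (hs.trans (e2.mono hZ')) fun h =>
      hs' ((h.down hED).conj_left e2.symm hZ' subset_rfl)
  rcases hR.ind_or sD zD ht₁ h1 with h | h
  · exact n3 (h.conj_pair hw.symm subset_rfl)
  · exact hcon' h

end Regular

/-! ### Conjugation and change of base for regular types -/

section Conjugation

variable {α β γ κ ι ζ : Type} {A A' B B' C D E F Z Z' N : Set M}

theorem eqv_range_iff {z : ζ → M} {x y : α → M} :
    Eqv L (Set.range z) x y ↔ Eqv L ∅ (Sum.elim x z) (Sum.elim y z) := by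
  rw [← eqv_union_range, Set.empty_union]

theorem Eqv.conj_base {u v : ι → M} (h : Eqv L ∅ u v) (i : κ → ι) (j l : α → ι)
    (hI : Eqv L (Set.range (u ∘ i)) (u ∘ j) (u ∘ l)) :
    Eqv L (Set.range (v ∘ i)) (v ∘ j) (v ∘ l) := by
  rw [eqv_range_iff] at hI ⊢
  simp only [← Sum.comp_elim] at hI ⊢
  exact ((h.comp _).symm.trans hI).trans (h.comp _)

theorem NF.conj_base {u v : ι → M} (h : Eqv L ∅ u v) (i : κ → ι) (j l : α → ι) (m : β → ι)
    (hI : NF L (Set.range (u ∘ i)) (u ∘ j) (Set.range (u ∘ m)) (u ∘ l)) :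
    NF L (Set.range (v ∘ i)) (v ∘ j) (Set.range (v ∘ m)) (v ∘ l) :=
  ⟨Eqv.conj_base h i j l hI.1, hI.2.conj_base h i l m⟩

theorem Eqv.eq_comp {u v : ι → M} (h : Eqv L C u v) (i : κ → ι) (j : ζ → ι) (f : κ → ζ)
    (he : u ∘ i = (u ∘ j) ∘ f) : v ∘ i = (v ∘ j) ∘ f := by
  ext k
  exact (h.iff (Dfb.eq (i k) (j (f k)))).1 (congrFun he k)

theorem exists_comp {z : ζ → M} {d : κ → M} (h : Set.range z ⊆ Set.range d) :
    ∃ f : ζ → κ, z = d ∘ f := by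
  choose f hf using fun i => h ⟨i, rfl⟩
  exact ⟨f, funext fun i => (hf i).symm⟩

theorem range_comp_subset (d : κ → M) (f : ζ → κ) : Set.range (d ∘ f) ⊆ Set.range d :=
  Set.range_comp_subset_range _ _

theorem exists_tuple (h : D.Finite) : ∃ (κ : Type) (_ : Finite κ) (d : κ → M), Set.range d = D := by
  obtain ⟨n, f, hf⟩ := h.fin_param
  exact ⟨Fin n, inferInstance, f, hf.2⟩

theorem Stat.conj [Amb L M] [Finite ζ] [Finite α] {z z' : ζ → M} {u u' : α → M}
    (h : Stat L (Set.range z) u) (e : Eqv L ∅ (Sum.elim z u) (Sum.elim z' u')) :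
    Stat L (Set.range z') u' := by
  intro E hE hZE a b ha hb
  rw [← Set.empty_union E, eqv_union]
  intro κ _ d hd
  let d' : ζ ⊕ κ → M := Sum.elim z' d
  have hd' : Set.range d' ⊆ E := by
    rw [Set.Sum.elim_range]
    exact Set.union_subset hZE (Set.range_subset_iff.2 hd)
  obtain ⟨w, hw⟩ := e.symm.extend Small.empty (Sum.elim d' (Sum.elim a b))
  let d₁ := w ∘ Sum.inl
  let a₁ := w ∘ Sum.inr ∘ Sum.inl
  let b₁ := w ∘ Sum.inr ∘ Sum.inr
  have hz : z = d₁ ∘ Sum.inl := hw.eq_comp (κ := ζ) (ζ := ζ ⊕ κ) (Sum.inl ∘ Sum.inl)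
    (Sum.inr ∘ Sum.inl) Sum.inl rfl
  have ha₁ : NF L (Set.range z) u (Set.range d₁) a₁ :=
    NF.conj_base hw (Sum.inl ∘ Sum.inl) (Sum.inl ∘ Sum.inr) (Sum.inr ∘ Sum.inr ∘ Sum.inl)
      (Sum.inr ∘ Sum.inl) (ha.restrict hd')
  have hb₁ : NF L (Set.range z) u (Set.range d₁) b₁ :=
    NF.conj_base hw (Sum.inl ∘ Sum.inl) (Sum.inl ∘ Sum.inr) (Sum.inr ∘ Sum.inr ∘ Sum.inr)
      (Sum.inr ∘ Sum.inl) (hb.restrict hd')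
  have h1 : Eqv L (Set.range d₁) a₁ b₁ :=
    h _ (Small.range _) (by rw [hz]; exact range_comp_subset _ _) _ _ ha₁ hb₁
  have h2 : Eqv L (Set.range d') a b := Eqv.conj_base hw.symm (Sum.inr ∘ Sum.inl)
    (Sum.inr ∘ Sum.inr ∘ Sum.inl) (Sum.inr ∘ Sum.inr ∘ Sum.inr) h1
  exact eqv_range_iff.1 (h2.mono (Set.range_comp_subset_range Sum.inr d'))

theorem exists_tuple_not_ind [Amb L M] [Finite α] [Finite β] {a : α → M} {b : β → M}
    (hE : Small L E) (h : ¬ Ind L E (Set.range a) (Set.range b)) (hF : F.Finite) (hFE : F ⊆ E) :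
    ∃ (κ : Type) (_ : Finite κ) (d : κ → M), Set.range d ⊆ E ∧ F ⊆ Set.range d ∧
      Ind L (Set.range d) (Set.range (Sum.elim a b)) E ∧
      ¬ Ind L (Set.range d) (Set.range a) (Set.range b) := by
  obtain ⟨E₀, h1, h2, h3⟩ := exists_finite_not_ind hE h hF hFE
  obtain ⟨κ, hκ, d, rfl⟩ := exists_tuple h2
  exact ⟨κ, hκ, d, h1, h3⟩

theorem not_ind_of_base [Amb L M] {a : α → M} (hE : Small L E) (hZ : Z ⊆ D) (hD : D ⊆ E)
    (h : ¬ Ind L Z (Set.range a) E) (hI : Ind L D (Set.range a) E) :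
    ¬ Ind L Z (Set.range a) D := fun hcon =>
  h ((Ind.trans (hE.mono hD) hZ hcon hI).down Set.subset_union_right)

theorem Reg.conj [Amb L M] [Finite ζ] [Finite α] {z z' : ζ → M} {u u' : α → M}
    (h : Reg L (Set.range z) u) (e : Eqv L ∅ (Sum.elim z u) (Sum.elim z' u')) :
    Reg L (Set.range z') u' := by
  intro E hE hZE a b ha hb hbE
  by_contra hcon
  obtain ⟨κ, _, d, h1, h2, h3, h4⟩ := exists_tuple_not_ind hE hcon (Set.finite_range z') hZE
  obtain ⟨f, hf⟩ := exists_comp h2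
  rw [Set.Sum.elim_range] at h3
  have hbd : ¬ Ind L (Set.range z') (Set.range b) (Set.range d) :=
    not_ind_of_base hE h2 h1 hbE (h3.sub Set.subset_union_right)
  obtain ⟨w, hw⟩ := e.symm.extend Small.empty (Sum.elim d (Sum.elim a b))
  let d₁ := w ∘ Sum.inl
  let a₁ := w ∘ Sum.inr ∘ Sum.inl
  let b₁ := w ∘ Sum.inr ∘ Sum.inr
  have hz : z = d₁ ∘ f := hw.eq_comp (Sum.inl ∘ Sum.inl) (Sum.inr ∘ Sum.inl) f hf
  have ha₁ : NF L (Set.range z) u (Set.range d₁) a₁ :=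
    NF.conj_base hw (Sum.inl ∘ Sum.inl) (Sum.inl ∘ Sum.inr) (Sum.inr ∘ Sum.inr ∘ Sum.inl)
      (Sum.inr ∘ Sum.inl) (ha.restrict h1)
  have hb₁ : Eqv L (Set.range z) u b₁ := Eqv.conj_base hw (Sum.inl ∘ Sum.inl)
    (Sum.inl ∘ Sum.inr) (Sum.inr ∘ Sum.inr ∘ Sum.inr) hb
  have hb₂ : ¬ Ind L (Set.range z) (Set.range b₁) (Set.range d₁) := fun hI =>
    hbd (Ind.conj_base hw.symm (Sum.inl ∘ Sum.inl) (Sum.inr ∘ Sum.inr ∘ Sum.inr)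
      (Sum.inr ∘ Sum.inl) hI)
  refine h4 (Ind.conj_base hw.symm (Sum.inr ∘ Sum.inl) (Sum.inr ∘ Sum.inr ∘ Sum.inl)
    (Sum.inr ∘ Sum.inr ∘ Sum.inr) (h _ (Small.range d₁) ?_ _ _ ha₁ hb₁ hb₂))
  rw [hz]
  exact range_comp_subset _ _

theorem NO.conj [Amb L M] {ζ' : Type} [Finite ζ] [Finite ζ'] [Finite α] [Finite β]
    {z y : ζ → M} {z' y' : ζ' → M} {u x : α → M} {u' x' : β → M}
    (h : NO L (Set.range z) u (Set.range z') u')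
    (e : Eqv L ∅ (Sum.elim (Sum.elim z u) (Sum.elim z' u'))
      (Sum.elim (Sum.elim y x) (Sum.elim y' x'))) :
    NO L (Set.range y) x (Set.range y') x' := by
  obtain ⟨D, hD, hZ, hZ', v, v', n1, n2, n3⟩ := h
  obtain ⟨κ, _, d, h1, h2, -, h4⟩ := exists_tuple_not_ind hD n3
    ((Set.finite_range z).union (Set.finite_range z')) (Set.union_subset hZ hZ')
  obtain ⟨f, hf⟩ := exists_comp (Set.subset_union_left.trans h2)
  obtain ⟨f', hf'⟩ := exists_comp (Set.subset_union_right.trans h2)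
  obtain ⟨w, hw⟩ := e.extend Small.empty (Sum.elim d (Sum.elim v v'))
  let d₁ := w ∘ Sum.inl
  let v₁ := w ∘ Sum.inr ∘ Sum.inl
  let v₁' := w ∘ Sum.inr ∘ Sum.inr
  have hz : y = d₁ ∘ f := hw.eq_comp (Sum.inl ∘ Sum.inl ∘ Sum.inl) (Sum.inr ∘ Sum.inl) f hf
  have hz' : y' = d₁ ∘ f' := hw.eq_comp (Sum.inl ∘ Sum.inr ∘ Sum.inl) (Sum.inr ∘ Sum.inl) f' hf'
  refine ⟨Set.range d₁, Small.range _, ?_, ?_, v₁, v₁',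
    NF.conj_base hw (Sum.inl ∘ Sum.inl ∘ Sum.inl) (Sum.inl ∘ Sum.inl ∘ Sum.inr)
      (Sum.inr ∘ Sum.inr ∘ Sum.inl) (Sum.inr ∘ Sum.inl) (n1.restrict h1),
    NF.conj_base hw (Sum.inl ∘ Sum.inr ∘ Sum.inl) (Sum.inl ∘ Sum.inr ∘ Sum.inr)
      (Sum.inr ∘ Sum.inr ∘ Sum.inr) (Sum.inr ∘ Sum.inl) (n2.restrict h1), fun hI => h4 ?_⟩
  · rw [hz]
    exact range_comp_subset _ _
  · rw [hz']
    exact range_comp_subset _ _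
  · exact Ind.conj_base hw.symm (Sum.inr ∘ Sum.inl) (Sum.inr ∘ Sum.inr ∘ Sum.inl)
      (Sum.inr ∘ Sum.inr ∘ Sum.inr) hI

theorem Reg.restrict [Amb L M] [Finite ζ] [Finite α] {z : ζ → M} {u : α → M} (hN : Small L N)
    (hR : Reg L N u) (hS : Stat L (Set.range z) u) (hz : Set.range z ⊆ N)
    (hI : Ind L (Set.range z) (Set.range u) N) : Reg L (Set.range z) u := by
  intro E hE hZE a b ha hb hbE
  by_contra hcon
  obtain ⟨κ, _, d, h1, h2, h3, h4⟩ := exists_tuple_not_ind hE hcon (Set.finite_range z) hZE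
  obtain ⟨f, hf⟩ := exists_comp h2
  rw [Set.Sum.elim_range] at h3
  have hbd : ¬ Ind L (Set.range z) (Set.range b) (Set.range d) :=
    not_ind_of_base hE h2 h1 hbE (h3.sub Set.subset_union_right)
  obtain ⟨w, hw, hwN⟩ := exists_ind (Small.range z) hN (Sum.elim d (Sum.elim a b))
  let d₁ := w ∘ Sum.inl
  let a₁ := w ∘ Sum.inr ∘ Sum.inl
  let b₁ := w ∘ Sum.inr ∘ Sum.inr
  have hw' := eqv_range_iff.1 hw
  have hz₁ : Set.range z ⊆ Set.range d₁ := by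
    have : z = d₁ ∘ f := hw'.eq_comp Sum.inr (Sum.inl ∘ Sum.inl) f hf
    rw [this]
    exact range_comp_subset _ _
  have sd : Small L (Set.range d₁) := Small.range _
  have sz : Small L (Set.range z) := Small.range _
  have ea : Eqv L (Set.range z) a a₁ := hw.comp (Sum.inr ∘ Sum.inl)
  have eb : Eqv L (Set.range z) b b₁ := hw.comp (Sum.inr ∘ Sum.inr)
  have hab : Ind L (Set.range d₁) (Set.range (Sum.elim a₁ b₁)) N :=
    (((hwN.symm sz).base (D := Set.range d₁) hz₁ ((range_comp_subset w Sum.inl).trans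
      Set.subset_union_left)).symm sd).sub (by
        rw [Set.Sum.elim_range]
        exact Set.union_subset (range_comp_subset _ _) (range_comp_subset _ _))
  rw [Set.Sum.elim_range] at hab
  have toN : ∀ x : α → M, Eqv L (Set.range z) u x → Ind L (Set.range z) (Set.range x) N →
      Eqv L N u x := fun x hx hxN => hS N hN hz _ _ ⟨Eqv.refl u, hI⟩ ⟨hx, hxN⟩
  have ha₁d : Ind L (Set.range z) (Set.range a₁) (Set.range d₁) :=
    Ind.conj_pair (hw.comp (Sum.elim (Sum.inr ∘ Sum.inl) Sum.inl) |> fun h => by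
      rwa [Sum.comp_elim, Sum.comp_elim] at h) subset_rfl (ha.restrict h1).2
  have ha₁ : Ind L (Set.range z) (Set.range a₁) (Set.range d₁ ∪ N) :=
    Ind.trans sd hz₁ ha₁d (hab.sub Set.subset_union_left)
  have hnf : NF L N u (Set.range d₁ ∪ N) a₁ :=
    ⟨toN _ (ha.1.trans ea) (ha₁.down Set.subset_union_right),
      ha₁.up hz Set.subset_union_right subset_rfl⟩
  have hbN : Ind L (Set.range z) (Set.range b₁) N := hwN.sub (range_comp_subset _ _)
  have h5 := hR (Set.range d₁ ∪ N) (sd.union hN) Set.subset_union_right a₁ b₁ hnf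
    (toN _ (hb.trans eb) hbN) fun hcon => hbd (by
      have h6 := (Ind.trans hN hz hbN hcon).down (B' := Set.range d₁)
        (Set.subset_union_left.trans Set.subset_union_right)
      exact Ind.conj_pair (hw.comp (Sum.elim (Sum.inr ∘ Sum.inr) Sum.inl) |> fun h => by
        rw [Sum.comp_elim, Sum.comp_elim] at h
        exact h.symm) subset_rfl h6)
  have h6 : Ind L (Set.range d₁) (Set.range a₁) (Set.range b₁) := by
    have h7 := (hab.sub (A' := Set.range a₁) Set.subset_union_left).mono (B' := Set.range d₁ ∪ N)
      subset_rfl (by rw [Set.union_comm])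
    exact (Ind.trans (sd.union hN) Set.subset_union_left h7 h5).down Set.subset_union_right
  have h7 : Eqv L ∅ (Sum.elim d (Sum.elim a b)) w := hw.mono (Set.empty_subset _)
  exact h4 (Ind.conj_base h7.symm Sum.inl (Sum.inr ∘ Sum.inl) (Sum.inr ∘ Sum.inr) h6)

end Conjugation

section Formal

variable {D E Z : Set M} {n m : ℕ}

theorem TypeRegular.reg [Amb L M] {d : Fin n → M} (h : TypeRegular (L := L) Z d) : Reg L Z d := by
  intro E hE hZE a b ha hb hbE
  have h1 := h E b hZE (sameTypeOver_iff.2 hb) ((tupForksOver_iff hE hZE).2 hbE) E a b hZE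
    subset_rfl (sameTypeOver_iff.2 ha.1) ((not_tupForksOver_iff hE hZE).2 ha.2)
    (sameTypeOver_iff.2 (Eqv.refl b))
    ((not_tupForksOver_iff hE subset_rfl).2 (ind_self subset_rfl hE))
  exact ((not_tupForksOver_iff (hE.union (Small.range b)) Set.subset_union_left).1 h1).down
    Set.subset_union_right

theorem TypeStationary.stat [Amb L M] {d : Fin n → M} (h : TypeStationary (L := L) Z d) :
    Stat L Z d := fun E hE hZE a b ha hb =>
  sameTypeOver_iff.1 (h E hZE a b (sameTypeOver_iff.2 ha.1) (sameTypeOver_iff.2 hb.1)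
    ((not_tupForksOver_iff hE hZE).2 ha.2) ((not_tupForksOver_iff hE hZE).2 hb.2))

end Formal

/-! ### Nonorthogonality to a small set -/

section Shrink

variable {α β ι ζ : Type} {A B C D E F Z Z' N : Set M}

theorem Dfb.exists_finite_base {P : (α → M) → Prop} (h : Dfb L (C ∪ D) P) :
    ∃ F ⊆ D, F.Finite ∧ Dfb L (C ∪ F) P := by
  obtain ⟨κ, hκ, d, Q, hd, hQ, hPQ⟩ := h.split
  refine ⟨Set.range d, Set.range_subset_iff.2 hd, Set.finite_range d, ?_⟩
  have hd' : ∀ i, d i ∈ C ∪ Set.range d := fun i => Or.inr ⟨i, rfl⟩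
  exact ((hQ.mono Set.subset_union_left).inst' d hd').congr hPQ

theorem Divides.mono {n m : ℕ} {φ : L.Formula (Fin n ⊕ Fin m)} {b : Fin m → M} (hCD : C ⊆ D)
    (h : Divides (L := L) D φ b) : Divides (L := L) C φ b := by
  obtain ⟨f, h1, h2, h3⟩ := h
  exact ⟨f, h1, fun k i j hi hj =>
    sameTypeOver_iff.2 ((sameTypeOver_iff.1 (h2 k i j hi hj)).mono hCD), h3⟩

theorem no_of_not_typesOrthogonal [Amb L M] {n m : ℕ} {d : Fin n → M} {e : Fin m → M}
    (hZ : Small L Z) (hZ' : Small L Z') (hS : Stat L Z d)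
    (h : ¬ TypesOrthogonal (L := L) Z d Z' e) : NO L Z d Z' e := by
  unfold TypesOrthogonal at h
  push Not at h
  obtain ⟨D, d', e', hZD, hZD', h1, h2, h3, h4, r, ms, φ, b, h5, h6⟩ := h
  by_contra hcon
  have nd : ∀ E, E ⊆ D → NF L Z d E d' := fun E hE => ⟨sameTypeOver_iff.1 h1, by
    by_contra hI
    exact h2 (tupForksOver_of_not_ind hZ hE hZD hI)⟩
  have ne : ∀ E, E ⊆ D → NF L Z' e E e' := fun E hE => ⟨sameTypeOver_iff.1 h3, by
    by_contra hI
    exact h4 (tupForksOver_of_not_ind hZ' hE hZD' hI)⟩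
  have key : ∀ E, E ⊆ D → Small L E → Z ⊆ E → Z' ⊆ E → ∀ a, Eqv L E d' a →
      Eqv L (E ∪ Set.range e') d' a := by
    intro E hE sE zE zE' a ha
    have hI : ∀ a, Eqv L E d' a → NF L Z d (E ∪ Set.range e') a := by
      intro a ha
      have na : NF L Z d E a := ⟨(nd E hE).1.trans (ha.mono zE),
        (nd E hE).2.conj_left ha zE subset_rfl⟩
      refine na.enlarge sE zE (Eqv.refl _) ?_
      by_contra hI
      exact hcon ⟨E, sE, zE, zE', a, e', na, ne E hE, hI⟩
    exact hS _ (sE.union (Small.range _)) (zE.trans Set.subset_union_left) _ _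
      (hI _ (Eqv.refl _)) (hI a ha)
  refine h2 ⟨r, ms, φ, b, fun i => (h5 i).mono hZD, fun a ha => h6 a ?_⟩
  rw [sameTypeOver_iff] at ha ⊢
  intro P hP hPd
  rw [Set.union_comm] at hP
  obtain ⟨F, hFD, hF, hPF⟩ := hP.exists_finite_base
  refine key (Z ∪ Z' ∪ F) (Set.union_subset (Set.union_subset hZD hZD') hFD)
    ((hZ.union hZ').union (Small.finite hF)) (Set.subset_union_left.trans Set.subset_union_left)
    (Set.subset_union_right.trans Set.subset_union_left) a
    (ha.mono (Set.union_subset (Set.union_subset hZD hZD') hFD)) P (hPF.mono ?_) hPd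
  exact Set.union_subset Set.subset_union_right
    (Set.subset_union_right.trans Set.subset_union_left)

theorem Ind.iUnion {b : ℕ → Set M} (h : ∀ n, Ind L C A (⋃ m ∈ Set.Iio n, b m)) :
    Ind L C A (⋃ m, b m) := by
  intro γ _ P x y hx hy
  have := P.fin
  have hN : ∀ j, ∃ n, ∀ k, n ≤ k → y j ∈ (⋃ m ∈ Set.Iio k, b m) ∪ C := by
    intro j
    rcases hy j with hj | hj
    · obtain ⟨m, hm⟩ := Set.mem_iUnion.1 hj
      exact ⟨m + 1, fun k hk => Or.inl (Set.mem_biUnion (x := m) (show m < k by omega) hm)⟩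
    · exact ⟨0, fun _ _ => Or.inr hj⟩
  choose f hf using hN
  obtain ⟨N, hN⟩ := (Set.finite_range f).bddAbove
  exact h N γ P x y hx fun j => hf j N (hN ⟨j, rfl⟩)

theorem ind_iUnion_ne [Amb L M] {G : ℕ → Set M} (hE : Small L E) (hG : ∀ n, Small L (G n))
    (hI : ∀ n, Ind L E (G n) (⋃ m ∈ Set.Iio n, G m)) (n : ℕ) :
    Ind L E (G n) (⋃ m, if m = n then ∅ else G m) := by
  refine Ind.iUnion fun N => ?_
  have hs : ∀ m, Small L (if m = n then ∅ else G m) := fun m => by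
    split_ifs
    exacts [Small.empty, hG m]
  have hsub : ∀ N, (⋃ m ∈ Set.Iio N, if m = n then ∅ else G m) ⊆ ⋃ m ∈ Set.Iio N, G m :=
    fun N => Set.iUnion₂_mono fun m _ => by
      split_ifs
      exacts [Set.empty_subset _, subset_rfl]
  induction N with
  | zero => simpa using (ind_self (L := L) (Set.empty_subset E) hE)
  | succ N ih =>
    rcases lt_trichotomy N n with h | rfl | h
    · refine (hI n).down ((hsub _).trans ?_)
      exact Set.biUnion_subset_biUnion_left fun m hm => Set.mem_Iio.2 ((Set.mem_Iio.1 hm).trans_le h)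
    · rw [biUnion_Iio_succ, if_pos rfl, Set.union_empty]
      exact ih
    · rw [biUnion_Iio_succ, if_neg h.ne']
      have h1 : Ind L E (G N) ((⋃ m ∈ Set.Iio N, if m = n then ∅ else G m) ∪ G n) :=
        (hI N).down (Set.union_subset (hsub N) (Set.subset_biUnion_of_mem (u := G) h))
      have h2 := h1.base (D := E ∪ ⋃ m ∈ Set.Iio N, if m = n then ∅ else G m)
        Set.subset_union_left (Set.union_subset Set.subset_union_right
          (Set.subset_union_left.trans Set.subset_union_left))
      have sP := Small.biUnion_Iio hs N
      exact ih.right_trans hE sP ((h2.mono (B' := G n) subset_rfl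
        (Set.subset_union_right.trans Set.subset_union_left)).symm (hE.union sP))

theorem exists_no_pair [Amb L M] [Finite ζ] [Finite α] [Finite β] {c : ζ → M} {s : α → M}
    {e : β → M} (hN : Small L N) (hcN : Set.range c ⊆ N)
    (hCB : C ⊆ B) (hBN : B ⊆ N) (hcB : Ind L C (Set.range c) B)
    (hsN : Ind L (Set.range c) (Set.range s) N) (hno : NO L N s B e) :
    ∃ (z z' : ζ → M) (u u' : α → M), Eqv L ∅ (Sum.elim c s) (Sum.elim z u) ∧
      Eqv L ∅ (Sum.elim c s) (Sum.elim z' u') ∧ Eqv L C c z ∧ Eqv L C c z' ∧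
      Ind L C (Set.range z) (Set.range z') ∧ NO L (Set.range z) u (Set.range z') u' := by
  obtain ⟨D, sD, hND, hBD, a, e', na, ne, hae⟩ := hno
  have sB : Small L B := hN.mono hBN
  have sc : Small L (Set.range c) := Small.range _
  have sC : Small L C := sB.mono hCB
  have haD : Ind L (Set.range c) (Set.range a) D :=
    (Ind.trans hN hcN (hsN.conj_left na.1 hcN subset_rfl) na.2).down Set.subset_union_right
  obtain ⟨A₀, hA₀, fA₀, hA₀e⟩ := exists_finite_base (L := L) e' B
  have he0 : Ind L A₀ (Set.range e') D :=
    (Ind.trans sB hA₀ hA₀e ne.2).down Set.subset_union_right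
  obtain ⟨κ, _, d, hdD, hFd, -, hade⟩ := exists_tuple_not_ind sD hae
    (fA₀.union (Set.finite_range c)) (Set.union_subset (hA₀.trans hBD) (hcN.trans hND))
  obtain ⟨f, hf⟩ := exists_comp (Set.subset_union_right.trans hFd)
  let K := C ∪ A₀
  have hKB : K ⊆ B := Set.union_subset hCB hA₀
  have hKD : K ⊆ D := hKB.trans hBD
  have sK : Small L K := sB.mono hKB
  have he1 : Ind L K (Set.range e') (Set.range d) := he0.up Set.subset_union_right hKD hdD
  let E := K ∪ Set.range e'
  have sE : Small L E := sK.union (Small.range _)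
  obtain ⟨w, hw⟩ := (nFork_empty sE (Sum.elim d a)).exists_seq sE Small.empty
  simp only [Set.union_empty, Set.empty_union] at hw
  let d' : ℕ → κ → M := fun n => w n ∘ Sum.inl
  let a' : ℕ → α → M := fun n => w n ∘ Sum.inr
  let c' : ℕ → ζ → M := fun n => d' n ∘ f
  let U : ℕ → Set M := fun n => ⋃ m, if m = n then ∅ else Set.range (d' m)
  have hKE : K ⊆ E := Set.subset_union_left
  have hd' : ∀ n, Eqv L E d (d' n) := fun n => (hw n).1.comp Sum.inl
  have hda : ∀ n, Eqv L E (Sum.elim d a) (Sum.elim (d' n) (a' n)) := fun n => by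
    have := (hw n).1
    rwa [← Sum.elim_comp_inl_inr (w n)] at this
  have hc' : ∀ n, Eqv L E c (c' n) := fun n => by
    rw [hf]
    exact (hd' n).comp f
  have hdw : ∀ n, Set.range (d' n) ⊆ Set.range (w n) := fun n => range_comp_subset _ _
  have haw : ∀ n, Set.range (a' n) ⊆ Set.range (w n) := fun n => range_comp_subset _ _
  have sd : ∀ n, Small L (Set.range (d' n)) := fun n => Small.range _
  have hed : ∀ n, Ind L K (Set.range e') (Set.range (d' n)) := fun n =>
    ((he1.symm sK).conj_left (hd' n) hKE Set.subset_union_right).symm sK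
  have hPs : ∀ n, Small L (⋃ m ∈ Set.Iio n, Set.range (d' m)) :=
    Small.biUnion_Iio fun m => sd m
  have hdP : ∀ n, Ind L K (Set.range (d' n)) (Set.range e' ∪ ⋃ m ∈ Set.Iio n, Set.range (d' m)) :=
    fun n => ((hed n).symm sK).right_trans sK (Small.range _) (((hw n).2.sub (hdw n)).down
      (Set.iUnion₂_mono fun m _ => hdw m))
  have heU : Ind L K (Set.range e') (⋃ m, Set.range (d' m)) := by
    refine Ind.iUnion fun n => ?_
    induction n with
    | zero => simpa using (ind_self (L := L) (Set.empty_subset K) sK)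
    | succ n ih =>
      rw [biUnion_Iio_succ]
      refine ih.right_trans sK (hPs n) (Ind.symm (sK.union (hPs n)) ?_)
      exact ((hdP n).base Set.subset_union_left (Set.union_subset Set.subset_union_right
        (Set.subset_union_right.trans Set.subset_union_left))).mono subset_rfl
        (Set.subset_union_left.trans Set.subset_union_left)
  have hUd : ∀ n, U n ⊆ ⋃ m, Set.range (d' m) := fun n => Set.iUnion_mono fun m => by
    split_ifs
    exacts [Set.empty_subset _, subset_rfl]
  have sU' : Small L (⋃ m, Set.range (d' m)) :=
    Small.of_countable (Set.countable_iUnion fun m => Set.countable_range _)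
  have sU : ∀ n, Small L (U n) := fun n => sU'.mono (hUd n)
  have hUw : ∀ n, Ind L K (U n) (Set.range e' ∪ Set.range (w n)) := fun n => by
    refine ((heU.down (hUd n)).symm sK).right_trans sK (Small.range _) (Ind.symm sE ?_)
    refine (ind_iUnion_ne sE (fun m => Small.range _) (fun m => (hw m).2) n).down ?_
    refine Set.iUnion_mono fun m => ?_
    split_ifs
    exacts [subset_rfl, hdw m]
  let F := K ∪ ⋃ m, Set.range (d' m)
  have sF : Small L F := sK.union sU'
  have hdF : ∀ n, Set.range (d' n) ⊆ F := fun n =>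
    (Set.subset_iUnion (fun m => Set.range (d' m)) n).trans Set.subset_union_right
  have hcd : ∀ n, Set.range (c' n) ⊆ Set.range (d' n) := fun n => range_comp_subset _ _
  have haF : ∀ n, Ind L (Set.range (c' n)) (Set.range (a' n)) F := by
    intro n
    have h1 : Ind L (∅ ∪ Set.range c) (Set.range a) (K ∪ Set.range d) := by
      rw [Set.empty_union]
      exact haD.down (Set.union_subset hKD hdD)
    have h2 : Ind L (Set.range (c' n)) (Set.range (a' n)) (K ∪ Set.range (d' n)) := by
      have := Ind.conj (hda n) (Sum.inl ∘ f) Sum.inr Sum.inl (Set.empty_subset E) hKE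
        (by rw [← Function.comp_assoc, Sum.elim_comp_inl, Sum.elim_comp_inr, ← hf]; exact h1)
      rwa [Set.empty_union] at this
    have h3 : Ind L (K ∪ Set.range (d' n)) (Set.range (a' n)) (U n) := by
      refine ((hUw n).base Set.subset_union_left ?_).symm (sK.union (sd n)) |>.sub
        ((haw n).trans Set.subset_union_right)
      exact Set.union_subset Set.subset_union_right
        (((hdw n).trans Set.subset_union_right).trans Set.subset_union_left)
    refine (Ind.trans (sK.union (sd n)) ((hcd n).trans Set.subset_union_right) h2 h3).down ?_
    refine Set.union_subset (Set.subset_union_left.trans Set.subset_union_left)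
      (Set.iUnion_subset fun m => ?_)
    rcases eq_or_ne m n with rfl | hmn
    · exact Set.subset_union_right.trans Set.subset_union_left
    · refine subset_trans ?_ Set.subset_union_right
      have := Set.subset_iUnion (fun m => if m = n then ∅ else Set.range (d' m)) m
      rwa [if_neg hmn] at this
  have hnF : ∀ n, NF L (Set.range (c' n)) (a' n) F (a' n) := fun n => ⟨Eqv.refl _, haF n⟩
  have hcF : ∀ n, Set.range (c' n) ⊆ F := fun n => (hcd n).trans (hdF n)
  have hae' : ∀ n, ¬ Ind L F (Set.range (a' n)) (Set.range e') := by
    intro n hI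
    have h1 : Ind L (Set.range (d' n)) (Set.range (a' n)) (Set.range e') :=
      (Ind.trans sF (hdF n) ((haF n).up (hcd n) (hdF n) subset_rfl) hI).down
        Set.subset_union_right
    have h2 := (hda n).append_const e' fun i => Or.inr ⟨i, rfl⟩
    exact hade (Ind.conj_base h2.symm (Sum.inl ∘ Sum.inl) (Sum.inl ∘ Sum.inr) Sum.inr h1)
  have hpair : ∃ m n, m < n ∧ NO L (Set.range (c' n)) (a' n) (Set.range (c' m)) (a' m) := by
    by_contra! hcon
    have hI : ∀ n, Ind L F (Set.range (a' n)) (⋃ m ∈ Set.Iio n, Set.range (a' m)) := by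
      intro n
      induction n using Nat.strong_induction_on with
      | _ n ih =>
        have hj : ∀ j, j ≤ n → Ind L F (Set.range (a' n)) (⋃ m ∈ Set.Iio j, Set.range (a' m)) := by
          intro j
          induction j with
          | zero => exact fun _ => by simpa using (ind_self (L := L) (Set.empty_subset F) sF)
          | succ j jh =>
            intro hjn
            rw [biUnion_Iio_succ]
            have h1 := jh (by omega)
            have sP := Small.biUnion_Iio (fun m => Small.range (L := L) (a' m)) j
            refine h1.right_trans sF sP ?_
            by_contra hI
            refine hcon j n hjn ⟨_, sF.union sP, (hcF n).trans Set.subset_union_left,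
              (hcF j).trans Set.subset_union_left, a' n, a' j, ?_, ?_, hI⟩
            · exact (hnF n).enlarge sF (hcF n) (Eqv.refl _) h1
            · exact (hnF j).enlarge sF (hcF j) (Eqv.refl _) (ih j (by omega))
        exact hj n le_rfl
    exact no_infinite_weight sF e' (fun n => Set.range (a' n)) (fun n => Small.range _) hI hae'
  obtain ⟨m, n, hmn, hno⟩ := hpair
  have hcs : Eqv L ∅ (Sum.elim c s) (Sum.elim c a) :=
    eqv_range_iff.1 (na.1.mono hcN) |> fun h => by
      have := h.comp Sum.swap
      rwa [Sum.elim_swap, Sum.elim_swap] at this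
  have hca : ∀ n, Eqv L ∅ (Sum.elim c a) (Sum.elim (c' n) (a' n)) := fun n => by
    have := ((hda n).mono (Set.empty_subset E)).comp (Sum.map f id)
    rwa [Sum.elim_comp_map, Sum.elim_comp_map, ← hf] at this
  have hCE : C ⊆ E := Set.subset_union_left.trans hKE
  refine ⟨c' n, c' m, a' n, a' m, hcs.trans (hca n), hcs.trans (hca m), (hc' n).mono hCE,
    (hc' m).mono hCE, ?_, hno⟩
  have h1 : Ind L C (Set.range (c' n)) K :=
    (hcB.down hKB).conj_left ((hc' n).mono hKE) Set.subset_union_left subset_rfl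
  refine (Ind.trans sK Set.subset_union_left h1 (((hdP n).sub (hcd n)).down ?_)).down
    Set.subset_union_right
  refine subset_trans ?_ Set.subset_union_right
  exact (hcd m).trans (Set.subset_biUnion_of_mem (u := fun m => Set.range (d' m)) hmn)

end Shrink

/-! ### Transfer of nonorthogonality along an indiscernible sequence -/

section Transfer

variable {α β ι ζ : Type} {A B C D E F Z Z' N : Set M}

theorem NO.congr_left [Amb L M] {u x : α → M} {u' : β → M} (h : NO L Z u Z' u')
    (e : Eqv L Z u x) : NO L Z x Z' u' := by
  obtain ⟨D, h1, h2, h3, v, v', n1, n2, n3⟩ := h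
  exact ⟨D, h1, h2, h3, v, v', ⟨e.symm.trans n1.1, n1.2⟩, n2, n3⟩

/-- If `a` is independent from `f 0` over `C` and `f` is a `C`-indiscernible sequence, then
`tp(a / C ∪ f 0)` is consistent with its conjugate over `C ∪ f i`. -/
theorem exists_common_conj [Amb L M] [Finite α] [Finite ζ] {a : α → M} {f : ℕ → ζ → M}
    (hC : Small L C) (hf : ∀ i j i' j', i < j → i' < j' →
      Eqv L C (Sum.elim (f i) (f j)) (Sum.elim (f i') (f j')))
    (ha : Ind L C (Set.range a) (Set.range (f 0))) (i : ℕ) :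
    ∃ b : α → M, Eqv L C (Sum.elim a (f 0)) (Sum.elim b (f 0)) ∧
      Eqv L C (Sum.elim a (f 0)) (Sum.elim b (f i)) := by
  rcases Nat.eq_zero_or_pos i with rfl | hi
  · exact ⟨a, Eqv.refl _, Eqv.refl _⟩
  let P := {Y : (α → M) → Prop | ∃ R : (α ⊕ ζ → M) → Prop, Dfb L C R ∧ R (Sum.elim a (f 0)) ∧
    Y = fun x => R (Sum.elim x (f 0)) ∧ R (Sum.elim x (f i))}
  have hsm : Small L (C ∪ (Set.range (f 0) ∪ Set.range (f i))) :=
    hC.union ((Small.range _).union (Small.range _))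
  have key := hsm.realize P ?_ (exists_of_directed ?_ ?_ ?_)
  · obtain ⟨b, hb⟩ := key
    exact ⟨b, fun R hR h => (hb _ ⟨R, hR, h, rfl⟩).1, fun R hR h => (hb _ ⟨R, hR, h, rfl⟩).2⟩
  · rintro _ ⟨R, hR, -, rfl⟩
    exact ((hR.mono Set.subset_union_left).inst' _ fun j => Or.inr (Or.inl ⟨j, rfl⟩)).and
      ((hR.mono Set.subset_union_left).inst' _ fun j => Or.inr (Or.inr ⟨j, rfl⟩))
  · exact ⟨_, fun _ => True, Dfb.const _, trivial, rfl⟩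
  · rintro _ ⟨R, hR, h, rfl⟩ _ ⟨R', hR', h', rfl⟩
    exact ⟨_, ⟨_, hR.and hR', ⟨h, h'⟩, rfl⟩, fun v hv => ⟨⟨hv.1.1, hv.2.1⟩, hv.1.2, hv.2.2⟩⟩
  · rintro _ ⟨R, hR, h, rfl⟩
    by_contra hcon
    refine ha.not_kDiv (k := 2) hR (fun j => ⟨j, rfl⟩) (fun j => Or.inl ⟨j, rfl⟩) h ?_
    have hinc : ∀ m n, m < n → ¬ ∃ x, R (Sum.elim x (f m)) ∧ R (Sum.elim x (f n)) := by
      intro m n hmn hx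
      have hD : Dfb L C fun v : ζ ⊕ ζ → M => ∃ x : α → M,
          R (Sum.elim x (v ∘ Sum.inl)) ∧ R (Sum.elim x (v ∘ Sum.inr)) := by
        refine Dfb.ex (P := fun w => R (Sum.elim (w ∘ Sum.inr) (w ∘ Sum.inl ∘ Sum.inl)) ∧
          R (Sum.elim (w ∘ Sum.inr) (w ∘ Sum.inl ∘ Sum.inr))) ?_
        refine ((hR.comp (Sum.elim Sum.inr (Sum.inl ∘ Sum.inl))).congr fun w => ?_).and
          ((hR.comp (Sum.elim Sum.inr (Sum.inl ∘ Sum.inr))).congr fun w => ?_)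
        all_goals rw [Sum.comp_elim]
      exact hcon (hf _ _ _ _ hmn hi _ hD hx)
    intro X hX hX0 r
    refine ⟨fun n => f n, fun n => ?_, fun s hs => ?_⟩
    · have h1 := (hf 0 (n + 1) n (n + 1) (by omega) (by omega)).comp Sum.inl
      exact h1 X hX hX0
    · rintro ⟨x, hx⟩
      have hne : (s 0 : ℕ) ≠ s 1 := fun h => absurd (hs (Fin.ext h)) (by decide)
      rcases hne.lt_or_gt with hlt | hlt
      · exact hinc _ _ hlt ⟨x, hx 0, hx 1⟩
      · exact hinc _ _ hlt ⟨x, hx 1, hx 0⟩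

theorem NO.transfer [Amb L M] [Finite α] [Finite ζ] {c z z' y y' : ζ → M} {s u u' d x : α → M}
    (h1 : Eqv L ∅ (Sum.elim c s) (Sum.elim z u)) (h2 : Eqv L ∅ (Sum.elim c s) (Sum.elim z' u'))
    (h : NO L (Set.range z) u (Set.range z') u')
    (h3 : Eqv L ∅ (Sum.elim z z') (Sum.elim y' y))
    (h4 : Eqv L ∅ (Sum.elim c s) (Sum.elim y d)) (h5 : Eqv L ∅ (Sum.elim c s) (Sum.elim y' x)) :
    NO L (Set.range y) d (Set.range y') x := by
  obtain ⟨w, hw⟩ := h3.extend Small.empty (Sum.elim u u')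
  have e1 : Eqv L ∅ (Sum.elim z u) (Sum.elim y' (w ∘ Sum.inl)) := by
    have := hw.comp (Sum.elim (Sum.inl ∘ Sum.inl) (Sum.inr ∘ Sum.inl))
    rwa [Sum.comp_elim, Sum.comp_elim] at this
  have e2 : Eqv L ∅ (Sum.elim z' u') (Sum.elim y (w ∘ Sum.inr)) := by
    have := hw.comp (Sum.elim (Sum.inl ∘ Sum.inr) (Sum.inr ∘ Sum.inr))
    rwa [Sum.comp_elim, Sum.comp_elim] at this
  have e3 : Eqv L ∅ (Sum.elim (Sum.elim z u) (Sum.elim z' u'))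
      (Sum.elim (Sum.elim y' (w ∘ Sum.inl)) (Sum.elim y (w ∘ Sum.inr))) := by
    have := hw.comp (Sum.elim (Sum.elim (Sum.inl ∘ Sum.inl) (Sum.inr ∘ Sum.inl))
      (Sum.elim (Sum.inl ∘ Sum.inr) (Sum.inr ∘ Sum.inr)))
    simp only [Sum.comp_elim] at this
    exact this
  have swap : ∀ {p q : ζ → M} {v v' : α → M}, Eqv L ∅ (Sum.elim p v) (Sum.elim p v') →
      Eqv L (Set.range p) v v' := fun h => eqv_range_iff.2 (by
    have := h.comp Sum.swap
    rwa [Sum.elim_swap, Sum.elim_swap] at this)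
  have e4 : Eqv L (Set.range y') (w ∘ Sum.inl) x := swap (q := y) ((h1.trans e1).symm.trans h5)
  have e5 : Eqv L (Set.range y) (w ∘ Sum.inr) d := swap (q := y) ((h2.trans e2).symm.trans h4)
  exact ((h.conj e3).congr_left e4).symm.congr_left e5

/-- A stationary regular type nonorthogonal to a small set from which its base is independent is
nonorthogonal to its conjugates along an indiscernible sequence. -/
theorem no_conj_indisc [Amb L M] [Finite ζ] [Finite α] [Finite β] {f : ℕ → ζ → M} {s : α → M}
    {e : β → M} (hR : Reg L (Set.range (f 0)) s) (hS : Stat L (Set.range (f 0)) s)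
    (hN : Small L N) (hcN : Set.range (f 0) ⊆ N) (hCB : C ⊆ B) (hBN : B ⊆ N)
    (hcB : Ind L C (Set.range (f 0)) B) (hsN : Ind L (Set.range (f 0)) (Set.range s) N)
    (hno : NO L N s B e) (hf : ∀ i j i' j', i < j → i' < j' →
      Eqv L C (Sum.elim (f i) (f j)) (Sum.elim (f i') (f j'))) (i : ℕ) (d : α → M)
    (hd : Eqv L ∅ (Sum.elim (f 0) s) (Sum.elim (f i) d)) :
    NO L (Set.range (f i)) d (Set.range (f 0)) s := by
  have sC : Small L C := hN.mono (hCB.trans hBN)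
  obtain ⟨z, z', u, u', h1, h2, h3, h4, h5, h6⟩ :=
    exists_no_pair hN hcN hCB hBN hcB hsN hno
  obtain ⟨a, ha⟩ := h4.symm.extend sC z
  have ha' : Eqv L C (Sum.elim z z') (Sum.elim a (f 0)) := by
    have := ha.comp Sum.swap
    rwa [Sum.elim_swap, Sum.elim_swap] at this
  obtain ⟨b, hb0, hbi⟩ := exists_common_conj sC hf (h5.conj_pair ha' subset_rfl) i
  have hb : Eqv L C (f 0) b :=
    h3.trans ((ha'.comp Sum.inl).trans (hb0.comp Sum.inl))
  obtain ⟨x, hx⟩ := (hb.mono (Set.empty_subset C)).extend Small.empty s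
  have n1 := h6.transfer h1 h2 ((ha'.trans hbi).mono (Set.empty_subset C)) hd hx
  have n2 := h6.transfer h1 h2 ((ha'.trans hb0).mono (Set.empty_subset C)) (Eqv.refl _) hx
  exact n1.trans (hR.conj hx) (hS.conj hx) n2.symm

theorem IndiscOver.pair {m : ℕ} {f : ℕ → Fin m → M} (hf : IndiscOver (L := L) C f)
    (i j i' j' : ℕ) (h : i < j) (h' : i' < j') :
    Eqv L C (Sum.elim (f i) (f j)) (Sum.elim (f i') (f j')) := by
  have key : ∀ i j : ℕ, i < j → StrictMono ![i, j] := fun i j h => by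
    refine Fin.strictMono_iff_lt_succ.2 fun n => ?_
    fin_cases n
    exact h
  have h1 := (sameTypeOver_iff.1 (hf 2 ![i, j] ![i', j'] (key _ _ h) (key _ _ h'))).comp
    (Sum.elim (fun n => (0, n)) fun n => (1, n))
  rwa [Sum.comp_elim, Sum.comp_elim] at h1

end Transfer

/-! ### Steinitz exchange -/

theorem card_le_of_exchange {X : Type*} [DecidableEq X] {cl : Finset X → X → Prop}
    (tr : ∀ S T g, (∀ s ∈ S, s ∈ T ∨ cl T s) → cl S g → cl T g)
    (ex : ∀ S g h, cl (insert h S) g → ¬ cl S g → cl (insert g S) h) (n : ℕ) :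
    ∀ (t : ℕ → X) (S J : Finset X), (∀ j < n, ¬ cl (S ∪ (Finset.range j).image t) (t j)) →
      (∀ j < n, cl (S ∪ J) (t j)) → n ≤ J.card := by
  induction n with
  | zero => exact fun _ _ J _ _ => Nat.zero_le _
  | succ n ih =>
    classical
    intro t S J h1 h2
    have mono : ∀ S T g, S ⊆ T → cl S g → cl T g := fun S T g hST =>
      tr S T g fun s hs => Or.inl (hST hs)
    have h0 : ¬ cl S (t 0) := by simpa using h1 0 (Nat.succ_pos n)
    obtain ⟨K, hK, hmin⟩ : ∃ K, K ⊆ J ∧ cl (S ∪ K) (t 0) ∧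
        ∀ K' ⊂ K, ¬ cl (S ∪ K') (t 0) := by
      obtain ⟨K, hK⟩ := (J.powerset.filter fun K => cl (S ∪ K) (t 0)).exists_minimal
        ⟨J, by simpa using h2 0 (Nat.succ_pos n)⟩
      simp only [Minimal, Finset.mem_filter, Finset.mem_powerset] at hK
      exact ⟨K, hK.1.1, hK.1.2, fun K' hK' hc => hK'.2 (hK.2 ⟨hK'.1.trans hK.1.1, hc⟩ hK'.1)⟩
    obtain ⟨hKc, hmin⟩ := hmin
    obtain ⟨x, hx⟩ : K.Nonempty := by
      rw [Finset.nonempty_iff_ne_empty]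
      rintro rfl
      exact h0 (by simpa using hKc)
    have hxcl : cl (insert (t 0) (S ∪ K.erase x)) x := by
      refine ex _ _ _ (mono _ _ _ ?_ hKc) (hmin _ (Finset.erase_ssubset hx))
      intro y hy
      by_cases hyx : y = x
      · exact hyx ▸ Finset.mem_insert_self _ _
      · rcases Finset.mem_union.1 hy with hy | hy
        · exact Finset.mem_insert_of_mem (Finset.mem_union_left _ hy)
        · exact Finset.mem_insert_of_mem (Finset.mem_union_right _ (Finset.mem_erase.2 ⟨hyx, hy⟩))
    have h3 := ih (fun j => t (j + 1)) (insert (t 0) S) (J.erase x) ?_ ?_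
    · rw [Finset.card_erase_of_mem (hK hx)] at h3
      have := Finset.card_pos.2 ⟨x, hK hx⟩
      omega
    · intro j hj hc
      refine h1 (j + 1) (by omega) (mono _ _ _ ?_ hc)
      intro y hy
      simp only [Finset.mem_union, Finset.mem_insert, Finset.mem_image, Finset.mem_range] at hy ⊢
      rcases hy with (rfl | hy) | ⟨i, hi, rfl⟩
      · exact Or.inr ⟨0, by omega, rfl⟩
      · exact Or.inl hy
      · exact Or.inr ⟨i + 1, by omega, rfl⟩
    · intro j hj
      refine tr _ _ _ (fun y hy => ?_) (h2 (j + 1) (by omega))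
      by_cases hyx : y = x
      · rw [hyx]
        refine Or.inr (mono _ _ _ ?_ hxcl)
        rw [Finset.insert_union]
        exact Finset.insert_subset_insert _ (Finset.union_subset_union subset_rfl
          (Finset.erase_subset_erase _ hK))
      · refine Or.inl ?_
        rcases Finset.mem_union.1 hy with hy | hy
        · exact Finset.mem_union_left _ (Finset.mem_insert_of_mem hy)
        · exact Finset.mem_union_right _ (Finset.mem_erase.2 ⟨hyx, hy⟩)

/-! ### The pregeometry of a class of nonorthogonal regular types -/

section Pregeometry

variable {α β γ ι ζ : Type} {A B C D E F X Y Z Z' N : Set M}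

/-- A realization, with base in `Y`, of a regular stationary type nonorthogonal to
`tp(h / X)`. -/
structure RegElt (L : FirstOrder.Language.{u, u}) {M : Type u} [L.Structure M] [Amb L M]
    (X : Set M) {γ : Type} (h : γ → M) (Y : Set M) where
  n : ℕ
  base : Set M
  val : Fin n → M
  sub : base ⊆ Y
  reg : Reg L base val
  stat : Stat L base val
  no : NO L base val X h

/-- The set `Y` together with the given tuples. -/
def RegElt.span [Amb L M] {h : γ → M} (S : Set (RegElt L X h Y)) : Set M :=
  Y ∪ ⋃ s ∈ S, Set.range s.val

/-- `g` depends on `S` over `Y`. -/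
def RegElt.Dep [Amb L M] {h : γ → M} (S : Finset (RegElt L X h Y)) (g : RegElt L X h Y) : Prop :=
  ¬ Ind L g.base (Set.range g.val) (RegElt.span (S : Set (RegElt L X h Y)))

theorem RegElt.span_small [Amb L M] {h : γ → M} (hY : Small L Y)
    (S : Finset (RegElt L X h Y)) : Small L (RegElt.span (S : Set (RegElt L X h Y))) :=
  hY.union (Small.of_countable (S.countable_toSet.biUnion fun _ _ => Set.countable_range _))

theorem RegElt.no_pair [Amb L M] [Finite γ] {h : γ → M} (hR : Reg L X h) (hS : Stat L X h)
    (g g' : RegElt L X h Y) : NO L g.base g.val g'.base g'.val :=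
  g.no.trans hR hS g'.no.symm

theorem RegElt.ind_of_dep [Amb L M] [Finite γ] {h : γ → M} (hR : Reg L X h) (hS : Stat L X h)
    (hE : Small L E) (hYE : Y ⊆ E) {g : RegElt L X h Y} (hg : Ind L g.base (Set.range g.val) E)
    (R : Set (RegElt L X h Y))
    (hdep : ∀ s ∈ R, Set.range s.val ⊆ E ∨ ¬ Ind L s.base (Set.range s.val) E) :
    Ind L g.base (Set.range g.val) (E ∪ ⋃ s ∈ R, Set.range s.val) := by
  have hgE : g.base ⊆ E := g.sub.trans hYE
  refine Ind.trans hE hgE hg (ind_of_step hE R (fun s => Set.range s.val)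
    (fun s _ => Small.range _) fun D hD hED hI s hs => ?_)
  rcases hdep s hs with h1 | h1
  · exact ind_self (h1.trans hED) hD
  · have hnf : NF L g.base g.val E g.val := ⟨Eqv.refl _, hg⟩
    exact (g.no_pair hR hS s).ind g.reg g.stat s.reg hD (hgE.trans hED)
      ((s.sub.trans hYE).trans hED) (hnf.extend hE hgE hI) (Eqv.refl _)
      fun h2 => h1 (h2.down hED)

theorem RegElt.dep_trans [Amb L M] [Finite γ] {h : γ → M} (hY : Small L Y) (hR : Reg L X h)
    (hS : Stat L X h) (S T : Finset (RegElt L X h Y)) (g : RegElt L X h Y)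
    (hST : ∀ s ∈ S, s ∈ T ∨ RegElt.Dep T s) (hg : RegElt.Dep S g) : RegElt.Dep T g := by
  intro hI
  have key := RegElt.ind_of_dep hR hS (RegElt.span_small hY T) Set.subset_union_left hI
    (S : Set (RegElt L X h Y)) fun s hs => (hST s hs).imp (fun hs' =>
      (Set.subset_biUnion_of_mem (u := fun s : RegElt L X h Y => Set.range s.val)
        (Finset.mem_coe.2 hs')).trans Set.subset_union_right) id
  exact hg (key.down (Set.union_subset_union_left _ Set.subset_union_left))

theorem RegElt.dep_exchange [Amb L M] {h : γ → M} [DecidableEq (RegElt L X h Y)]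
    (hY : Small L Y) (S : Finset (RegElt L X h Y)) (g g' : RegElt L X h Y)
    (h1 : RegElt.Dep (insert g' S) g) (h2 : ¬ RegElt.Dep S g) : RegElt.Dep (insert g S) g' := by
  have hsp : ∀ g : RegElt L X h Y, RegElt.span ((insert g S : Finset _) : Set (RegElt L X h Y)) =
      RegElt.span (S : Set (RegElt L X h Y)) ∪ Set.range g.val := fun g => by
    rw [RegElt.span, RegElt.span, Finset.coe_insert, Set.biUnion_insert, Set.union_assoc,
      Set.union_comm (Set.range g.val)]
  intro hI
  rw [RegElt.Dep, hsp] at h1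
  rw [hsp] at hI
  have sS := RegElt.span_small hY S
  have hg' : g'.base ⊆ RegElt.span (S : Set (RegElt L X h Y)) :=
    g'.sub.trans Set.subset_union_left
  have hg : g.base ⊆ RegElt.span (S : Set (RegElt L X h Y)) :=
    g.sub.trans Set.subset_union_left
  exact h1 (Ind.trans sS hg (not_not.1 h2)
    ((hI.up hg' Set.subset_union_left Set.subset_union_right).symm sS))

/-- An independent sequence depending on a finite set has length at most its cardinality. -/
theorem RegElt.le_card [Amb L M] [Finite γ] {h : γ → M} (hY : Small L Y) (hR : Reg L X h)
    (hS : Stat L X h) (n : ℕ) (t : ℕ → RegElt L X h Y) (J : Finset (RegElt L X h Y))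
    (h1 : ∀ j < n, Ind L (t j).base (Set.range (t j).val)
      (Y ∪ ⋃ m ∈ Set.Iio j, Set.range (t m).val))
    (h2 : ∀ j < n, RegElt.Dep J (t j)) : n ≤ J.card := by
  classical
  refine card_le_of_exchange (RegElt.dep_trans hY hR hS) (RegElt.dep_exchange hY) n t ∅ J
    (fun j hj => not_not.2 ?_) (by simpa using h2)
  refine (h1 j hj).down (Set.union_subset_union_right _ (Set.iUnion₂_subset fun s hs => ?_))
  simp only [Finset.empty_union, Finset.coe_image, Finset.coe_range] at hs
  obtain ⟨m, hm, rfl⟩ := hs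
  exact Set.subset_biUnion_of_mem (u := fun m => Set.range (t m).val) hm

end Pregeometry

/-! ### Finite bases for the copies of a regular type inside a homogeneous set -/

section Copies

variable {α β γ ι ζ : Type} {A B C D E F X Y Z Z' N : Set M} {n : ℕ}

/-- Types of finite tuples over finite tuples of `N` are realized in `N`. -/
def Homog (L : FirstOrder.Language.{u, u}) {M : Type u} [L.Structure M] (N : Set M) : Prop :=
  ∀ {ι κ : Type} [Finite ι] [Finite κ] (x y : ι → M) (z : κ → M), (∀ i, y i ∈ N) →
    Eqv L ∅ x y → ∃ w : κ → M, (∀ i, w i ∈ N) ∧ Eqv L ∅ (Sum.elim x z) (Sum.elim y w)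

/-- The tuples `d` in `N` for which `z, d` realizes the type of `c, s`. -/
def copies (L : FirstOrder.Language.{u, u}) {M : Type u} [L.Structure M] (c : ζ → M)
    (s : Fin n → M) (z : ζ → M) (N : Set M) : Set (Fin n → M) :=
  {d | (∀ i, d i ∈ N) ∧ Eqv L ∅ (Sum.elim c s) (Sum.elim z d)}

/-- A copy of a regular stationary type, as an element of the pregeometry. -/
def RegElt.ofEqv [Amb L M] [Finite ζ] {c : ζ → M} {s : Fin n → M}
    (hR : Reg L (Set.range c) s) (hS : Stat L (Set.range c) s) {z : ζ → M} (hz : Set.range z ⊆ Y)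
    (d : Fin n → M) (e : Eqv L ∅ (Sum.elim c s) (Sum.elim z d))
    (hno : NO L (Set.range z) d (Set.range c) s) : RegElt L (Set.range c) s Y where
  n := n
  base := Set.range z
  val := d
  sub := hz
  reg := hR.conj e
  stat := hS.conj e
  no := hno

theorem exists_span_or_seq [Amb L M] [Finite ζ] {c : ζ → M} {s : Fin n → M}
    (hR : Reg L (Set.range c) s) (hS : Stat L (Set.range c) s) {z : ζ → M} (hz : Set.range z ⊆ Y)
    (hno : ∀ d, Eqv L ∅ (Sum.elim c s) (Sum.elim z d) → NO L (Set.range z) d (Set.range c) s)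
    (N : Set M) :
    (∃ J : Finset (RegElt L (Set.range c) s Y), ∀ d ∈ copies L c s z N,
      ¬ Ind L (Set.range z) (Set.range d) (RegElt.span (J : Set (RegElt L (Set.range c) s Y)))) ∨
    ∃ g : ℕ → Fin n → M, ∀ j, g j ∈ copies L c s z N ∧
      Ind L (Set.range z) (Set.range (g j)) (Y ∪ ⋃ m ∈ Set.Iio j, Set.range (g m)) := by
  classical
  refine or_iff_not_imp_left.2 fun hcon => ?_
  push Not at hcon
  let mk : copies L c s z N → RegElt L (Set.range c) s Y := fun d =>
    RegElt.ofEqv hR hS hz d.1 d.2.2 (hno _ d.2.2)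
  have key := Benign.exists_seq (fun (T : Set (copies L c s z N)) d =>
    Ind L (Set.range z) (Set.range d.1) (Y ∪ ⋃ t ∈ T, Set.range t.1)) fun T hT => by
    obtain ⟨d, hd, hI⟩ := hcon (hT.toFinset.image mk)
    refine ⟨⟨d, hd⟩, hI.down (Set.union_subset_union_right _ (Set.iUnion₂_subset fun t ht => ?_))⟩
    exact Set.subset_biUnion_of_mem (u := fun s : RegElt L (Set.range c) s Y => Set.range s.val)
      (show mk t ∈ ((hT.toFinset.image mk : Finset _) : Set _) from
        Finset.mem_coe.2 (Finset.mem_image_of_mem _ (hT.mem_toFinset.2 ht)))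
  obtain ⟨g, hg⟩ := key
  simp only [Set.biUnion_image] at hg
  exact ⟨fun j => (g j).1, fun j => ⟨(g j).2, hg j⟩⟩

/-- If the dimension of the type in `N` is finite, its copies over `c` have a finite basis. -/
theorem exists_span_of_dim [Amb L M] [Finite ζ] {c : ζ → M} {s : Fin n → M}
    (hR : Reg L (Set.range c) s) (hS : Stat L (Set.range c) s) (hN : Small L N)
    (hcB : Set.range c ⊆ B) (hBY : B ⊆ Y) (hBN : B ⊆ N)
    (hno : ∀ d, Eqv L ∅ (Sum.elim c s) (Sum.elim c d) → NO L (Set.range c) d (Set.range c) s)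
    (hsN : Ind L (Set.range c) (Set.range s) N)
    (hdim : ¬ ∃ g : ℕ → Fin n → M, ∀ j, (∀ i, g j i ∈ N) ∧ Eqv L B s (g j) ∧
      Ind L B (Set.range (g j)) (⋃ m ∈ Set.Iio j, Set.range (g m))) :
    ∃ J : Finset (RegElt L (Set.range c) s Y), ∀ d ∈ copies L c s c N,
      ¬ Ind L (Set.range c) (Set.range d) (RegElt.span (J : Set (RegElt L (Set.range c) s Y))) := by
  refine (exists_span_or_seq hR hS (hcB.trans hBY) hno N).resolve_right ?_
  rintro ⟨g, hg⟩
  refine hdim ⟨g, fun j => ⟨(hg j).1.1, ?_, ?_⟩⟩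
  · refine hS B (hN.mono hBN) hcB _ _ ⟨Eqv.refl _, hsN.down hBN⟩ ⟨?_, ?_⟩
    · rw [eqv_range_iff]
      have := (hg j).1.2.comp Sum.swap
      simpa only [Sum.elim_swap] using this
    · exact (hg j).2.down (hBY.trans Set.subset_union_left)
  · exact (hg j).2.up hcB (hBY.trans Set.subset_union_left) Set.subset_union_right

/-- Copies over another base `z` also have a finite basis, as they depend on copies over `c`. -/
theorem exists_span [Amb L M] [Finite ζ] {c : ζ → M} {s : Fin n → M}
    (hR : Reg L (Set.range c) s) (hS : Stat L (Set.range c) s) (hN : Small L N) (hH : Homog L N)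
    (hcB : Set.range c ⊆ B) (hBY : B ⊆ Y) (hYN : Y ⊆ N)
    (hno0 : ∀ d, Eqv L ∅ (Sum.elim c s) (Sum.elim c d) → NO L (Set.range c) d (Set.range c) s)
    (hsN : Ind L (Set.range c) (Set.range s) N)
    (hdim : ¬ ∃ g : ℕ → Fin n → M, ∀ j, (∀ i, g j i ∈ N) ∧ Eqv L B s (g j) ∧
      Ind L B (Set.range (g j)) (⋃ m ∈ Set.Iio j, Set.range (g m)))
    {z : ζ → M} (hz : Set.range z ⊆ Y)
    (hno : ∀ d, Eqv L ∅ (Sum.elim c s) (Sum.elim z d) → NO L (Set.range z) d (Set.range c) s) :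
    ∃ J : Finset (RegElt L (Set.range c) s Y), ∀ d ∈ copies L c s z N,
      ¬ Ind L (Set.range z) (Set.range d) (RegElt.span (J : Set (RegElt L (Set.range c) s Y))) := by
  refine (exists_span_or_seq hR hS hz hno N).resolve_right ?_
  rintro ⟨g, hg⟩
  have hcY : Set.range c ⊆ Y := hcB.trans hBY
  have hY : Small L Y := hN.mono hYN
  have hgN : ∀ j, Set.range (g j) ⊆ N := fun j => Set.range_subset_iff.2 (hg j).1.1
  obtain ⟨D, sD, hzD, hcD, v, v', nv, nv', hvv⟩ := hno (g 0) (hg 0).1.2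
  obtain ⟨κ, _, e, heD, hFe, -, he⟩ := exists_tuple_not_ind sD hvv
    ((Set.finite_range z).union (Set.finite_range c)) (Set.union_subset hzD hcD)
  have hze : Set.range z ⊆ Set.range e := Set.subset_union_left.trans hFe
  have hce : Set.range c ⊆ Set.range e := Set.subset_union_right.trans hFe
  obtain ⟨fz, hfz⟩ := exists_comp hze
  obtain ⟨fc, hfc⟩ := exists_comp hce
  replace nv := nv.restrict heD
  replace nv' := nv'.restrict heD
  obtain ⟨e', he'N, hee⟩ := hH (Sum.elim z c) (Sum.elim z c) e
    (by rintro (i | i); exacts [hYN (hz ⟨i, rfl⟩), hYN (hcY ⟨i, rfl⟩)]) (Eqv.refl _)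
  obtain ⟨w, hw⟩ := hee.extend Small.empty (Sum.elim v v')
  let v₁ := w ∘ Sum.inl
  let v₁' := w ∘ Sum.inr
  have hz' : z = e' ∘ fz := hee.eq_comp (Sum.inl ∘ Sum.inl) Sum.inr fz hfz
  have hc' : c = e' ∘ fc := hee.eq_comp (Sum.inl ∘ Sum.inr) Sum.inr fc hfc
  have hze' : Set.range z ⊆ Set.range e' := by
    rw [hz']
    exact range_comp_subset _ _
  have hce' : Set.range c ⊆ Set.range e' := by
    rw [hc']
    exact range_comp_subset _ _
  have nv₁ : NF L (Set.range z) (g 0) (Set.range e') v₁ := by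
    refine ⟨nv.1.trans ?_, ?_⟩
    · rw [eqv_range_iff]
      have := hw.comp (Sum.elim (Sum.inr ∘ Sum.inl) (Sum.inl ∘ Sum.inl ∘ Sum.inl))
      simp only [Sum.comp_elim] at this
      exact this
    · exact Ind.conj_base hw (Sum.inl ∘ Sum.inl ∘ Sum.inl) (Sum.inr ∘ Sum.inl)
        (Sum.inl ∘ Sum.inr) nv.2
  have hvv₁ : ¬ Ind L (Set.range e') (Set.range v₁) (Set.range v₁') := fun hI =>
    he (Ind.conj_base hw.symm (Sum.inl ∘ Sum.inr) (Sum.inr ∘ Sum.inl) (Sum.inr ∘ Sum.inr) hI)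
  have hcv : Eqv L ∅ (Sum.elim c s) (Sum.elim c v₁') := by
    have h1 := (eqv_range_iff.1 nv'.1).comp Sum.swap
    simp only [Sum.elim_swap] at h1
    have h2 := hw.comp (Sum.elim (Sum.inl ∘ Sum.inl ∘ Sum.inr) (Sum.inr ∘ Sum.inr))
    simp only [Sum.comp_elim] at h2
    exact h1.trans h2
  obtain ⟨B₀, hB₀, fB₀, hI₀⟩ := exists_finite_base (L := L) e' (Y ∪ ⋃ m, Set.range (g m))
  obtain ⟨n₀, hn₀⟩ : ∃ n₀, B₀ ⊆ Y ∪ ⋃ m ∈ Set.Iio n₀, Set.range (g m) := by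
    have h1 : B₀ ⊆ ⋃ j, (Y ∪ ⋃ m ∈ Set.Iio j, Set.range (g m)) := fun x hx => by
      rcases hB₀ hx with hx | hx
      · exact Set.mem_iUnion.2 ⟨0, Or.inl hx⟩
      · obtain ⟨m, hm⟩ := Set.mem_iUnion.1 hx
        exact Set.mem_iUnion.2 ⟨m + 1, Or.inr (Set.mem_biUnion (Set.mem_Iio.2 m.lt_succ_self) hm)⟩
    have h2 : Monotone fun j => Y ∪ ⋃ m ∈ Set.Iio j, Set.range (g m) := fun i j hij =>
      Set.union_subset_union_right _ (Set.biUnion_subset_biUnion_left (Set.Iio_subset_Iio hij))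
    choose! φ hφ using fun x (hx : x ∈ B₀) => Set.mem_iUnion.1 (h1 hx)
    obtain ⟨n₀, hn₀⟩ := (fB₀.image φ).bddAbove
    exact ⟨n₀, fun x hx => h2 (hn₀ ⟨x, hx, rfl⟩) (hφ x hx)⟩
  let W : ℕ → Set M := fun j => Y ∪ ⋃ m ∈ Set.Iio (n₀ + j), Set.range (g m)
  have hWN : ∀ j, W j ⊆ N := fun j => Set.union_subset hYN (Set.iUnion₂_subset fun m _ => hgN m)
  have hWall : ∀ j, W j ⊆ Y ∪ ⋃ m, Set.range (g m) := fun j =>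
    Set.union_subset_union_right _ (Set.iUnion₂_subset fun m _ => Set.subset_iUnion_of_subset m subset_rfl)
  have hBW : ∀ j, B₀ ⊆ W j := fun j => hn₀.trans (Set.union_subset_union_right _
    (Set.biUnion_subset_biUnion_left (Set.Iio_subset_Iio (Nat.le_add_right _ _))))
  let Y' := Y ∪ Set.range e'
  have hY'N : Y' ⊆ N := Set.union_subset hYN (Set.range_subset_iff.2 he'N)
  have hgW : ∀ j, Ind L (Set.range z) (Set.range (g (n₀ + j))) (W j ∪ Set.range e') := fun j => by
    refine Ind.trans (hN.mono (hWN j)) (hz.trans Set.subset_union_left) (hg (n₀ + j)).2 ?_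
    refine Ind.symm (hN.mono (hWN j)) (hI₀.up (hBW j) (hWall j) ?_)
    exact (Set.subset_iUnion (fun m => Set.range (g m)) _).trans Set.subset_union_right
  have hd : ∀ j, ∃ d ∈ copies L c s c N,
      ¬ Ind L (Set.range e') (Set.range (g (n₀ + j))) (Set.range d) := fun j => by
    have ng : NF L (Set.range z) (g 0) (Set.range e') (g (n₀ + j)) := by
      refine ⟨?_, (hgW j).down Set.subset_union_right⟩
      rw [eqv_range_iff]
      have h1 := ((hg 0).1.2.symm.trans (hg (n₀ + j)).1.2).comp Sum.swap
      simpa only [Sum.elim_swap] using h1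
    have h2 := hS.conj (hg 0).1.2 _ (Small.range e') hze' _ _ nv₁ ng
    obtain ⟨d, hdN, hd⟩ := hH _ _ v₁' (by
      rintro (i | i)
      exacts [(hg _).1.1 i, he'N i]) (eqv_range_iff.1 h2)
    refine ⟨d, ⟨hdN, hcv.trans ?_⟩, fun hI => hvv₁ ?_⟩
    · have := hd.comp (Sum.elim (Sum.inl ∘ Sum.inr ∘ fc) Sum.inr)
      simp only [Sum.comp_elim] at this
      rw [hc']
      exact this
    · exact Ind.conj_base hd.symm (Sum.inl ∘ Sum.inr) (Sum.inl ∘ Sum.inl) Sum.inr hI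
  choose d hd hgd using hd
  obtain ⟨J, hJ⟩ := exists_span_of_dim (Y := Y') hR hS hN hcB (hBY.trans Set.subset_union_left)
    (hBY.trans hYN) hno0 hsN hdim
  let G : ℕ → RegElt L (Set.range c) s Y' := fun j =>
    RegElt.ofEqv hR hS (hz.trans Set.subset_union_left) (g (n₀ + j)) (hg _).1.2 (hno _ (hg _).1.2)
  let H : ℕ → RegElt L (Set.range c) s Y' := fun j =>
    RegElt.ofEqv hR hS (hcY.trans Set.subset_union_left) (d j) (hd j).2 (hno0 _ (hd j).2)
  have key := RegElt.le_card (hN.mono hY'N) hR hS (J.card + 1) G J (fun j _ => ?_) fun j _ => ?_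
  · omega
  · refine (hgW j).down (Set.union_subset (Set.union_subset_union_left _ Set.subset_union_left) ?_)
    refine Set.iUnion₂_subset fun m hm => ?_
    refine Set.Subset.trans ?_ (Set.subset_union_right.trans Set.subset_union_left)
    exact Set.subset_biUnion_of_mem (u := fun m => Set.range (g m))
      (Set.mem_Iio.2 (Nat.add_lt_add_left (Set.mem_Iio.1 hm) n₀))
  · refine RegElt.dep_trans (hN.mono hY'N) hR hS {H j} J (G j) (fun t ht => ?_) fun hI => ?_
    · rw [Finset.mem_singleton.1 ht]
      exact Or.inr (hJ _ (hd j))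
    · refine hgd j (hI.up hze' ?_ ?_)
      · exact Set.subset_union_right.trans Set.subset_union_left
      · refine Set.Subset.trans ?_ Set.subset_union_right
        exact Set.subset_biUnion_of_mem (u := fun s : RegElt L (Set.range c) s Y' => Set.range s.val)
          (show H j ∈ (({H j} : Finset _) : Set _) by simp)

end Copies

/-! ### Algebraic closure -/

section Acl

variable {α β γ ι ζ : Type} {A B C D E F X Y Z Z' N W : Set M} {n : ℕ}

theorem mem_aclSet_iff {x : M} : x ∈ aclSet (L := L) C ↔
    ∃ Z : (Fin 1 → M) → Prop, Dfb L C Z ∧ Z ![x] ∧ {y | Z ![y]}.Finite := by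
  refine ⟨?_, ?_⟩
  · rintro ⟨φ, h1, h2⟩
    obtain ⟨s, t, ψ, h⟩ := exists_restrict (M := M) φ
    refine ⟨fun v => φ.Realize (Sum.elim v Subtype.val), ?_, h1, h2⟩
    let e := t.equivFin
    refine ⟨Fin t.card, inferInstance, fun i => (e.symm i).1.1,
      ψ.relabel (Sum.map Subtype.val e), fun i => (e.symm i).1.2, fun v => ?_⟩
    dsimp only
    rw [h, Formula.realize_relabel, Sum.elim_comp_map]
    apply iff_of_eq
    congr 2
    ext i
    simp
  · rintro ⟨Z, ⟨κ, _, d, φ, hd, hφ⟩, h1, h2⟩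
    have key : ∀ y : M, (φ.relabel (Sum.map id fun i => (⟨d i, hd i⟩ : C))).Realize
        (Sum.elim ![y] Subtype.val) ↔ Z ![y] := fun y => by
      rw [hφ, Formula.realize_relabel, Sum.elim_comp_map]
      rfl
    refine ⟨φ.relabel (Sum.map id fun i => (⟨d i, hd i⟩ : C)), (key x).2 h1, ?_⟩
    simpa only [key] using h2

theorem aclSet_mono (h : C ⊆ D) : aclSet (L := L) C ⊆ aclSet (L := L) D := fun x hx => by
  obtain ⟨Z, h1, h2⟩ := mem_aclSet_iff.1 hx
  exact mem_aclSet_iff.2 ⟨Z, h1.mono h, h2⟩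

theorem subset_aclSet : C ⊆ aclSet (L := L) C := fun x hx => by
  refine mem_aclSet_iff.2 ⟨fun v => v 0 = x, ?_, rfl, ?_⟩
  · exact (Dfb.eq (Sum.inl 0) (Sum.inr ())).inst' (fun _ : Unit => x) fun _ => hx
  · exact (Set.finite_singleton x).subset fun y hy => hy

theorem ElemSubset.aclSet_subset (hN : ElemSubset (L := L) N) (hC : C ⊆ N) :
    aclSet (L := L) C ⊆ N := fun x hx => by
  obtain ⟨Z, h1, h2, h3⟩ := mem_aclSet_iff.1 hx
  obtain ⟨κ, _, d, hd⟩ := exists_tuple (h3.inter_of_left N)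
  by_contra hxN
  obtain ⟨y, hy, hZ, hyd⟩ := hN.exists_mem (P := fun v => Z v ∧ ∀ i, ¬ v 0 = d i)
    ((h1.mono hC).and (Dfb.finAll fun i => Dfb.not
      ((Dfb.eq (Sum.inl 0) (Sum.inr ())).inst' (fun _ : Unit => d i) fun _ =>
        (hd.subset ⟨i, rfl⟩ : d i ∈ _ ∩ N).2)))
    ⟨![x], h2, fun i hi => hxN (by
      have := (hd.subset ⟨i, rfl⟩ : d i ∈ _ ∩ N).2
      rwa [← hi] at this)⟩
  obtain ⟨i, hi⟩ := hd.superset ⟨hZ, hy⟩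
  exact hyd i hi.symm

theorem Ind.acl [Amb L M] (hW : Small L W) (hYW : Y ⊆ W) (h : Ind L Y A W) :
    Ind L Y A (aclSet (L := L) W) :=
  (Ind.trans hW hYW h (ind_acl.symm hW)).down Set.subset_union_right

/-- Algebraicity over parameters and copies in `M` reduces to copies in a homogeneous set. -/
theorem mem_aclSet_of_copies {ζ : Type} [Finite ζ] {c : ζ → M} {s : Fin n → M} {f : ℕ → ζ → M}
    {k : ℕ} (hH : Homog L N) {x : M} (hx : x ∈ N) (hCN : C ⊆ N) (hfC : ∀ i < k, Set.range (f i) ⊆ C)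
    (hxC : x ∈ aclSet (L := L) (C ∪ {y | ∃ (d : Fin n → M) (i : ℕ), i < k ∧
      Eqv L ∅ (Sum.elim c s) (Sum.elim (f i) d) ∧ y ∈ Set.range d}))
    (hCW : C ⊆ W) (hW : ∀ i < k, ∀ d ∈ copies L c s (f i) N, Set.range d ⊆ W) :
    x ∈ aclSet (L := L) W := by
  obtain ⟨Z, hZ, hZx, hfin⟩ := mem_aclSet_iff.1 hxC
  obtain ⟨κ, _, p, Q, hp, hQ, hZQ⟩ := hZ.split
  rw [← Set.empty_union C] at hQ
  obtain ⟨κ', _, a, R, ha, hR, hQR⟩ := hQ.split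
  choose d i hi hd hpd using hp
  choose l hl using hpd
  obtain ⟨w, hwN, hw⟩ := hH (Sum.elim (Sum.elim ![x] a) fun j : κ × ζ => f (i j.1) j.2)
    (Sum.elim (Sum.elim ![x] a) fun j : κ × ζ => f (i j.1) j.2)
    (fun j : κ × Fin n => d j.1 j.2) (by
      rintro ((j | j) | j)
      · rw [Subsingleton.elim j 0]
        exact hx
      · exact hCN (ha j)
      · exact hCN (hfC _ (hi _) ⟨_, rfl⟩)) (Eqv.refl _)
  let p' : κ → M := fun j => w (j, l j)
  have hp' : ∀ j, p' j ∈ W := fun j => by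
    refine hW (i j) (hi j) (fun m => w (j, m)) ⟨fun m => hwN _, ?_⟩ ⟨l j, rfl⟩
    refine (hd j).trans ?_
    have := hw.comp (Sum.elim (fun m => Sum.inl (Sum.inr (j, m))) fun m => Sum.inr (j, m))
    simp only [Sum.comp_elim] at this
    exact this
  have hpp : Eqv L ∅ (Sum.elim (Sum.elim ![x] p) a) (Sum.elim (Sum.elim ![x] p') a) := by
    have := hw.comp (Sum.elim (Sum.elim (fun m => Sum.inl (Sum.inl (Sum.inl m)))
      fun j => Sum.inr (j, l j)) fun m => Sum.inl (Sum.inl (Sum.inr m)))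
    simp only [Sum.comp_elim] at this
    have h2 : p = fun j => d j (l j) := funext fun j => (hl j).symm
    rw [h2]
    exact this
  refine mem_aclSet_iff.2 ⟨fun v => Q (Sum.elim v p'), ?_, ?_, ?_⟩
  · refine Dfb.inst' (hQ.mono ?_) p' hp'
    rw [Set.empty_union]
    exact hCW
  · exact (hQR _).2 ((hpp.iff hR).1 ((hQR _).1 ((hZQ _).1 hZx)))
  · obtain ⟨m, hm⟩ : ∃ m, m = hfin.toFinset.card := ⟨_, rfl⟩
    let P : ((Fin 1 ⊕ κ) ⊕ κ' → M) → Prop := fun v => ∃ u : Fin (m + 1) → M,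
      (∀ i j, i ≠ j → ¬ u i = u j) ∧
        ∀ i, R (Sum.elim (Sum.elim ![u i] (v ∘ Sum.inl ∘ Sum.inr)) (v ∘ Sum.inr))
    have hP : Dfb L ∅ P := by
      refine (Dfb.ex (P := fun w : ((Fin 1 ⊕ κ) ⊕ κ') ⊕ Fin (m + 1) → M =>
        (∀ i j, i ≠ j → ¬ w (Sum.inr i) = w (Sum.inr j)) ∧
          ∀ i, R (w ∘ Sum.elim (Sum.elim (fun _ => Sum.inr i) (Sum.inl ∘ Sum.inl ∘ Sum.inr))
            (Sum.inl ∘ Sum.inr))) (Dfb.and ?_ (Dfb.finAll fun i => hR.comp _))).congr fun v =>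
        exists_congr fun z => and_congr Iff.rfl (forall_congr' fun i => ?_)
      · refine Dfb.finAll fun i => Dfb.finAll fun j => ?_
        by_cases hij : i = j
        · exact (Dfb.eq (Sum.inr i) (Sum.inr i)).congr fun v => by simp [hij]
        · exact (Dfb.eq (Sum.inr i) (Sum.inr j)).not.congr fun v => by simp [hij]
      · apply iff_of_eq
        congr 1
        ext ((j | j) | j)
        · rw [Subsingleton.elim j 0]
          rfl
        · rfl
        · rfl
    by_contra hinf
    have h1 : P (Sum.elim (Sum.elim ![x] p') a) := by
      let u := Set.Infinite.natEmbedding _ hinf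
      refine ⟨fun i => (u i).1, fun i j hij h => hij (Fin.ext (u.injective (Subtype.ext h))),
        fun i => ?_⟩
      exact (hQR _).1 (u i).2
    obtain ⟨u, hu1, hu2⟩ := (hpp.iff hP).2 h1
    have h2 : ∀ i, u i ∈ hfin.toFinset := fun i => by
      rw [Set.Finite.mem_toFinset]
      exact (hZQ _).2 ((hQR _).2 (hu2 i))
    have h3 := Finset.card_le_card_of_injOn u (s := Finset.univ) (fun i _ => h2 i)
      fun i _ j _ h => by_contra fun hij => hu1 i j hij h
    rw [Finset.card_univ, Fintype.card_fin, ← hm] at h3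
    omega

end Acl

/-! ### Bounding the weight -/

section Weight

variable {α β γ ι ζ : Type} {A B C D E F X Y Z Z' N W : Set M} {n : ℕ}

/-- A regular type over `Y` independent from a basis is independent from the span. -/
theorem RegElt.ind_acl_acl [Amb L M] [Finite γ] {h : γ → M} (hR : Reg L X h) (hS : Stat L X h)
    (hY : Small L Y) (hW : Small L W) (hYW : Y ⊆ W) (hA : Small L (aclSet (L := L) W))
    (J : Finset (RegElt L X h Y)) (t : RegElt L X h Y) (htY : t.base = Y)
    (hW' : ∀ x ∈ W, x ∈ Y ∨ ∃ s : RegElt L X h Y, RegElt.Dep J s ∧ x ∈ Set.range s.val)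
    (ht : ¬ RegElt.Dep J t) :
    Ind L Y (Set.range t.val) (aclSet (L := L) (aclSet (L := L) W)) := by
  have h1 := RegElt.ind_of_dep hR hS (RegElt.span_small hY J) Set.subset_union_left (not_not.1 ht)
    {s | RegElt.Dep J s} fun s hs => Or.inr hs
  rw [htY] at h1
  have h2 : Ind L Y (Set.range t.val) W := h1.down fun x hx => by
    rcases hW' x hx with hx | ⟨s, hs, hx⟩
    · exact Or.inl (Or.inl hx)
    · exact Or.inr (Set.mem_biUnion (x := s) hs hx)
  exact (h2.acl hW hYW).acl hA (hYW.trans subset_aclSet)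

theorem card_le_of_indepFamily [Amb L M] [Finite γ] {h : γ → M} (hR : Reg L X h)
    (hS : Stat L X h) (hY : Small L Y) {I : Set (Σ m : ℕ, Fin m → M)}
    (hI : IndepFamily (L := L) Y I) (J : Finset (RegElt L X h Y))
    (hJ : ∀ t ∈ I, ∃ g : RegElt L X h Y, g.base = Y ∧ Set.range g.val = Set.range t.2 ∧
      RegElt.Dep J g) : #I ≤ J.card := by
  refine Cardinal.card_le_of fun s => ?_
  rcases s.eq_empty_or_nonempty with rfl | ⟨x₀, hx₀⟩
  · simp
  choose G hG1 hG2 hG3 using hJ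
  let e : ℕ → I := fun j => if hj : j < s.card then (s.equivFin.symm ⟨j, hj⟩).1 else x₀
  have he : ∀ j < s.card, ∀ m < s.card, e j = e m → j = m := fun j hj m hm h => by
    simp only [e, hj, hm, dite_true] at h
    simpa using s.equivFin.symm.injective (Subtype.ext h)
  refine RegElt.le_card hY hR hS s.card (fun j => G (e j).1 (e j).2) J (fun j hj => ?_)
    fun j _ => hG3 _ _
  simp only [hG1, hG2]
  by_contra hcon
  refine hI (e j).1 (e j).2 (tupForksOver_of_not_ind hY ?_ Set.subset_union_right hcon)
  refine Set.union_subset Set.subset_union_right (Set.iUnion₂_subset fun m hm => ?_)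
  refine Set.Subset.trans ?_ Set.subset_union_left
  refine Set.subset_biUnion_of_mem (u := fun s : Σ m : ℕ, Fin m → M => Set.range s.2)
    ⟨(e m).2, fun h => ?_⟩
  have := he m (lt_trans hm hj) j hj (Subtype.ext h)
  exact absurd hm (by rw [this]; simp)

end Weight

/-! ### The setup -/

theorem SaturatedIn.of_sum {L' : FirstOrder.Language.{0, 0}} [L'.Structure M] {κ : Cardinal.{u}}
    (h : SaturatedIn (M := M) (L.sum L') κ) : SaturatedIn (M := M) L κ := by
  intro S hS p hp
  have key : ∀ (φ : L.Formula (Fin 1 ⊕ S)) (v : Fin 1 ⊕ S → M),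
      ((LHom.sumInl : L →ᴸ L.sum L').onFormula φ).Realize v ↔ φ.Realize v := fun φ v =>
    LHom.realize_onFormula _ φ
  obtain ⟨x, hx⟩ := h S hS ((LHom.sumInl : L →ᴸ L.sum L').onFormula '' p) fun fs hfs => by
    classical
    obtain ⟨gs, hgs, rfl⟩ := Finset.subset_set_image_iff.1 hfs
    obtain ⟨x, hx⟩ := hp gs hgs
    refine ⟨x, fun φ hφ => ?_⟩
    obtain ⟨ψ, hψ, rfl⟩ := Finset.mem_image.1 hφ
    exact (key ψ _).2 (hx ψ hψ)
  exact ⟨x, fun φ hφ => (key φ _).1 (hx _ ⟨φ, hφ, rfl⟩)⟩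

theorem NF.of_base [Amb L M] {α : Type} {Z N E : Set M} {u a : α → M} (hN : Small L N)
    (hZN : Z ⊆ N) (hI : Ind L Z (Set.range u) N) (h : NF L N u E a) : NF L Z u E a :=
  ⟨h.1.mono hZN, (Ind.trans hN hZN (hI.conj_left h.1 hZN subset_rfl) h.2).down
    Set.subset_union_right⟩

theorem Stat.of_base [Amb L M] {α : Type} {Z N : Set M} {u : α → M} (hN : Small L N)
    (hZN : Z ⊆ N) (hI : Ind L Z (Set.range u) N) (h : Stat L Z u) : Stat L N u :=
  fun E hE hNE _ _ ha hb => h E hE (hZN.trans hNE) _ _ (ha.of_base hN hZN hI) (hb.of_base hN hZN hI)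

theorem NO.of_base [Amb L M] {α β : Type} {Y Z N : Set M} {t : β → M} {u : α → M} (hN : Small L N)
    (hZN : Z ⊆ N) (hI : Ind L Z (Set.range u) N) (h : NO L Y t N u) : NO L Y t Z u := by
  obtain ⟨D, h1, h2, h3, v, v', h4, h5, h6⟩ := h
  exact ⟨D, h1, h2, hZN.trans h3, v, v', h4, h5.of_base hN hZN hI, h6⟩

theorem OneSat.homog [Nonempty M] {N : Set M} {μ : Cardinal.{u}} (h : OneSat L N μ)
    (hμ : ℵ₀ < μ) : Homog L N := fun _ _ z hy hxy =>
  h.extend hμ (Set.empty_subset _) (by simpa using Cardinal.aleph0_pos.trans hμ) hy hxy z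

namespace WSetup

variable (S : WSetup L M)

theorem aleph0_lt : ℵ₀ < S.κ := by
  have h1 : cardL L < S.κ := by
    conv_rhs => rw [← S.pow]
    exact Cardinal.cantor' _ (Cardinal.one_lt_aleph0.trans_le S.reg.aleph0_le)
  exact le_sup_right.trans_lt h1

theorem kc : Kc (L := L) S.κ S.A S.a S.Ma S.Astar := S.witness.k2.1.ka

/-- The ambient model of the setup is saturated above the size of `Ma`. -/
@[reducible] def amb : Amb L M where
  card := S.κ
  aleph0_le := S.reg.aleph0_le
  nonempty := ⟨S.a⟩
  oneSat := by
    let _ : unaryLang.Structure M := unaryStructure S.A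
    have h : SaturatedIn (M := M) (L.sum unaryLang) (Order.succ S.κ) := S.pairSat
    exact h.of_sum.oneSat
  exists_not_hasTree := by
    have : Nonempty M := ⟨S.a⟩
    exact fun {α} _ σ hσ => S.superstable.not_hasTree σ hσ

theorem homog : Homog L S.Ma := by
  have : Nonempty M := ⟨S.a⟩
  intro ι κ _ _ x y z hy hxy
  exact (S.kc.sat.oneSat S.kc.elem).homog S.aleph0_lt x y z hy hxy

theorem small_Ma : letI := S.amb; Small L S.Ma := S.kc.cardM₁

theorem range_c : Set.range S.c ⊆ S.Ma := Set.range_subset_iff.2 S.hc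

theorem ind_dstar : Ind L (Set.range S.c) (Set.range S.dstar) S.Ma := by
  let _ := S.amb
  exact (not_tupForksOver_iff S.small_Ma S.range_c).1 S.nfP

theorem stat : letI := S.amb; Stat L (Set.range S.c) S.dstar := by
  let _ := S.amb
  exact S.statP.stat

theorem regular : letI := S.amb; Reg L (Set.range S.c) S.dstar := by
  let _ := S.amb
  exact Reg.restrict S.small_Ma S.regularP.reg S.stat S.range_c S.ind_dstar

theorem acl_Astar : aclSet (L := L) S.Astar ⊆ S.Ma := S.kc.elem.aclSet_subset S.kc.sub

theorem ind_c : Ind L S.C (Set.range S.c) (aclSet (L := L) S.Astar) := by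
  let _ := S.amb
  have h1 : Small L S.Astar := S.small_Ma.mono S.kc.sub
  have h2 := (tupIndepOver_iff (h1.mono S.hCsub) h1).1 S.cIndep
  exact h2.acl h1 S.hCsub

/-- The copies of `tp(dstar / c)` over the members of the sequence are nonorthogonal to it. -/
theorem no_cseq (i : ℕ) (d : Fin S.nd → M)
    (hd : Eqv L ∅ (Sum.elim S.c S.dstar) (Sum.elim (S.cseq i) d)) :
    let _ := S.amb; NO L (Set.range (S.cseq i)) d (Set.range S.c) S.dstar := by
  let _ := S.amb
  have h1 := S.nonorthAstar
  unfold TypeOrthSet at h1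
  push Not at h1
  obtain ⟨m, e, he⟩ := h1
  have h2 := no_of_not_typesOrthogonal S.small_Ma (S.small_Ma.mono S.acl_Astar)
    (S.stat.of_base S.small_Ma S.range_c S.ind_dstar) he
  have key := no_conj_indisc (L := L) (f := S.cseq) (s := S.dstar) (e := e) (N := S.Ma) (C := S.C)
    (B := aclSet (L := L) S.Astar)
  rw [S.cseq0] at key
  exact key S.regular S.stat S.small_Ma S.range_c (S.hCsub.trans subset_aclSet) S.acl_Astar
    S.ind_c S.ind_dstar h2
    (fun i j i' j' h h' => (S.indisc.pair i j i' j' h h').mono subset_aclSet) i d hd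

theorem not_dim (hdim : DimFinite (L := L) (S.Astar ∪ Set.range S.c) S.dstar S.Ma) :
    ¬ ∃ g : ℕ → Fin S.nd → M, ∀ j, (∀ i, g j i ∈ S.Ma) ∧
      Eqv L (S.Astar ∪ Set.range S.c) S.dstar (g j) ∧
      Ind L (S.Astar ∪ Set.range S.c) (Set.range (g j)) (⋃ m ∈ Set.Iio j, Set.range (g m)) := by
  let _ := S.amb
  rintro ⟨g, hg⟩
  have h1 : S.Astar ∪ Set.range S.c ⊆ S.Ma := Set.union_subset S.kc.sub S.range_c
  refine hdim ⟨g, fun j => ⟨(hg j).1, sameTypeOver_iff.2 (hg j).2.1, ?_⟩⟩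
  refine (not_tupForksOver_iff (S.small_Ma.mono (Set.union_subset h1 (Set.iUnion₂_subset
    fun m _ => Set.range_subset_iff.2 (hg m).1))) Set.subset_union_left).2 ?_
  exact (hg j).2.2.mono subset_rfl (Set.union_comm _ _).subset

/-- The base over which the weight is computed. -/
def base : Set M := S.Astar ∪ ⋃ i ∈ Set.Iio S.k, Set.range (S.cseq i)

theorem base_subset : S.base ⊆ S.Ma :=
  Set.union_subset S.kc.sub (Set.iUnion₂_subset fun i _ => Set.range_subset_iff.2 (S.cseqMa i))

theorem range_cseq {i : ℕ} (hi : i < S.k) : Set.range (S.cseq i) ⊆ S.base :=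
  (Set.subset_biUnion_of_mem (u := fun i => Set.range (S.cseq i)) (Set.mem_Iio.2 hi)).trans
    Set.subset_union_right

theorem exists_basis (hdim : DimFinite (L := L) (S.Astar ∪ Set.range S.c) S.dstar S.Ma) :
    let _ := S.amb
    ∃ J : Finset (RegElt L (Set.range S.c) S.dstar S.base), ∀ i < S.k,
      ∀ d ∈ copies L S.c S.dstar (S.cseq i) S.Ma,
        ¬ Ind L (Set.range (S.cseq i)) (Set.range d)
          (RegElt.span (J : Set (RegElt L (Set.range S.c) S.dstar S.base))) := by
  let _ := S.amb
  classical
  have hc0 : ∀ d, Eqv L ∅ (Sum.elim S.c S.dstar) (Sum.elim S.c d) →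
      NO L (Set.range S.c) d (Set.range S.c) S.dstar := by
    have := S.no_cseq 0
    rwa [S.cseq0] at this
  have key : ∀ i, ∃ J : Finset (RegElt L (Set.range S.c) S.dstar S.base), i < S.k →
      ∀ d ∈ copies L S.c S.dstar (S.cseq i) S.Ma,
        ¬ Ind L (Set.range (S.cseq i)) (Set.range d)
          (RegElt.span (J : Set (RegElt L (Set.range S.c) S.dstar S.base))) := fun i => by
    by_cases hi : i < S.k
    · have h0 : Set.range S.c ⊆ S.base := by
        have := S.range_cseq (pos_of_gt hi)
        rwa [S.cseq0] at this
      obtain ⟨J, hJ⟩ := exists_span S.regular S.stat S.small_Ma S.homog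
        (B := S.Astar ∪ Set.range S.c) Set.subset_union_right
        (Set.union_subset Set.subset_union_left h0) S.base_subset hc0 S.ind_dstar
        (S.not_dim hdim) (S.range_cseq hi) (S.no_cseq i)
      exact ⟨J, fun _ => hJ⟩
    · exact ⟨∅, fun h => absurd h hi⟩
  choose J hJ using key
  refine ⟨(Finset.range S.k).biUnion J, fun i hi d hd hI => hJ i hi d hd (hI.down ?_)⟩
  refine Set.union_subset_union_right _ (Set.biUnion_subset_biUnion_left fun x hx => ?_)
  exact Finset.mem_coe.2 (Finset.mem_biUnion.2 ⟨i, Finset.mem_range.2 hi, hx⟩)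

/-- Realizations of `q` in `Ma` are algebraic over the base and the copies in `Ma`. -/
theorem qSet_subset {W : Set M} (hW : S.base ⊆ W)
    (hW' : ∀ i < S.k, ∀ d ∈ copies L S.c S.dstar (S.cseq i) S.Ma, Set.range d ⊆ W) :
    qSet (L := L) (aclSet (L := L) S.C) S.e S.Ma ⊆ aclSet (L := L) (aclSet (L := L) W) := by
  rintro x ⟨hx, hxe⟩
  have hbase : aclSet (L := L) S.C ∪ (⋃ i ∈ Set.Iio S.k, Set.range (S.cseq i)) ⊆
      aclSet (L := L) S.Astar ∪ S.base :=
    Set.union_subset_union (aclSet_mono S.hCsub) Set.subset_union_right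
  refine mem_aclSet_of_copies (C := aclSet (L := L) S.C ∪ (⋃ i ∈ Set.Iio S.k, Set.range (S.cseq i)))
    (c := S.c) (s := S.dstar) (f := S.cseq) (k := S.k) S.homog hx
    (hbase.trans (Set.union_subset S.acl_Astar S.base_subset)) (fun i hi =>
      (Set.subset_biUnion_of_mem (u := fun i => Set.range (S.cseq i)) (Set.mem_Iio.2 hi)).trans
        Set.subset_union_right) (aclSet_mono (Set.union_subset_union_right _ ?_) (S.qAcl x hxe))
    (hbase.trans (Set.union_subset (aclSet_mono (Set.subset_union_left.trans hW))
      (hW.trans subset_aclSet))) fun i hi d hd => (hW' i hi d hd).trans subset_aclSet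
  rintro y ⟨d, i, hi, hd, hy⟩
  refine ⟨d, i, hi, ?_, hy⟩
  have := ((sameTypeOver_iff.1 hd).mono (Set.empty_subset _)).symm.comp Sum.swap
  simpa only [Sum.elim_swap] using this

theorem wP_le (hdim : DimFinite (L := L) (S.Astar ∪ Set.range S.c) S.dstar S.Ma) :
    ∃ n : ℕ, wP (L := L) S.Ma S.dstar (qSet (L := L) (aclSet (L := L) S.C) S.e S.Ma) S.base ≤ n := by
  let _ := S.amb
  obtain ⟨J, hJ⟩ := S.exists_basis hdim
  have hY : Small L S.base := S.small_Ma.mono S.base_subset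
  refine ⟨J.card, csSup_le' ?_⟩
  rintro _ ⟨I, rfl, hI, hP⟩
  refine card_le_of_indepFamily S.regular S.stat hY hI J fun t ht => ?_
  obtain ⟨⟨h1, h2, h3⟩, h4⟩ := hP t ht
  let g : RegElt L (Set.range S.c) S.dstar S.base :=
    { n := t.1
      base := S.base
      val := t.2
      sub := subset_rfl
      reg := h1.reg
      stat := h2.stat
      no := (no_of_not_typesOrthogonal hY S.small_Ma h2.stat h3).of_base S.small_Ma S.range_c
        S.ind_dstar }
  refine ⟨g, rfl, rfl, by_contra fun hg => ?_⟩
  let W : Set M := S.base ∪ ⋃ i ∈ Set.Iio S.k, ⋃ d ∈ copies L S.c S.dstar (S.cseq i) S.Ma, Set.range d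
  have hWMa : W ⊆ S.Ma := Set.union_subset S.base_subset (Set.iUnion₂_subset fun i _ =>
    Set.iUnion₂_subset fun d hd => Set.range_subset_iff.2 hd.1)
  have hbW : S.base ⊆ W := Set.subset_union_left
  have key := RegElt.ind_acl_acl S.regular S.stat hY (S.small_Ma.mono hWMa) hbW
    (S.small_Ma.mono (S.kc.elem.aclSet_subset hWMa)) J g rfl (fun x hx => ?_) hg
  · have hq := S.qSet_subset hbW fun i hi d hd => (Set.subset_biUnion_of_mem hd).trans
      ((Set.subset_biUnion_of_mem (u := fun i => ⋃ d ∈ copies L S.c S.dstar (S.cseq i) S.Ma,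
        Set.range d) (Set.mem_Iio.2 hi)).trans Set.subset_union_right)
    refine h4.not_ind hY (S.small_Ma.mono (Set.union_subset S.base_subset fun x hx => hx.1))
      (key.down (Set.union_subset ?_ hq))
    exact hbW.trans (subset_aclSet.trans subset_aclSet)
  · refine hx.imp id fun hx => ?_
    simp only [Set.mem_iUnion] at hx
    obtain ⟨i, hi, d, hd, hx⟩ := hx
    exact ⟨RegElt.ofEqv S.regular S.stat (S.range_cseq hi) d hd.2 (S.no_cseq i d hd.2),
      hJ i hi d hd, hx⟩

end WSetup

/-- If `dim(r₀ ↾ (A_* ∪ c₀), M_a)` is finite, then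
`w_P(q(M_a), A_* ∪ ⋃_{i<k} c_i)` is finite. -/
theorem wP_finite_over_Astar_cseq {L : FirstOrder.Language.{u, u}} {M : Type u}
    [L.Structure M] (S : WSetup L M)
    (hdim : DimFinite (L := L) (S.Astar ∪ Set.range S.c) S.dstar S.Ma) :
    wP (L := L) S.Ma S.dstar (qSet (L := L) (aclSet (L := L) S.C) S.e S.Ma)
      (S.Astar ∪ ⋃ i ∈ Set.Iio S.k, Set.range (S.cseq i)) < ℵ₀ := by
  obtain ⟨n, hn⟩ := S.wP_le hdim
  exact hn.trans_lt Cardinal.natCast_lt_aleph0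

end Benign
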